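/- arXiv:1912.04745 — 2 statements merged into one kernel-verified Lean document; each statement's English description precedes it below -/
import Mathlib

section
/- Assume gcd(s+l,2l) = gcd(s,l) = d and d is odd. Then the number of quadruples (a,b,c,h) ∈ F_{p^s} × F_q × F_q × F_p for which the codeword c(a,b,c,h) has Hamming weight (p−1)(p^{m−1} − p^{s−1}) equals p^{m+d}(p^s+1)(p^m−1)/(2(p^d+1)). -/
/-- `trp p r z = z + z^p + ⋯ + z^(p^(r-1))`, the trace form used for `Tr_r`. -/
def trp (p r : ℕ) {F : Type} [Field F] (z : F) : F :=
  ∑ i ∈ Finset.range r, z ^ p ^ i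

/-- The codeword `c(a,b,c,h)` of the code `C`, viewed as a function on `F_q = F`;
its value at `x` is `Tr_s(a x^(p^s+1)) + Tr_m(b x^(p^l+1) + c x) + h` (the values
lie in the prime field `F_p ⊆ F`). Here `m = 2s`. -/
def cword (p s l : ℕ) {F : Type} [Field F] (a b c : F) (h : ZMod p) : F → F :=
  fun x => trp p s (a * x ^ (p ^ s + 1)) + trp p (2 * s) (b * x ^ (p ^ l + 1) + c * x)
    + ZMod.cast h

/-- The support of the codeword `c(a,b,c,h)`; its cardinality is the Hamming weight. -/
def suppw (p s l : ℕ) {F : Type} [Field F] [Fintype F] [DecidableEq F]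
    (a b c : F) (h : ZMod p) : Finset F :=
  Finset.univ.filter fun x => cword p s l a b c h x ≠ 0

section QuadraticCounting

variable {p : ℕ} [Fact p.Prime] {V : Type} [AddCommGroup V] [Module (ZMod p) V]

/-- A function which moves at constant nonzero speed along a direction `w` is equidistributed. -/
lemma card_mul_sum_fiber_of_shift (s : Finset V) (f : V → ZMod p) (w : V) (c : ZMod p)
    (hc : c ≠ 0) (hs : ∀ x ∈ s, ∀ k : ZMod p, x + k • w ∈ s)
    (hf : ∀ x k, f (x + k • w) = f x + k * c) (v : ZMod p) :
    (p : ℤ) * ∑ x ∈ s, (if f x = v then 1 else 0) = s.card := by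
  have key : ∀ u : ZMod p, (∑ x ∈ s, (if f x = u then 1 else 0) : ℤ)
      = ∑ x ∈ s, (if f x = v then 1 else 0) := by
    intro u
    refine Finset.sum_nbij' (fun x => x + ((v - u) / c) • w) (fun x => x + (-((v - u) / c)) • w)
      (fun x hx => hs x hx _) (fun x hx => hs x hx _) ?_ ?_ ?_
    · intro x _
      simp only [neg_smul]; abel
    · intro x _
      simp only [neg_smul]; abel
    · intro x _
      rw [hf, div_mul_cancel₀ _ hc]
      congr 1
      apply propext
      constructor <;> intro h <;> linear_combination h
  have tot : ∑ u : ZMod p, (∑ x ∈ s, (if f x = u then 1 else 0) : ℤ) = s.card := by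
    rw [Finset.sum_comm]
    simp
  rw [Finset.sum_congr rfl (fun u _ => key u)] at tot
  simpa [ZMod.card] using tot

variable [Fintype V]

/-- The number of representations of `v` by the quadratic form `x ↦ B x x`. -/
def reprCount (B : V →ₗ[ZMod p] V →ₗ[ZMod p] ZMod p) (v : ZMod p) : ℤ :=
  ∑ x, (if B x x = v then 1 else 0)

open Classical in
/-- The number of vectors in the radical of `B`. -/
noncomputable def radCount (B : V →ₗ[ZMod p] V →ₗ[ZMod p] ZMod p) : ℤ :=
  ∑ x, (if B x = 0 then 1 else 0)

variable (B : V →ₗ[ZMod p] V →ₗ[ZMod p] ZMod p)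

lemma sum_comp_form (g : ZMod p → ℤ) : ∑ x, g (B x x) = ∑ w, reprCount B w * g w := by
  simp only [reprCount, Finset.sum_mul]
  rw [Finset.sum_comm]
  refine Finset.sum_congr rfl fun x _ => ?_
  simp

lemma sum_reprCount : ∑ v, reprCount B v = Fintype.card V := by
  have := sum_comp_form B (fun _ => 1)
  simpa using this.symm

lemma reprCount_mul_sq {c : ZMod p} (hc : c ≠ 0) (v : ZMod p) :
    reprCount B (c ^ 2 * v) = reprCount B v := by
  unfold reprCount
  symm
  refine Fintype.sum_equiv (LinearEquiv.smulOfUnit (Units.mk0 c hc)).toEquiv _ _ fun x => ?_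
  congr 1
  apply propext
  have : ((LinearEquiv.smulOfUnit (Units.mk0 c hc)).toEquiv x : V) = c • x := rfl
  rw [this]
  simp only [map_smul, LinearMap.smul_apply, smul_eq_mul]
  constructor
  · intro h; rw [h]; ring
  · intro h
    have h2 : c ^ 2 * (B x x - v) = 0 := by linear_combination h
    have := (mul_eq_zero.mp h2).resolve_left (pow_ne_zero _ hc)
    linear_combination this

lemma conv_reprCount (v : ZMod p) : ∑ w, reprCount B w * reprCount B (v - w)
    = ∑ x, ∑ y, (if B x x + B y y = v then 1 else 0) := by
  rw [← sum_comp_form B (fun w => reprCount B (v - w))]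
  refine Finset.sum_congr rfl fun x _ => ?_
  unfold reprCount
  refine Finset.sum_congr rfl fun y _ => ?_
  congr 1
  apply propext
  constructor <;> intro h <;> linear_combination h

lemma conv_reprCount_mul {u : ZMod p} (hu : u ≠ 0) (v : ZMod p) :
    ∑ w, reprCount B w * reprCount B (u * v - w) = ∑ w, reprCount B w * reprCount B (v - w) := by
  obtain ⟨a, b, hab⟩ := ZMod.sq_add_sq p u
  rw [conv_reprCount, conv_reprCount]
  rw [← Fintype.sum_prod_type', ← Fintype.sum_prod_type']
  symm
  let e : V × V ≃ V × V :=
    { toFun := fun z => (a • z.1 + b • z.2, (-b) • z.1 + a • z.2)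
      invFun := fun z => (u⁻¹ • (a • z.1 + (-b) • z.2), u⁻¹ • (b • z.1 + a • z.2))
      left_inv := fun z => by
        ext
        · simp only [smul_add, smul_smul]
          have h1 : (u⁻¹ * (a * a)) • z.1 + (u⁻¹ * (-b * -b)) • z.1 = z.1 := by
            rw [← add_smul]
            have : u⁻¹ * (a * a) + u⁻¹ * (-b * -b) = 1 := by field_simp; linear_combination hab
            rw [this, one_smul]
          have h2 : (u⁻¹ * (a * b)) • z.2 + (u⁻¹ * (-b * a)) • z.2 = 0 := by
            rw [← add_smul]
            have : u⁻¹ * (a * b) + u⁻¹ * (-b * a) = 0 := by ring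
            rw [this, zero_smul]
          rw [add_add_add_comm, h1, h2, add_zero]
        · simp only [smul_add, smul_smul]
          have h1 : (u⁻¹ * (b * a)) • z.1 + (u⁻¹ * (a * -b)) • z.1 = 0 := by
            rw [← add_smul]
            have : u⁻¹ * (b * a) + u⁻¹ * (a * -b) = 0 := by ring
            rw [this, zero_smul]
          have h2 : (u⁻¹ * (b * b)) • z.2 + (u⁻¹ * (a * a)) • z.2 = z.2 := by
            rw [← add_smul]
            have : u⁻¹ * (b * b) + u⁻¹ * (a * a) = 1 := by field_simp; linear_combination hab
            rw [this, one_smul]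
          rw [add_add_add_comm, h1, h2, zero_add]
      right_inv := fun z => by
        ext
        · simp only [smul_add, smul_smul]
          have h1 : (a * (u⁻¹ * a)) • z.1 + (b * (u⁻¹ * b)) • z.1 = z.1 := by
            rw [← add_smul]
            have : a * (u⁻¹ * a) + b * (u⁻¹ * b) = 1 := by field_simp; linear_combination hab
            rw [this, one_smul]
          have h2 : (a * (u⁻¹ * -b)) • z.2 + (b * (u⁻¹ * a)) • z.2 = 0 := by
            rw [← add_smul]
            have : a * (u⁻¹ * -b) + b * (u⁻¹ * a) = 0 := by ring
            rw [this, zero_smul]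
          rw [add_add_add_comm, h1, h2, add_zero]
        · simp only [smul_add, smul_smul]
          have h1 : (-b * (u⁻¹ * a)) • z.1 + (a * (u⁻¹ * b)) • z.1 = 0 := by
            rw [← add_smul]
            have : -b * (u⁻¹ * a) + a * (u⁻¹ * b) = 0 := by ring
            rw [this, zero_smul]
          have h2 : (-b * (u⁻¹ * -b)) • z.2 + (a * (u⁻¹ * a)) • z.2 = z.2 := by
            rw [← add_smul]
            have : -b * (u⁻¹ * -b) + a * (u⁻¹ * a) = 1 := by field_simp; linear_combination hab
            rw [this, one_smul]
          rw [add_add_add_comm, h1, h2, zero_add] }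
  refine Fintype.sum_equiv e _ _ fun z => ?_
  congr 1
  apply propext
  have : B (e z).1 (e z).1 + B (e z).2 (e z).2 = u * (B z.1 z.1 + B z.2 z.2) := by
    change B (a • z.1 + b • z.2) (a • z.1 + b • z.2)
      + B ((-b) • z.1 + a • z.2) ((-b) • z.1 + a • z.2) = _
    simp only [map_add, map_smul, LinearMap.add_apply, LinearMap.smul_apply, smul_eq_mul]
    rw [← hab]; ring
  rw [this]
  constructor
  · intro h; rw [h]
  · intro h; exact mul_left_cancel₀ hu h

lemma exists_nonsquare_reprCount (hp : p ≠ 2) : ∃ n : ZMod p, n ≠ 0 ∧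
    ∀ v : ZMod p, v ≠ 0 → (reprCount B v = reprCount B 1 ∧ reprCount B (n * v) = reprCount B n) ∨
      (reprCount B v = reprCount B n ∧ reprCount B (n * v) = reprCount B 1) := by
  have hchar : ringChar (ZMod p) ≠ 2 := by rwa [ZMod.ringChar_zmod_n]
  obtain ⟨n, hn⟩ := FiniteField.exists_nonsquare hchar
  have hn0 : n ≠ 0 := by rintro rfl; exact hn (IsSquare.zero)
  have hsq : ∀ {t : ZMod p}, t ≠ 0 → IsSquare t → ∀ u, reprCount B (t * u) = reprCount B u := by
    rintro t ht ⟨r, rfl⟩ u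
    have hr : r ≠ 0 := by rintro rfl; simp at ht
    rw [← pow_two]
    exact reprCount_mul_sq B hr u
  refine ⟨n, hn0, fun v hv => ?_⟩
  by_cases hs : IsSquare v
  · left
    refine ⟨by simpa using hsq hv hs 1, ?_⟩
    rw [mul_comm]; exact hsq hv hs n
  · right
    have hnv : IsSquare (n * v) := by
      rw [← quadraticChar_one_iff_isSquare (mul_ne_zero hn0 hv), map_mul,
        (quadraticChar_neg_one_iff_not_isSquare).mpr hn,
        (quadraticChar_neg_one_iff_not_isSquare).mpr hs]
      norm_num
    refine ⟨?_, by simpa using hsq (mul_ne_zero hn0 hv) hnv 1⟩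
    have h1 := hsq (mul_ne_zero hn0 hv) hnv n
    rw [← h1, show n * v * n = n ^ 2 * v by ring, reprCount_mul_sq B hn0]

lemma reprCount_const_or_balanced (hp : p ≠ 2) :
    (∀ v : ZMod p, v ≠ 0 → reprCount B v = reprCount B 1) ∨
    ((p : ℤ) * reprCount B 0 = Fintype.card V ∧ ∀ v : ZMod p, v ≠ 0 →
      ((p : ℤ) * reprCount B v - Fintype.card V) ^ 2
        = ((p : ℤ) * reprCount B 1 - Fintype.card V) ^ 2) := by
  obtain ⟨n, hn0, hn⟩ := exists_nonsquare_reprCount B hp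
  have hperm : ∀ g : ZMod p → ℤ, ∑ w, g (n * w) = ∑ w, g w := fun g =>
    Fintype.sum_equiv (Equiv.mulLeft₀ n hn0) _ _ fun _ => rfl
  have hsum : ∑ w, (reprCount B w - reprCount B (n * w)) = 0 := by
    rw [Finset.sum_sub_distrib, hperm, sub_self]
  have hS : ∀ v, reprCount B v + reprCount B (n * v) = (reprCount B 1 + reprCount B n)
      + (if v = 0 then 2 * reprCount B 0 - (reprCount B 1 + reprCount B n) else 0) := by
    intro v
    split_ifs with h
    · subst h; rw [mul_zero]; ring
    · rcases hn v h with ⟨h1, h2⟩ | ⟨h1, h2⟩ <;> rw [h1, h2] <;> ring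
  have hconv : ∑ w, (reprCount B w - reprCount B (n * w))
      * (reprCount B (1 - w) + reprCount B (n * (1 - w))) = 0 := by
    have h1 : ∑ w, reprCount B w * reprCount B (n * (1 - w))
        = ∑ w, reprCount B (n * w) * reprCount B (1 - w) := by
      refine Fintype.sum_equiv (Equiv.subLeft 1) _ _ fun w => ?_
      simp only [Equiv.subLeft_apply, sub_sub_cancel]
      ring
    have h2 : ∑ w, reprCount B (n * w) * reprCount B (n * (1 - w))
        = ∑ w, reprCount B w * reprCount B (1 - w) := by
      rw [← conv_reprCount_mul B hn0 1, ← hperm (fun w => reprCount B w * reprCount B (n * 1 - w))]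
      simp only [mul_sub]
    simp only [sub_mul, mul_add, Finset.sum_sub_distrib, Finset.sum_add_distrib]
    linarith
  have hprod : (reprCount B 1 - reprCount B n)
      * (2 * reprCount B 0 - (reprCount B 1 + reprCount B n)) = 0 := by
    simp only [hS (1 - _), mul_add, Finset.sum_add_distrib, ← Finset.sum_mul, hsum, zero_mul,
      zero_add, sub_eq_zero, mul_ite, mul_zero] at hconv
    rw [Finset.sum_ite_eq] at hconv
    simpa using hconv
  rcases mul_eq_zero.mp hprod with h | h
  · left
    intro v hv
    rcases hn v hv with ⟨h1, h2⟩ | ⟨h1, h2⟩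
    · exact h1
    · rw [h1]; linarith
  · right
    have htot : ∑ v, (reprCount B v + reprCount B (n * v)) = 2 * Fintype.card V := by
      rw [Finset.sum_add_distrib, hperm, sum_reprCount]; ring
    simp only [hS, h, ite_self, add_zero, Finset.sum_const, Finset.card_univ, ZMod.card,
      nsmul_eq_mul] at htot
    constructor
    · have h0 : 2 * reprCount B 0 = reprCount B 1 + reprCount B n := by linarith
      rw [← h0] at htot
      linarith
    · intro v hv
      rcases hn v hv with ⟨h1, h2⟩ | ⟨h1, h2⟩
      · rw [h1]
      · rw [h1]
        have : (p : ℤ) * reprCount B n - Fintype.card V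
            = -((p : ℤ) * reprCount B 1 - Fintype.card V) := by linarith
        rw [this]; ring

lemma mul_sum_reprCount_sq (hp : p ≠ 2) (hB : ∀ x y, B x y = B y x) :
    (p : ℤ) * ∑ v, reprCount B v ^ 2 = p * radCount B * Fintype.card V
      + (Fintype.card V - radCount B) * Fintype.card V := by
  have h2 : (2 : ZMod p) ≠ 0 := by
    have : ringChar (ZMod p) ≠ 2 := by rwa [ZMod.ringChar_zmod_n]
    exact Ring.two_ne_zero this
  have h1 : ∑ v, reprCount B v ^ 2 = ∑ u, ∑ w, (if B u w = 0 then 1 else 0 : ℤ) := by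
    simp only [pow_two]
    rw [← sum_comp_form B (fun w => reprCount B w)]
    unfold reprCount
    rw [← Fintype.sum_prod_type', ← Fintype.sum_prod_type']
    symm
    let e : V × V ≃ V × V :=
      { toFun := fun z => (z.1 + z.2, z.1 - z.2)
        invFun := fun z => ((2 : ZMod p)⁻¹ • (z.1 + z.2), (2 : ZMod p)⁻¹ • (z.1 - z.2))
        left_inv := fun z => by
          ext
          · simp only [add_add_sub_cancel, ← two_smul (ZMod p) z.1, smul_smul,
              inv_mul_cancel₀ h2, one_smul]
          · simp only [add_sub_sub_cancel, ← two_smul (ZMod p) z.2, smul_smul,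
              inv_mul_cancel₀ h2, one_smul]
        right_inv := fun z => by
          ext
          · simp only [← smul_add, add_add_sub_cancel, ← two_smul (ZMod p) z.1, smul_smul,
              inv_mul_cancel₀ h2, one_smul]
          · simp only [← smul_sub, add_sub_sub_cancel, ← two_smul (ZMod p) z.2, smul_smul,
              inv_mul_cancel₀ h2, one_smul] }
    refine Fintype.sum_equiv e _ _ fun z => ?_
    congr 1
    apply propext
    have he : B (e z).1 (e z).1 - B (e z).2 (e z).2 = 2 ^ 2 * B z.1 z.2 := by
      change B (z.1 + z.2) (z.1 + z.2) - B (z.1 - z.2) (z.1 - z.2) = _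
      simp only [map_add, map_sub, LinearMap.add_apply, LinearMap.sub_apply]
      rw [hB z.2 z.1]; ring
    constructor
    · intro h; rw [h] at he; linear_combination -he
    · intro h
      rw [h, sub_self] at he
      exact (mul_eq_zero.mp he.symm).resolve_left (pow_ne_zero _ h2)
  have h3 : ∀ u, (p : ℤ) * ∑ w, (if B u w = 0 then 1 else 0 : ℤ)
      = Fintype.card V + (if B u = 0 then 1 else 0) * ((p - 1) * Fintype.card V) := by
    intro u
    split_ifs with hu
    · simp [hu]; ring
    · obtain ⟨w, hw⟩ : ∃ w, B u w ≠ 0 := by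
        by_contra! h
        exact hu (LinearMap.ext h)
      rw [card_mul_sum_fiber_of_shift Finset.univ (fun x => B u x) w (B u w) hw (by simp) (by simp)]
      simp
  classical
  rw [h1, Finset.mul_sum, Finset.sum_congr rfl fun u _ => h3 u, Finset.sum_add_distrib,
    ← Finset.sum_mul]
  have : (∑ i, (if B i = 0 then 1 else 0) : ℤ) = radCount B := by
    unfold radCount
    refine Finset.sum_congr rfl fun x _ => ?_
    congr
  simp only [Finset.sum_const, Finset.card_univ, nsmul_eq_mul]
  rw [show (∑ i, (if B i = 0 then 1 else 0) : ℤ) = radCount B from this]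
  ring

/-- The value distribution of a quadratic form over `ZMod p`, in terms of the size of its radical:
the two cases correspond to even and odd rank. -/
theorem reprCount_dichotomy (hp : p ≠ 2) (hB : ∀ x y, B x y = B y x) :
    ((∀ v : ZMod p, v ≠ 0 → ((p : ℤ) - 1) * (p * reprCount B v - Fintype.card V)
        = -(p * reprCount B 0 - Fintype.card V)) ∧
      ((p : ℤ) * reprCount B 0 - Fintype.card V) ^ 2
        = ((p : ℤ) - 1) ^ 2 * (Fintype.card V * radCount B)) ∨
    ((p : ℤ) * reprCount B 0 - Fintype.card V = 0 ∧
      ∀ v : ZMod p, v ≠ 0 → ((p : ℤ) * reprCount B v - Fintype.card V) ^ 2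
        = p * (Fintype.card V * radCount B)) := by
  have hp0 : (p : ℤ) ≠ 0 := by exact_mod_cast (Fact.out : p.Prime).ne_zero
  have hp1 : (p : ℤ) - 1 ≠ 0 := by
    have := (Fact.out : p.Prime).one_lt
    omega
  have hsplit : ∀ g : ZMod p → ℤ, (∀ v ≠ 0, g v = g 1) → ∑ v, g v = g 0 + (p - 1) * g 1 := by
    intro g hg
    rw [← Finset.add_sum_erase _ _ (Finset.mem_univ (0 : ZMod p)),
      Finset.sum_congr rfl (fun v hv => hg v (Finset.ne_of_mem_erase hv))]
    simp [Finset.card_erase_of_mem, ZMod.card, Nat.cast_sub (Fact.out : p.Prime).one_le]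
  have hN := sum_reprCount B
  have hN2 := mul_sum_reprCount_sq B hp hB
  have hE : ∑ v, ((p : ℤ) * reprCount B v - Fintype.card V) ^ 2
      = p * (p - 1) * (Fintype.card V * radCount B) := by
    have : ∀ v, ((p : ℤ) * reprCount B v - Fintype.card V) ^ 2 = p ^ 2 * reprCount B v ^ 2
        - 2 * p * Fintype.card V * reprCount B v + (Fintype.card V : ℤ) ^ 2 := fun v => by ring
    simp only [this, Finset.sum_add_distrib, Finset.sum_sub_distrib, ← Finset.mul_sum, hN]
    simp only [Finset.sum_const, Finset.card_univ, ZMod.card, nsmul_eq_mul]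
    linear_combination (p : ℤ) * hN2
  rcases reprCount_const_or_balanced B hp with h | ⟨h0, h⟩
  · left
    rw [hsplit _ h] at hN
    have h1 : ((p : ℤ) - 1) * (p * reprCount B 1 - Fintype.card V)
        = -(p * reprCount B 0 - Fintype.card V) := by linear_combination (p : ℤ) * hN
    refine ⟨fun v hv => by rw [h v hv]; exact h1, ?_⟩
    rw [hsplit _ (fun v hv => by rw [h v hv])] at hE
    apply mul_left_cancel₀ hp0
    linear_combination ((p : ℤ) - 1) * hE - ((p : ℤ) - 1) *
      (p * reprCount B 1 - Fintype.card V) * h1 + (p * reprCount B 0 - Fintype.card V) * h1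
  · right
    refine ⟨by rw [h0, sub_self], fun v hv => ?_⟩
    rw [hsplit _ h, h0, sub_self] at hE
    rw [h v hv]
    apply mul_left_cancel₀ hp1
    linear_combination hE

lemma radCount_eq_card_ker : radCount B = Nat.card (LinearMap.ker B) := by
  classical
  unfold radCount
  rw [Finset.sum_boole, Nat.cast_inj, ← Fintype.card_subtype, ← Nat.card_eq_fintype_card]
  rfl

lemma radCount_eq_one_or_dvd {n : ℕ} (hV : Fintype.card V = p ^ n) :
    radCount B = 1 ∨ (p : ℤ) ∣ radCount B := by
  have h : Nat.card (LinearMap.ker B) ∣ p ^ n := by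
    rw [← hV, ← Nat.card_eq_fintype_card]
    exact AddSubgroup.card_addSubgroup_dvd_card (LinearMap.ker B).toAddSubgroup
  obtain ⟨k, -, hk⟩ := (Nat.dvd_prime_pow Fact.out).mp h
  rw [radCount_eq_card_ker, hk]
  rcases k with _ | k
  · left; simp
  · right; exact_mod_cast dvd_pow_self p k.succ_ne_zero

lemma exists_eq_of_forall_ker (hB : ∀ x y, B x y = B y x) (φ : V →ₗ[ZMod p] ZMod p)
    (h : ∀ w, B w = 0 → φ w = 0) : ∃ x₀, φ = B x₀ := by
  have hφ : φ ∈ LinearMap.range B.dualMap := by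
    rw [LinearMap.range_dualMap_eq_dualAnnihilator_ker, Submodule.mem_dualAnnihilator]
    exact fun w hw => h w hw
  obtain ⟨ψ, rfl⟩ := hφ
  obtain ⟨x₀, rfl⟩ := (Module.evalEquiv (ZMod p) V).surjective ψ
  refine ⟨x₀, LinearMap.ext fun y => ?_⟩
  simp [hB x₀ y]

/-- The number of zeros of the inhomogeneous form `x ↦ B x x + 2 φ x + 2 h`. -/
def zeroCount (φ : V →ₗ[ZMod p] ZMod p) (h : ZMod p) : ℤ :=
  ∑ x, (if B x x + 2 * φ x + 2 * h = 0 then 1 else 0)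

lemma zeroCount_eq_reprCount (hB : ∀ x y, B x y = B y x) (x₀ : V) (h : ZMod p) :
    zeroCount B (B x₀) h = reprCount B (B x₀ x₀ - 2 * h) := by
  refine Fintype.sum_equiv (Equiv.addRight x₀) _ _ fun x => ?_
  congr 1
  apply propext
  simp only [Equiv.coe_addRight, map_add, LinearMap.add_apply]
  rw [hB x x₀]
  constructor <;> intro h <;> linear_combination h

lemma mul_zeroCount_of_ne (hp : p ≠ 2) (hB : ∀ x y, B x y = B y x)
    (φ : V →ₗ[ZMod p] ZMod p) (h : ZMod p) {w : V} (hw : B w = 0) (hφ : φ w ≠ 0) :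
    (p : ℤ) * zeroCount B φ h = Fintype.card V := by
  have h2 : (2 : ZMod p) ≠ 0 := by
    have : ringChar (ZMod p) ≠ 2 := by rwa [ZMod.ringChar_zmod_n]
    exact Ring.two_ne_zero this
  have hw' : ∀ x, B x w = 0 := fun x => by rw [hB, hw]; rfl
  refine card_mul_sum_fiber_of_shift Finset.univ (fun x => B x x + 2 * φ x + 2 * h) w (2 * φ w)
    (mul_ne_zero h2 hφ) (by simp) (fun x k => ?_) 0
  simp only [map_add, map_smul, LinearMap.add_apply, LinearMap.smul_apply, hw, hw', smul_eq_mul,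
    LinearMap.zero_apply]
  ring

/-- `B` is nondegenerate and has the value distribution of a hyperbolic form. -/
def IsHyperbolicCount (s : ℕ) : Prop :=
  radCount B = 1 ∧ (p : ℤ) * reprCount B 0 - p ^ (2 * s) = (p - 1) * p ^ s

lemma eq_zero_of_reprCount {s : ℕ} (hp : p ≠ 2) (hB : ∀ x y, B x y = B y x)
    (hV : Fintype.card V = p ^ (2 * s)) {v : ZMod p}
    (hv : (p : ℤ) * reprCount B v - p ^ (2 * s) = (p - 1) * p ^ s) :
    v = 0 ∧ radCount B = 1 := by
  have hpp : p.Prime := Fact.out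
  have hq : ((p : ℤ) ^ (2 * s)) ≠ 0 := pow_ne_zero _ (by exact_mod_cast hpp.ne_zero)
  have hp3 : (3 : ℤ) ≤ p := by
    have := hpp.two_le
    have : 3 ≤ p := by omega
    exact_mod_cast this
  have hsq : ((p : ℤ) ^ s) ^ 2 = p ^ (2 * s) := by rw [← pow_mul, mul_comm]
  have hndvd : ¬ (p : ℤ) ∣ ((p : ℤ) - 1) ^ 2 := by
    intro h
    have h1 := (Nat.prime_iff_prime_int.mp hpp).dvd_of_dvd_pow h
    have h2 : (p : ℤ) ∣ 1 := by simpa using dvd_sub (dvd_refl (p : ℤ)) h1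
    have := Int.le_of_dvd one_pos h2
    omega
  have hcard : (Fintype.card V : ℤ) = p ^ (2 * s) := by rw [hV]; push_cast; rfl
  rcases reprCount_dichotomy B hp hB with ⟨h1, h2⟩ | ⟨h1, h2⟩ <;> rw [hcard] at h1 h2
  · by_cases hv0 : v = 0
    · subst hv0
      refine ⟨rfl, ?_⟩
      rw [hv, mul_pow, hsq] at h2
      have h3 : ((p : ℤ) - 1) ^ 2 * p ^ (2 * s) * radCount B
          = ((p : ℤ) - 1) ^ 2 * p ^ (2 * s) * 1 := by linear_combination -h2
      exact mul_left_cancel₀ (mul_ne_zero (pow_ne_zero _ (by omega)) hq) h3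
    · exfalso
      have h3 := h1 v hv0
      have h4 : ((p : ℤ) - 1) ^ 2 = radCount B := by
        rw [hv] at h3
        rw [← neg_sq, ← h3] at h2
        have h5 : ((p : ℤ) - 1) ^ 2 * p ^ (2 * s) * ((p : ℤ) - 1) ^ 2
          = ((p : ℤ) - 1) ^ 2 * p ^ (2 * s) * radCount B := by
          rw [← hsq] at h2 ⊢; linear_combination h2
        exact mul_left_cancel₀ (mul_ne_zero (pow_ne_zero _ (by omega)) hq) h5
      rcases radCount_eq_one_or_dvd B hV with h6 | h6
      · rw [h6] at h4; nlinarith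
      · rw [← h4] at h6; exact hndvd h6
  · exfalso
    by_cases hv0 : v = 0
    · subst hv0
      rw [hv] at h1
      have : (0 : ℤ) < ((p : ℤ) - 1) * p ^ s := mul_pos (by omega) (by positivity)
      omega
    · have h3 := h2 v hv0
      rw [hv, mul_pow, hsq] at h3
      have h5 : (p : ℤ) ^ (2 * s) * ((p : ℤ) - 1) ^ 2 = p ^ (2 * s) * (p * radCount B) := by
        linear_combination h3
      exact hndvd ⟨_, mul_left_cancel₀ hq h5⟩

lemma card_zeroCount_eq {s : ℕ} (hp : p ≠ 2) (hB : ∀ x y, B x y = B y x)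
    (hV : Fintype.card V = p ^ (2 * s)) (φ : V →ₗ[ZMod p] ZMod p)
    [Decidable (IsHyperbolicCount B s)] :
    (Finset.univ.filter fun h : ZMod p =>
      (p : ℤ) * zeroCount B φ h - p ^ (2 * s) = (p - 1) * p ^ s).card
      = if IsHyperbolicCount B s then 1 else 0 := by
  have hpp : p.Prime := Fact.out
  have h2 : (2 : ZMod p) ≠ 0 := by
    have : ringChar (ZMod p) ≠ 2 := by rwa [ZMod.ringChar_zmod_n]
    exact Ring.two_ne_zero this
  have hpos : (0 : ℤ) < ((p : ℤ) - 1) * p ^ s := by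
    have := hpp.one_lt
    have := hpp.pos
    exact mul_pos (by omega) (by positivity)
  by_cases hφ : ∀ w, B w = 0 → φ w = 0
  · obtain ⟨x₀, rfl⟩ := exists_eq_of_forall_ker B hB φ hφ
    split_ifs with hyp
    · rw [Finset.card_eq_one]
      refine ⟨B x₀ x₀ / 2, ?_⟩
      ext h
      simp only [Finset.mem_filter, Finset.mem_univ, true_and, Finset.mem_singleton]
      rw [zeroCount_eq_reprCount B hB]
      constructor
      · intro hh
        have := (eq_zero_of_reprCount B hp hB hV hh).1
        field_simp
        linear_combination -this
      · rintro rfl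
        rw [mul_div_cancel₀ _ h2, sub_self]
        exact hyp.2
    · rw [Finset.card_eq_zero, Finset.filter_eq_empty_iff]
      intro h _ hh
      rw [zeroCount_eq_reprCount B hB] at hh
      have h3 := eq_zero_of_reprCount B hp hB hV hh
      rw [h3.1] at hh
      exact hyp ⟨h3.2, hh⟩
  · push Not at hφ
    obtain ⟨w, hw, hw'⟩ := hφ
    have hZ := fun h => mul_zeroCount_of_ne B hp hB φ h hw hw'
    rw [if_neg]
    · rw [Finset.card_eq_zero, Finset.filter_eq_empty_iff]
      intro h _ hh
      rw [hZ, hV] at hh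
      push_cast at hh
      omega
    · rintro ⟨h1, -⟩
      have hw0 : w = 0 := by
        rw [radCount_eq_card_ker] at h1
        have h1 : Nat.card (LinearMap.ker B) = 1 := by exact_mod_cast h1
        have := (Nat.card_eq_one_iff_unique.mp h1).1
        exact congrArg Subtype.val (Subsingleton.elim (⟨w, hw⟩ : LinearMap.ker B) 0)
      exact hw' (by rw [hw0, map_zero])

end QuadraticCounting

/-- A finite field of order `p ^ (2 * s)` with an involution `τ`, a commuting automorphism `σ`
agreeing with `τ` exactly on a subfield of order `p ^ d` fixed by both, and an invariant
nondegenerate trace. -/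
structure ConjugationData (p s d : ℕ) [Fact p.Prime] (F : Type) [Field F] [Fintype F]
    [DecidableEq F] [Algebra (ZMod p) F] where
  τ : F ≃+* F
  σ : F ≃+* F
  tr : F →ₗ[ZMod p] ZMod p
  p_ne_two : p ≠ 2
  two_ne_zero : (2 : F) ≠ 0
  τ_τ : ∀ x, τ (τ x) = x
  σ_τ : ∀ x, σ (τ x) = τ (σ x)
  τ_eq_of_σ_eq : ∀ x, σ x = τ x → τ x = x
  tr_τ : ∀ x, tr (τ x) = tr x
  tr_σ : ∀ x, tr (σ x) = tr x
  tr_nondeg : ∀ a, a ≠ 0 → ∃ b, tr (a * b) ≠ 0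
  card_eq : Fintype.card F = p ^ (2 * s)
  card_fixed : (Finset.univ.filter fun x => τ x = x).card = p ^ s
  card_agree : (Finset.univ.filter fun x => σ x = τ x).card = p ^ d

namespace ConjugationData

variable {p s d : ℕ} [Fact p.Prime] {F : Type} [Field F] [Fintype F] [DecidableEq F]
  [Algebra (ZMod p) F] (D : ConjugationData p s d F)

/-- The fixed field of `τ`. -/
def fixed : Finset F := Finset.univ.filter fun x => D.τ x = x

lemma mem_fixed {x : F} : x ∈ D.fixed ↔ D.τ x = x := by simp [fixed]

/-- The linearized polynomial attached to the form with parameters `a`, `b`. -/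
def lin (a b x : F) : F := a * D.τ x + b * D.σ x + D.σ.symm (b * x)

lemma lin_add (a b x y : F) : D.lin a b (x + y) = D.lin a b x + D.lin a b y := by
  simp only [lin, map_add, mul_add]; ring

lemma lin_smul (a b : F) (k : ZMod p) (x : F) : D.lin a b (k • x) = k • D.lin a b x := by
  simp only [lin, ZMod.map_smul, mul_smul_comm, smul_add]

/-- The bilinear form `(x, y) ↦ tr (y * lin a b x)`. -/
def form (a b : F) : F →ₗ[ZMod p] F →ₗ[ZMod p] ZMod p :=
  LinearMap.mk₂ (ZMod p) (fun x y => D.tr (y * D.lin a b x))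
    (fun x x' y => by rw [lin_add, mul_add, map_add])
    (fun k x y => by rw [lin_smul, mul_smul_comm, map_smul])
    (fun x y y' => by rw [add_mul, map_add])
    (fun k x y => by rw [smul_mul_assoc, map_smul])

@[simp]
lemma form_apply (a b x y : F) : D.form a b x y = D.tr (y * D.lin a b x) := rfl

lemma tr_σ_symm (x : F) : D.tr (D.σ.symm x) = D.tr x := by
  rw [← D.tr_σ (D.σ.symm x), D.σ.apply_symm_apply]

lemma form_symm {a : F} (ha : D.τ a = a) (b x y : F) : D.form a b x y = D.form a b y x := by
  simp only [form_apply, lin, mul_add, map_add]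
  have h1 : D.tr (y * (a * D.τ x)) = D.tr (x * (a * D.τ y)) := by
    rw [← D.tr_τ]
    simp only [map_mul, D.τ_τ, ha]
    congr 1; ring
  have h2 : ∀ x y, D.tr (y * (b * D.σ x)) = D.tr (x * D.σ.symm (b * y)) := by
    intro x y
    rw [← D.tr_σ_symm]
    simp only [map_mul, D.σ.symm_apply_apply]
    congr 1; ring
  rw [h1, h2, h2 y x]; ring

lemma form_self (a b x : F) :
    D.form a b x x = D.tr (a * (x * D.τ x) + 2 * (b * (x * D.σ x))) := by
  simp only [form_apply, lin, mul_add]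
  rw [map_add, ← D.tr_σ (x * D.σ.symm (b * x)), ← map_add]
  simp only [map_mul, D.σ.apply_symm_apply]
  congr 1; ring

lemma form_eq_zero_iff (a b x : F) : D.form a b x = 0 ↔ D.lin a b x = 0 := by
  constructor
  · intro h
    by_contra hx
    obtain ⟨y, hy⟩ := D.tr_nondeg _ hx
    apply hy
    have := LinearMap.congr_fun h y
    rwa [form_apply, mul_comm] at this
  · intro h
    ext y
    simp [h]

/-- The number of isotropic vectors of `D.form a b`. -/
def isoCount (a b : F) : ℤ := reprCount (D.form a b) 0

/-- The number of vectors in the radical of `D.form a b`. -/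
def kerCount (a b : F) : ℤ := ∑ x, (if D.lin a b x = 0 then 1 else 0)

lemma radCount_form (a b : F) : radCount (D.form a b) = D.kerCount a b := by
  classical
  unfold radCount kerCount
  refine Finset.sum_congr rfl fun x _ => ?_
  simp only [D.form_eq_zero_iff]

lemma lin_scale (a b x t : F) :
    D.lin (a * (x * D.τ x)) (b * (x * D.σ x)) t = x * D.lin a b (x * t) := by
  simp only [lin, map_mul, D.σ.symm_apply_apply]; ring

lemma kerCount_scale (a b : F) {x : F} (hx : x ≠ 0) :
    D.kerCount (a * (x * D.τ x)) (b * (x * D.σ x)) = D.kerCount a b := by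
  refine Fintype.sum_equiv (Equiv.mulLeft₀ x hx) _ _ fun t => ?_
  simp [lin_scale, hx]

lemma isoCount_scale (a b : F) {x : F} (hx : x ≠ 0) :
    D.isoCount (a * (x * D.τ x)) (b * (x * D.σ x)) = D.isoCount a b := by
  refine Fintype.sum_equiv (Equiv.mulLeft₀ x hx) _ _ fun t => ?_
  have : D.form (a * (x * D.τ x)) (b * (x * D.σ x)) t t = D.form a b (x * t) (x * t) := by
    simp only [form_apply, lin_scale]
    rw [← mul_assoc, mul_comm t x]
  rw [this]
  rfl

lemma eq_zero_of_neg {v : F} (h1 : D.σ v = -v) (h2 : D.τ v = -v) : v = 0 := by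
  have h3 := D.τ_eq_of_σ_eq v (h1.trans h2.symm)
  have h4 : 2 * v = 0 := by linear_combination h2 - h3
  exact (mul_eq_zero.mp h4).resolve_left D.two_ne_zero

lemma τ_σ_symm (x : F) : D.τ (D.σ.symm x) = D.σ.symm (D.τ x) := by
  apply D.σ.injective
  rw [D.σ_τ, D.σ.apply_symm_apply, D.σ.apply_symm_apply]

lemma τ_eq_of_lin_eq_zero {a : F} (ha : D.τ a = a) {b x : F} (h : D.lin a b x = 0) :
    D.τ (b * (x * D.σ x)) = b * (x * D.σ x) := by
  have h1 : a * (x * D.τ x) + b * (x * D.σ x) + D.σ.symm (b * (x * D.σ x)) = 0 := by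
    have : x * D.lin a b x = 0 := by rw [h, mul_zero]
    rw [← this]
    simp only [lin, map_mul, D.σ.symm_apply_apply]; ring
  generalize b * (x * D.σ x) = u at h1 ⊢
  have h2 := congrArg D.τ h1
  rw [map_add, map_add, map_mul, map_mul, ha, D.τ_τ, D.τ_σ_symm, map_zero] at h2
  have h3 : D.σ.symm (D.τ u - u) = -(D.τ u - u) := by
    rw [map_sub]
    linear_combination h2 - h1
  refine sub_eq_zero.mp (D.eq_zero_of_neg (v := D.τ u - u) ?_ ?_)
  · apply D.σ.symm.injective
    rw [D.σ.symm_apply_apply, map_neg, h3, neg_neg]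
  · rw [map_sub, D.τ_τ]; ring

lemma sum_lin_one (f : F → F → ℤ) :
    ∑ a ∈ D.fixed, ∑ b, (if D.lin a b 1 = 0 then f a b else 0)
      = ∑ b ∈ D.fixed, f (-(b + D.σ.symm b)) b := by
  rw [Finset.sum_comm]
  have hfix : ∀ b, (-(b + D.σ.symm b)) ∈ D.fixed ↔ b ∈ D.fixed := by
    intro b
    rw [mem_fixed, mem_fixed]
    constructor
    · intro h
      have := D.τ_eq_of_lin_eq_zero h (b := b) (x := 1) (by simp [lin])
      simpa using this
    · intro h
      rw [map_neg, map_add, D.τ_σ_symm, h]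
  have : ∀ b, ∑ a ∈ D.fixed, (if D.lin a b 1 = 0 then f a b else 0)
      = if b ∈ D.fixed then f (-(b + D.σ.symm b)) b else 0 := by
    intro b
    rw [← if_congr (hfix b) rfl rfl,
      ← Finset.sum_ite_eq' D.fixed (-(b + D.σ.symm b)) (fun a => f a b)]
    refine Finset.sum_congr rfl fun a _ => ?_
    refine if_congr ?_ rfl rfl
    simp only [lin, map_one, mul_one]
    constructor <;> intro h <;> linear_combination h
  rw [Finset.sum_congr rfl fun b _ => this b]
  simp [Finset.sum_ite_mem]

lemma sum_lin_eq_sum_lin_one (f : F → F → ℤ) (x : F) (hx : x ≠ 0)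
    (hf : ∀ a b, f (a * (x * D.τ x)) (b * (x * D.σ x)) = f a b) :
    ∑ a ∈ D.fixed, ∑ b, (if D.lin a b x = 0 then f a b else 0)
      = ∑ a ∈ D.fixed, ∑ b, (if D.lin a b 1 = 0 then f a b else 0) := by
  have hτ : x * D.τ x ≠ 0 := mul_ne_zero hx (by simpa using hx)
  have hσ : x * D.σ x ≠ 0 := mul_ne_zero hx (by simpa using hx)
  have hfix : D.τ (x * D.τ x) = x * D.τ x := by rw [map_mul, D.τ_τ, mul_comm]
  refine Finset.sum_nbij' (fun a => a * (x * D.τ x)) (fun a => a * (x * D.τ x)⁻¹) ?_ ?_ ?_ ?_ ?_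
  · intro a ha
    rw [mem_fixed] at *
    rw [map_mul, ha, hfix]
  · intro a ha
    rw [mem_fixed] at *
    rw [map_mul, ha, map_inv₀, hfix]
  · intro a _; rw [mul_assoc, mul_inv_cancel₀ hτ, mul_one]
  · intro a _; rw [mul_assoc, inv_mul_cancel₀ hτ, mul_one]
  · intro a _
    refine Fintype.sum_equiv (Equiv.mulRight₀ (x * D.σ x) hσ) _ _ fun b => ?_
    change _ = if D.lin (a * (x * D.τ x)) (b * (x * D.σ x)) 1 = 0
      then f (a * (x * D.τ x)) (b * (x * D.σ x)) else 0
    simp only [lin_scale, hf, mul_one, mul_eq_zero, hx, false_or]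

lemma sum_mul_kerCount (f : F → F → ℤ)
    (hf : ∀ x, x ≠ 0 → ∀ a b, f (a * (x * D.τ x)) (b * (x * D.σ x)) = f a b) :
    ∑ a ∈ D.fixed, ∑ b, f a b * D.kerCount a b = ∑ a ∈ D.fixed, ∑ b, f a b
      + ((p : ℤ) ^ (2 * s) - 1) * ∑ b ∈ D.fixed, f (-(b + D.σ.symm b)) b := by
  have h1 : ∑ a ∈ D.fixed, ∑ b, f a b * D.kerCount a b
      = ∑ x, ∑ a ∈ D.fixed, ∑ b, (if D.lin a b x = 0 then f a b else 0) := by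
    symm
    rw [Finset.sum_comm]
    refine Finset.sum_congr rfl fun a _ => ?_
    rw [Finset.sum_comm]
    refine Finset.sum_congr rfl fun b _ => ?_
    simp only [kerCount, Finset.mul_sum, mul_ite, mul_one, mul_zero]
  rw [h1, ← Finset.add_sum_erase _ _ (Finset.mem_univ (0 : F)),
    Finset.sum_congr rfl fun x hx => (D.sum_lin_eq_sum_lin_one f x (Finset.ne_of_mem_erase hx)
      (hf x (Finset.ne_of_mem_erase hx))).trans (D.sum_lin_one f)]
  simp [lin, Finset.card_erase_of_mem, D.card_eq,
    Nat.cast_sub (Nat.one_le_pow (2 * s) p (Fact.out : p.Prime).pos)]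

lemma card_fixed' : D.fixed.card = p ^ s := D.card_fixed

/-- The subfield on which `σ` and `τ` agree. -/
def agree : Finset F := Finset.univ.filter fun x => D.σ x = D.τ x

lemma mem_agree {x : F} : x ∈ D.agree ↔ D.σ x = D.τ x := by simp [agree]

lemma card_agree' : D.agree.card = p ^ d := D.card_agree

lemma agree_subset_fixed : D.agree ⊆ D.fixed := fun x hx =>
  D.mem_fixed.mpr (D.τ_eq_of_σ_eq x (D.mem_agree.mp hx))

lemma mem_agree_iff_of_fixed {x : F} (hx : x ∈ D.fixed) : x ∈ D.agree ↔ D.σ x = x := by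
  rw [mem_agree, D.mem_fixed.mp hx]

lemma sum_sum_isoCount : (p : ℤ) * ∑ a ∈ D.fixed, ∑ b, D.isoCount a b
    = p ^ s * p ^ (2 * s) * (p ^ (2 * s) + p - 1) := by
  have hx : ∀ x : F, x ≠ 0 → (p : ℤ) * ∑ a ∈ D.fixed, ∑ b,
      (if D.form a b x x = 0 then 1 else 0) = p ^ s * p ^ (2 * s) := by
    intro x hx
    have hσ : 2 * (x * D.σ x) ≠ 0 :=
      mul_ne_zero D.two_ne_zero (mul_ne_zero hx (by simpa using hx))
    obtain ⟨w, hw⟩ := D.tr_nondeg _ hσ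
    rw [Finset.mul_sum, Finset.sum_congr rfl fun a _ => card_mul_sum_fiber_of_shift Finset.univ
      (fun b => D.form a b x x) w _ hw (by simp) (fun b k => ?_) 0]
    · simp [D.card_eq, D.card_fixed']
    · simp only [form_self]
      rw [← smul_eq_mul k, ← map_smul, ← map_add]
      congr 1
      simp only [Algebra.smul_def]; ring
  have h1 : ∑ a ∈ D.fixed, ∑ b, D.isoCount a b
      = ∑ x, ∑ a ∈ D.fixed, ∑ b, (if D.form a b x x = 0 then 1 else 0) := by
    symm
    rw [Finset.sum_comm]
    refine Finset.sum_congr rfl fun a _ => ?_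
    rw [Finset.sum_comm]
    rfl
  rw [h1, Finset.mul_sum, ← Finset.add_sum_erase _ _ (Finset.mem_univ (0 : F)),
    Finset.sum_congr rfl fun x h => hx x (Finset.ne_of_mem_erase h)]
  simp [D.card_fixed', Finset.card_erase_of_mem, D.card_eq,
    Nat.cast_sub (Nat.one_le_pow (2 * s) p (Fact.out : p.Prime).pos)]
  ring

lemma form_self_of_one (b x : F) (hb : D.τ b = b) :
    D.form (-(b + D.σ.symm b)) b x x
      = D.tr ((D.σ x - D.τ x) * (x - D.τ (D.σ x)) * b) := by
  rw [form_self]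
  have h1 : D.tr (D.σ.symm b * (x * D.τ x)) = D.tr (b * (D.σ x * D.τ (D.σ x))) := by
    rw [← D.tr_σ]
    simp only [map_mul, D.σ.apply_symm_apply, D.σ_τ]
  have h2 : D.tr (b * (D.τ x * D.τ (D.σ x))) = D.tr (b * (x * D.σ x)) := by
    rw [← D.tr_τ]
    simp only [map_mul, D.τ_τ, hb]
  have e1 : -(b + D.σ.symm b) * (x * D.τ x) + 2 * (b * (x * D.σ x))
      = b * (x * D.σ x) + b * (x * D.σ x) - b * (x * D.τ x) - D.σ.symm b * (x * D.τ x) := by ring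
  have e2 : (D.σ x - D.τ x) * (x - D.τ (D.σ x)) * b
      = b * (x * D.σ x) + b * (D.τ x * D.τ (D.σ x)) - b * (x * D.τ x)
        - b * (D.σ x * D.τ (D.σ x)) := by ring
  rw [e1, e2]
  simp only [map_add, map_sub, h1, h2]

lemma exists_fixed_tr_ne_zero {g : F} (hg : D.τ g = g) (hg0 : g ≠ 0) :
    ∃ w ∈ D.fixed, D.tr (g * w) ≠ 0 := by
  have h2 : (2 : ZMod p) ≠ 0 := by
    have : ringChar (ZMod p) ≠ 2 := by rw [ZMod.ringChar_zmod_n]; exact D.p_ne_two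
    exact Ring.two_ne_zero this
  obtain ⟨w, hw⟩ := D.tr_nondeg g hg0
  refine ⟨w + D.τ w, ?_, ?_⟩
  · rw [mem_fixed, map_add, D.τ_τ, add_comm]
  · have : D.tr (g * D.τ w) = D.tr (g * w) := by
      rw [← D.tr_τ]
      simp only [map_mul, hg, D.τ_τ]
    rw [mul_add, map_add, this, ← two_mul]
    exact mul_ne_zero h2 hw

lemma sum_isoCount_one : (p : ℤ) * ∑ b ∈ D.fixed, D.isoCount (-(b + D.σ.symm b)) b
    = p ^ s * (p ^ (2 * s) + (p - 1) * p ^ d) := by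
  have h1 : ∑ b ∈ D.fixed, D.isoCount (-(b + D.σ.symm b)) b = ∑ x, ∑ b ∈ D.fixed,
      (if D.tr ((D.σ x - D.τ x) * (x - D.τ (D.σ x)) * b) = 0 then 1 else 0) := by
    symm
    rw [Finset.sum_comm]
    refine Finset.sum_congr rfl fun b hb => ?_
    refine Finset.sum_congr rfl fun x _ => ?_
    rw [D.form_self_of_one b x (D.mem_fixed.mp hb)]
  have h2 : ∀ x, (p : ℤ) * ∑ b ∈ D.fixed,
      (if D.tr ((D.σ x - D.τ x) * (x - D.τ (D.σ x)) * b) = 0 then 1 else 0)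
      = p ^ s + if x ∈ D.agree then (p - 1) * (p : ℤ) ^ s else 0 := by
    intro x
    split_ifs with hx
    · rw [mem_agree] at hx
      simp [hx, D.card_fixed']
      ring
    · rw [mem_agree] at hx
      have hg : D.τ ((D.σ x - D.τ x) * (x - D.τ (D.σ x)))
          = (D.σ x - D.τ x) * (x - D.τ (D.σ x)) := by
        simp only [map_mul, map_sub, D.τ_τ]; ring
      have hg0 : (D.σ x - D.τ x) * (x - D.τ (D.σ x)) ≠ 0 := by
        refine mul_ne_zero (sub_ne_zero.mpr hx) (sub_ne_zero.mpr fun h => hx ?_)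
        conv_rhs => rw [h, D.τ_τ]
      obtain ⟨w, hw, hw'⟩ := D.exists_fixed_tr_ne_zero hg hg0
      rw [card_mul_sum_fiber_of_shift D.fixed (fun b => D.tr (_ * b)) w _ hw' ?_ ?_ 0]
      · simp [D.card_fixed']
      · intro b hb k
        rw [mem_fixed] at *
        rw [map_add, ZMod.map_smul, hb, hw]
      · intro b k
        rw [mul_add, map_add, mul_smul_comm, map_smul, smul_eq_mul]
  rw [h1, Finset.mul_sum, Finset.sum_congr rfl fun x _ => h2 x]
  simp [Finset.sum_add_distrib, D.card_eq, D.card_agree']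
  ring

lemma mem_fixed_of_lin_eq_zero {b t : F} (hb : b ∈ D.fixed) (hb0 : b ≠ 0)
    (h : D.lin (-(b + D.σ.symm b)) b t = 0) : t ∈ D.fixed := by
  rw [mem_fixed] at *
  have ha : D.τ (-(b + D.σ.symm b)) = -(b + D.σ.symm b) := by
    rw [map_neg, map_add, D.τ_σ_symm, hb]
  have h1 : D.lin (-(b + D.σ.symm b)) b 1 = 0 := by simp [lin]
  have e1 := D.τ_eq_of_lin_eq_zero ha h
  have e2 := D.τ_eq_of_lin_eq_zero ha (x := 1 + t) (by rw [lin_add, h1, h, add_zero])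
  simp only [map_mul, map_add, map_one, hb] at e1 e2
  have e3 : D.τ t * D.τ (D.σ t) = t * D.σ t := mul_left_cancel₀ hb0 e1
  have e4 : D.τ t + D.τ (D.σ t) = t + D.σ t := by
    apply mul_left_cancel₀ hb0
    linear_combination e2 - b * e3
  refine sub_eq_zero.mp (D.eq_zero_of_neg (v := D.τ t - t) ?_ ?_)
  · rw [map_sub, D.σ_τ]; linear_combination e4
  · rw [map_sub, D.τ_τ]; ring

lemma lin_eq_zero_iff {b t : F} (hb : b ∈ D.fixed) (hb0 : b ≠ 0) :
    D.lin (-(b + D.σ.symm b)) b t = 0 ↔ t ∈ D.fixed ∧ b * (D.σ t - t) ∈ D.agree := by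
  have key : t ∈ D.fixed → (D.lin (-(b + D.σ.symm b)) b t = 0 ↔ b * (D.σ t - t) ∈ D.agree) := by
    intro ht
    have hz : b * (D.σ t - t) ∈ D.fixed := by
      rw [mem_fixed] at *
      rw [map_mul, map_sub, ← D.σ_τ, ht, hb]
    rw [D.mem_agree_iff_of_fixed hz, eq_comm (b := b * (D.σ t - t)), ← D.σ.symm_apply_eq]
    rw [mem_fixed] at ht
    simp only [lin, map_mul, map_sub, D.σ.symm_apply_apply, ht]
    constructor <;> intro h <;> linear_combination -h
  exact ⟨fun h => ⟨D.mem_fixed_of_lin_eq_zero hb hb0 h,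
    (key (D.mem_fixed_of_lin_eq_zero hb hb0 h)).mp h⟩, fun h => (key h.1).mpr h.2⟩

lemma kerCount_one {b : F} (hb : b ∈ D.fixed) (hb0 : b ≠ 0) :
    D.kerCount (-(b + D.σ.symm b)) b
      = (D.fixed.filter fun t => b * (D.σ t - t) ∈ D.agree).card := by
  unfold kerCount
  simp only [D.lin_eq_zero_iff hb hb0, Finset.sum_boole]
  congr 2
  ext t; simp

lemma kerCount_zero_zero : D.kerCount 0 0 = p ^ (2 * s) := by
  simp [kerCount, lin, D.card_eq]

lemma sum_kerCount_one : ∑ b ∈ D.fixed, D.kerCount (-(b + D.σ.symm b)) b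
    = (p : ℤ) ^ (2 * s) + p ^ d * (p ^ s - 1) + (p ^ s - p ^ d) * (p ^ d - 1) := by
  have h0 : (0 : F) ∈ D.fixed := by simp [mem_fixed]
  have hcardS : ((D.fixed.erase 0).card : ℤ) = p ^ s - 1 := by
    rw [Finset.card_erase_of_mem h0, D.card_fixed',
      Nat.cast_sub (Nat.one_le_pow _ _ (Fact.out : p.Prime).pos)]
    push_cast; ring
  have hcardK : ((D.agree.erase 0).card : ℤ) = p ^ d - 1 := by
    rw [Finset.card_erase_of_mem (by simp [mem_agree]), D.card_agree',
      Nat.cast_sub (Nat.one_le_pow _ _ (Fact.out : p.Prime).pos)]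
    push_cast; ring
  have h1 : ∀ t ∈ D.fixed, (∑ b ∈ D.fixed.erase 0,
      (if b * (D.σ t - t) ∈ D.agree then 1 else 0) : ℤ)
      = (p ^ d - 1) + if t ∈ D.agree then (p : ℤ) ^ s - p ^ d else 0 := by
    intro t ht
    split_ifs with htK
    · rw [D.mem_agree_iff_of_fixed ht] at htK
      have : (0 : F) ∈ D.agree := by simp [mem_agree]
      simp only [htK, sub_self, mul_zero, this, if_true, Finset.sum_const, nsmul_eq_mul, mul_one,
        hcardS]
      ring
    · rw [D.mem_agree_iff_of_fixed ht] at htK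
      have hne : D.σ t - t ≠ 0 := sub_ne_zero.mpr htK
      have hfix : D.τ (D.σ t - t) = D.σ t - t := by
        rw [mem_fixed] at ht
        rw [map_sub, ← D.σ_τ, ht]
      rw [Finset.sum_boole, add_zero, ← hcardK, Nat.cast_inj]
      refine Finset.card_nbij' (fun b => b * (D.σ t - t)) (fun z => z / (D.σ t - t)) ?_ ?_ ?_ ?_
      · intro b hb
        simp only [Finset.coe_filter, Set.mem_ofPred_eq, Finset.mem_erase] at hb
        simp only [Finset.coe_erase, Set.mem_sdiff, Finset.mem_coe, Set.mem_singleton_iff]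
        exact ⟨hb.2, mul_ne_zero hb.1.1 hne⟩
      · intro z hz
        simp only [Finset.coe_erase, Set.mem_sdiff, Finset.mem_coe, Set.mem_singleton_iff] at hz
        simp only [Finset.coe_filter, Set.mem_ofPred_eq, Finset.mem_erase]
        rw [div_mul_cancel₀ _ hne]
        refine ⟨⟨div_ne_zero hz.2 hne, ?_⟩, hz.1⟩
        rw [mem_fixed, map_div₀, hfix, D.mem_fixed.mp (D.agree_subset_fixed hz.1)]
      · intro b _; exact mul_div_cancel_right₀ _ hne
      · intro z _; exact div_mul_cancel₀ _ hne
  have h2 : ∑ b ∈ D.fixed.erase 0, D.kerCount (-(b + D.σ.symm b)) b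
      = ∑ t ∈ D.fixed, ∑ b ∈ D.fixed.erase 0,
        (if b * (D.σ t - t) ∈ D.agree then 1 else 0) := by
    rw [Finset.sum_comm]
    refine Finset.sum_congr rfl fun b hb => ?_
    rw [D.kerCount_one (Finset.mem_of_mem_erase hb) (Finset.ne_of_mem_erase hb), Finset.sum_boole]
  rw [← Finset.add_sum_erase _ _ h0, h2, Finset.sum_congr rfl h1, Finset.sum_add_distrib,
    Finset.sum_ite_mem, Finset.inter_eq_right.mpr D.agree_subset_fixed]
  simp only [map_zero, add_zero, neg_zero, kerCount_zero_zero, Finset.sum_const, nsmul_eq_mul,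
    D.card_fixed', D.card_agree']
  push_cast
  ring

lemma kerCount_one_mem {b : F} (hb : b ∈ D.fixed) (hb0 : b ≠ 0) :
    D.kerCount (-(b + D.σ.symm b)) b = p ^ d ∨ D.kerCount (-(b + D.σ.symm b)) b = p ^ (2 * d) := by
  have hK0 : (0 : F) ∈ D.agree := by simp [mem_agree]
  rw [D.kerCount_one hb hb0]
  by_cases h : ∀ t ∈ D.fixed, b * (D.σ t - t) ∈ D.agree → t ∈ D.agree
  · left
    rw [show (D.fixed.filter fun t => b * (D.σ t - t) ∈ D.agree) = D.agree from ?_, D.card_agree']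
    · push_cast; rfl
    · ext t
      simp only [Finset.mem_filter]
      refine ⟨fun ht => h t ht.1 ht.2, fun ht => ⟨D.agree_subset_fixed ht, ?_⟩⟩
      rw [(D.mem_agree_iff_of_fixed (D.agree_subset_fixed ht)).mp ht, sub_self, mul_zero]
      exact hK0
  · right
    push Not at h
    obtain ⟨t₀, ht₀, hz₀, ht₀'⟩ := h
    rw [D.mem_agree_iff_of_fixed ht₀] at ht₀'
    have hne : b * (D.σ t₀ - t₀) ≠ 0 := mul_ne_zero hb0 (sub_ne_zero.mpr ht₀')
    have hmul : ∀ {x y}, x ∈ D.agree → y ∈ D.agree → x * y ∈ D.agree := by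
      intro x y hx hy
      rw [mem_agree] at *
      rw [map_mul, map_mul, hx, hy]
    have hσ : ∀ {x}, x ∈ D.agree → D.σ x = x := fun hx =>
      (D.mem_agree_iff_of_fixed (D.agree_subset_fixed hx)).mp hx
    have hτ : ∀ {x}, x ∈ D.agree → D.τ x = x := fun hx =>
      D.mem_fixed.mp (D.agree_subset_fixed hx)
    have hcard : (D.agree ×ˢ D.agree).card
        = (D.fixed.filter fun t => b * (D.σ t - t) ∈ D.agree).card := by
      refine Finset.card_nbij' (fun k => k.1 + k.2 * t₀)
        (fun t => (t - b * (D.σ t - t) / (b * (D.σ t₀ - t₀)) * t₀,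
          b * (D.σ t - t) / (b * (D.σ t₀ - t₀)))) ?_ ?_ ?_ ?_
      · rintro ⟨k₁, k₂⟩ hk
        simp only [Finset.coe_product, Set.mem_prod, Finset.mem_coe] at hk
        simp only [Finset.coe_filter, Set.mem_ofPred_eq, mem_fixed]
        constructor
        · rw [map_add, map_mul, hτ hk.1, hτ hk.2, D.mem_fixed.mp ht₀]
        · rw [map_add, map_mul, hσ hk.1, hσ hk.2]
          have := hmul hk.2 hz₀
          convert this using 1
          ring
      · intro t ht
        simp only [Finset.coe_filter, Set.mem_ofPred_eq] at ht
        have hk : b * (D.σ t - t) / (b * (D.σ t₀ - t₀)) ∈ D.agree := by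
          have h1 := D.mem_agree.mp ht.2
          have h2 := D.mem_agree.mp hz₀
          rw [mem_agree, map_div₀, map_div₀, h1, h2]
        simp only [Finset.coe_product, Set.mem_prod, Finset.mem_coe]
        refine ⟨?_, hk⟩
        have hfix : t - b * (D.σ t - t) / (b * (D.σ t₀ - t₀)) * t₀ ∈ D.fixed := by
          rw [mem_fixed, map_sub, map_mul, hτ hk, D.mem_fixed.mp ht.1, D.mem_fixed.mp ht₀]
        rw [D.mem_agree_iff_of_fixed hfix, map_sub, map_mul, hσ hk]
        have hne' := sub_ne_zero.mpr ht₀'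
        field_simp
        ring
      · rintro ⟨k₁, k₂⟩ hk
        simp only [Finset.coe_product, Set.mem_prod, Finset.mem_coe] at hk
        have hk2 : b * (D.σ (k₁ + k₂ * t₀) - (k₁ + k₂ * t₀)) / (b * (D.σ t₀ - t₀)) = k₂ := by
          rw [div_eq_iff hne, map_add, map_mul, hσ hk.1, hσ hk.2]; ring
        simp only [hk2, add_sub_cancel_right]
      · intro t _
        simp only [sub_add_cancel]
    rw [← hcard, Finset.card_product, D.card_agree']
    push_cast; ring

lemma kerCount_mem {a b : F} (ha : a ∈ D.fixed) (hab : ¬(a = 0 ∧ b = 0)) :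
    D.kerCount a b = 1 ∨ D.kerCount a b = p ^ d ∨ D.kerCount a b = p ^ (2 * d) := by
  by_cases h : ∃ x ≠ 0, D.lin a b x = 0
  · right
    obtain ⟨x, hx, hlin⟩ := h
    have hσ : x * D.σ x ≠ 0 := mul_ne_zero hx (by simpa using hx)
    have hτ : x * D.τ x ≠ 0 := mul_ne_zero hx (by simpa using hx)
    rw [← D.kerCount_scale a b hx]
    have h1 : b * (x * D.σ x) ∈ D.fixed :=
      D.mem_fixed.mpr (D.τ_eq_of_lin_eq_zero (D.mem_fixed.mp ha) hlin)
    have h2 : a * (x * D.τ x) = -(b * (x * D.σ x) + D.σ.symm (b * (x * D.σ x))) := by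
      have h3 : D.lin (a * (x * D.τ x)) (b * (x * D.σ x)) 1 = 0 := by
        rw [lin_scale, mul_one, hlin, mul_zero]
      simp only [lin, map_one, mul_one] at h3
      linear_combination h3
    rw [h2]
    refine D.kerCount_one_mem h1 (mul_ne_zero (fun hb => hab ⟨?_, hb⟩) hσ)
    rw [hb] at h2
    simpa [hτ, hx] using h2
  · left
    push Not at h
    unfold kerCount
    rw [Finset.sum_boole]
    have : (Finset.univ.filter fun x => D.lin a b x = 0) = {0} := by
      ext x
      simp only [Finset.mem_filter, Finset.mem_univ, true_and, Finset.mem_singleton]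
      refine ⟨fun hx => by_contra fun h0 => h x h0 hx, ?_⟩
      rintro rfl
      simp [lin]
    rw [this]; simp

lemma sq_ne_odd_pow_mul_sq {n : ℕ} (hn : Odd n) {y z : ℤ} (hz : z ≠ 0) :
    y ^ 2 ≠ (p : ℤ) ^ n * z ^ 2 := by
  intro h
  have hp0 : (p : ℤ) ≠ 0 := by exact_mod_cast (Fact.out : p.Prime).ne_zero
  have hy : y ≠ 0 := by
    rintro rfl
    have := mul_ne_zero (pow_ne_zero n hp0) (pow_ne_zero 2 hz)
    exact this (by rw [← h]; ring)
  have h1 := congrArg (padicValInt p) h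
  rw [padicValInt.mul (pow_ne_zero n hp0) (pow_ne_zero 2 hz), pow_two, pow_two,
    padicValInt.mul hy hy, padicValInt.mul hz hz] at h1
  have h2 : padicValInt p ((p : ℤ) ^ n) = n := by
    rw [← Nat.cast_pow, padicValInt.of_nat, padicValNat.prime_pow]
  rw [h2] at h1
  obtain ⟨k, hk⟩ := hn
  omega

lemma sq_defect (hd : Odd d) {a : F} (ha : a ∈ D.fixed) (b : F) :
    (D.kerCount a b = 1 → (p * D.isoCount a b - p ^ (2 * s) = ((p : ℤ) - 1) * p ^ s ∨
      p * D.isoCount a b - p ^ (2 * s) = -(((p : ℤ) - 1) * p ^ s))) ∧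
    (D.kerCount a b = p ^ d → (p : ℤ) * D.isoCount a b - p ^ (2 * s) = 0) := by
  have hp1 : (p : ℤ) - 1 ≠ 0 := by
    have := (Fact.out : p.Prime).one_lt
    omega
  have hcard : (Fintype.card F : ℤ) = p ^ (2 * s) := by rw [D.card_eq]; push_cast; rfl
  have h := reprCount_dichotomy (D.form a b) D.p_ne_two (D.form_symm (D.mem_fixed.mp ha) b)
  rw [D.radCount_form, hcard] at h
  change ((∀ v : ZMod p, v ≠ 0 → ((p : ℤ) - 1) * (p * reprCount (D.form a b) v - p ^ (2 * s))
        = -(p * D.isoCount a b - p ^ (2 * s))) ∧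
      ((p : ℤ) * D.isoCount a b - p ^ (2 * s)) ^ 2
        = ((p : ℤ) - 1) ^ 2 * (p ^ (2 * s) * D.kerCount a b)) ∨
    ((p : ℤ) * D.isoCount a b - p ^ (2 * s) = 0 ∧
      ∀ v : ZMod p, v ≠ 0 → ((p : ℤ) * reprCount (D.form a b) v - p ^ (2 * s)) ^ 2
        = p * (p ^ (2 * s) * D.kerCount a b)) at h
  constructor
  · intro hR
    rw [hR] at h
    rcases h with ⟨-, h⟩ | ⟨-, h⟩
    · apply sq_eq_sq_iff_eq_or_eq_neg.mp
      rw [h]; ring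
    · exfalso
      refine sq_ne_odd_pow_mul_sq (p := p) (n := 2 * s + 1) ⟨s, rfl⟩ one_ne_zero
        ((h 1 one_ne_zero).trans ?_)
      ring
  · intro hR
    rw [hR] at h
    rcases h with ⟨-, h⟩ | ⟨h, -⟩
    · exfalso
      refine sq_ne_odd_pow_mul_sq (p := p) (n := 2 * s + d) ?_ hp1 (h.trans ?_)
      · exact Even.add_odd (even_two_mul s) hd
      · ring
    · exact h

open Classical in
lemma two_mul_card_hyperbolic (hd : Odd d) (hs : s ≠ 0) :
    2 * ((p : ℤ) ^ d + 1) * ∑ a ∈ D.fixed, ∑ b, (if IsHyperbolicCount (D.form a b) s then 1 else 0)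
      = p ^ d * (p ^ s + 1) * (p ^ (2 * s) - 1) := by
  have hpp : p.Prime := Fact.out
  have hp1 : (p : ℤ) - 1 ≠ 0 := by
    have := hpp.one_lt
    omega
  have hx : (1 : ℤ) < p ^ d := by exact_mod_cast Nat.one_lt_pow hd.pos.ne' hpp.one_lt
  have hq : (1 : ℤ) < p ^ (2 * s) := by exact_mod_cast Nat.one_lt_pow (by omega) hpp.one_lt
  have hx2 : ((p : ℤ) ^ d) ^ 2 = p ^ (2 * d) := by ring
  have hiff : ∀ a b, IsHyperbolicCount (D.form a b) s ↔ D.kerCount a b = 1 ∧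
      p * D.isoCount a b - p ^ (2 * s) = ((p : ℤ) - 1) * p ^ s := by
    intro a b
    rw [IsHyperbolicCount, D.radCount_form]; rfl
  have hterm : ∀ a ∈ D.fixed, ∀ b,
      2 * (1 - (p : ℤ) ^ d) * (1 - (p ^ d) ^ 2) * ((p - 1) * p ^ s)
        * (if IsHyperbolicCount (D.form a b) s then 1 else 0)
      = (1 - p ^ d) * (p * (D.isoCount a b * D.kerCount a b) - p ^ (2 * s) * D.kerCount a b
            - (p ^ d) ^ 2 * (p * D.isoCount a b - p ^ (2 * s)))
        + (p - 1) * p ^ s * (D.kerCount a b * D.kerCount a b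
            - (p ^ d + (p ^ d) ^ 2) * D.kerCount a b + p ^ d * (p ^ d) ^ 2)
        - (if a = 0 then (if b = 0 then (1 - (p : ℤ) ^ d) * ((p - 1) * p ^ (2 * s))
            * (p ^ (2 * s) - (p ^ d) ^ 2)
          + (p - 1) * p ^ s * ((p ^ (2 * s) - p ^ d) * (p ^ (2 * s) - (p ^ d) ^ 2)) else 0)
            else 0) := by
    intro a ha b
    by_cases hab : a = 0 ∧ b = 0
    · obtain ⟨rfl, rfl⟩ := hab
      have hi : D.isoCount 0 0 = p ^ (2 * s) := by
        simp [isoCount, reprCount, lin, D.card_eq]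
      have hn : ¬ IsHyperbolicCount (D.form 0 0) s := by
        rw [hiff, D.kerCount_zero_zero]
        rintro ⟨h, -⟩
        omega
      rw [if_neg hn, if_pos rfl, if_pos rfl, D.kerCount_zero_zero, hi]
      ring
    · have hz : (if a = 0 then (if b = 0 then (1 - (p : ℤ) ^ d) * ((p - 1) * p ^ (2 * s))
            * (p ^ (2 * s) - (p ^ d) ^ 2)
          + (p - 1) * p ^ s * ((p ^ (2 * s) - p ^ d) * (p ^ (2 * s) - (p ^ d) ^ 2)) else 0)
            else 0) = 0 := by
        by_cases h1 : a = 0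
        · rw [if_pos h1, if_neg (fun h2 => hab ⟨h1, h2⟩)]
        · rw [if_neg h1]
      rw [hz]
      have hdef := D.sq_defect hd ha b
      rcases D.kerCount_mem ha hab with h | h | h
      · rcases hdef.1 h with he | he
        · rw [if_pos ((hiff a b).mpr ⟨h, he⟩), h]
          linear_combination (-(1 - (p : ℤ) ^ d) * (1 - (p ^ d) ^ 2)) * he
        · have hn : ¬ IsHyperbolicCount (D.form a b) s := by
            rw [hiff]
            rintro ⟨-, h2⟩
            have hpos : ((p : ℤ) - 1) * p ^ s ≠ 0 :=
              mul_ne_zero hp1 (pow_ne_zero _ (by exact_mod_cast hpp.ne_zero))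
            omega
          rw [if_neg hn, h]
          linear_combination (-(1 - (p : ℤ) ^ d) * (1 - (p ^ d) ^ 2)) * he
      · have he := hdef.2 h
        have hn : ¬ IsHyperbolicCount (D.form a b) s := by
          rw [hiff, h]
          rintro ⟨h, -⟩
          omega
        rw [if_neg hn, h]
        linear_combination (-(1 - (p : ℤ) ^ d) * (p ^ d - (p ^ d) ^ 2)) * he
      · have hn : ¬ IsHyperbolicCount (D.form a b) s := by
          rw [hiff, h, ← hx2]
          rintro ⟨h, -⟩
          nlinarith
        rw [if_neg hn, h, ← hx2]
        ring
  have h0 : (0 : F) ∈ D.fixed := by simp [mem_fixed]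
  have hsum := Finset.sum_congr rfl fun a ha => Finset.sum_congr (s₁ := Finset.univ) rfl
    fun b _ => hterm a ha b
  have s1 := D.sum_mul_kerCount (fun _ _ => 1) (fun _ _ _ _ => rfl)
  have sR := D.sum_mul_kerCount D.kerCount (fun x hx a b => D.kerCount_scale a b hx)
  have sN := D.sum_mul_kerCount D.isoCount (fun x hx a b => D.isoCount_scale a b hx)
  have sE := D.sum_sum_isoCount
  have sE1 := D.sum_isoCount_one
  rw [D.sum_kerCount_one] at sR
  simp only [one_mul, Finset.sum_const, Finset.card_univ, D.card_eq, D.card_fixed', nsmul_eq_mul,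
    mul_one, Nat.cast_pow] at s1
  have hC : ∀ C : ℤ, ∑ a ∈ D.fixed, ∑ b : F,
      (if a = 0 then (if b = 0 then C else 0) else 0) = C := by
    intro C
    rw [Finset.sum_eq_single_of_mem 0 h0 fun a _ ha => by simp [ha]]
    simp
  simp only [Finset.sum_add_distrib, Finset.sum_sub_distrib, ← Finset.mul_sum, hC,
    Finset.sum_const, Finset.card_univ, D.card_eq,
    D.card_fixed', nsmul_eq_mul, Nat.cast_pow] at hsum
  rw [sN, sR, s1] at hsum
  have hne : (1 - (p : ℤ) ^ d) ^ 2 * ((p - 1) * p ^ s) ≠ 0 :=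
    mul_ne_zero (pow_ne_zero _ (by omega))
      (mul_ne_zero hp1 (pow_ne_zero _ (by exact_mod_cast hpp.ne_zero)))
  apply mul_left_cancel₀ hne
  linear_combination hsum + (1 - (p : ℤ) ^ d) * (1 - (p ^ d) ^ 2) * sE
    + (1 - (p : ℤ) ^ d) * (p ^ (2 * s) - 1) * sE1

end ConjugationData

lemma card_pow_eq_self_of_dvd {F : Type*} [Field F] [Fintype F] [DecidableEq F] {p n k : ℕ}
    (hp : 1 < p) (hF : Fintype.card F = p ^ n) (hkn : k ∣ n) :
    (Finset.univ.filter fun x : F => x ^ p ^ k = x).card = p ^ k := by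
  have h1 : 1 ≤ p ^ k := Nat.one_le_pow _ _ (by omega)
  have hker := IsCyclic.card_powMonoidHom_ker (G := Fˣ) (p ^ k - 1)
  rw [Nat.card_units, Nat.card_eq_fintype_card (α := F), hF,
    Nat.gcd_eq_right (Nat.pow_sub_one_dvd_pow_sub_one p hkn)] at hker
  have hset : (Finset.univ.filter fun x : F => x ^ p ^ k = x)
      = insert 0 ((Finset.univ.filter fun u : Fˣ => u ^ (p ^ k - 1) = 1).map
          ⟨Units.val, Units.val_injective⟩) := by
    ext x
    simp only [Finset.mem_filter, Finset.mem_univ, true_and, Finset.mem_insert, Finset.mem_map,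
      Function.Embedding.coeFn_mk]
    constructor
    · intro hx
      by_cases h0 : x = 0
      · exact Or.inl h0
      · refine Or.inr ⟨Units.mk0 x h0, ?_, rfl⟩
        ext
        simp only [Units.val_pow_eq_pow_val, Units.val_mk0, Units.val_one]
        apply mul_right_cancel₀ h0
        rw [← pow_succ, Nat.sub_add_cancel h1, hx, one_mul]
    · rintro (rfl | ⟨u, hu, rfl⟩)
      · exact zero_pow (by omega)
      · rw [← Units.val_pow_eq_pow_val, ← Nat.sub_add_cancel h1, pow_succ, hu, one_mul]
  rw [hset, Finset.card_insert_of_notMem (by simp), Finset.card_map]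
  have : (Finset.univ.filter fun u : Fˣ => u ^ (p ^ k - 1) = 1).card = p ^ k - 1 := by
    refine Eq.trans ?_ hker
    rw [Nat.card_eq_fintype_card, Fintype.card_subtype]
    simp [MonoidHom.mem_ker]
  omega

lemma pow_gcd_eq_self {F : Type*} [Monoid F] {p m n : ℕ} {x : F} (hm : x ^ p ^ m = x)
    (hn : x ^ p ^ n = x) : x ^ p ^ Nat.gcd m n = x := by
  have key : ∀ k, (fun y : F => y ^ p)^[k] x = x ^ p ^ k := by
    intro k
    exact congrFun (pow_iterate p k) x
  have h := Function.IsPeriodicPt.gcd (f := fun y : F => y ^ p) (x := x) (m := m) (n := n)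
    ((key m).trans hm) ((key n).trans hn)
  exact (key _).symm.trans h

lemma pow_eq_self_of_dvd {F : Type*} [Monoid F] {p m n : ℕ} {x : F} (hm : x ^ p ^ m = x)
    (h : m ∣ n) : x ^ p ^ n = x := by
  obtain ⟨k, rfl⟩ := h
  induction k with
  | zero => simp
  | succ k ih => rw [Nat.mul_succ, pow_add, pow_mul, ih, hm]

lemma algebraMap_trace_eq_trp {p n : ℕ} [Fact p.Prime] {F : Type} [Field F] [Fintype F]
    [Algebra (ZMod p) F] (hF : Fintype.card F = p ^ n) (z : F) :
    algebraMap (ZMod p) F (Algebra.trace (ZMod p) F z) = trp p n z := by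
  have hn : Module.finrank (ZMod p) F = n := by
    have h := Module.card_eq_pow_finrank (K := ZMod p) (V := F)
    rw [hF, ZMod.card] at h
    exact (Nat.pow_right_injective (Fact.out : p.Prime).two_le h).symm
  rw [FiniteField.algebraMap_trace_eq_sum_pow, hn, Nat.card_zmod]
  rfl

lemma trp_two_mul {p s : ℕ} {F : Type} [Field F] {z : F} (hz : z ^ p ^ s = z) :
    trp p (2 * s) z = 2 * trp p s z := by
  rw [trp, two_mul s, Finset.sum_range_add, two_mul]
  congr 1
  refine Finset.sum_congr rfl fun i _ => ?_
  rw [pow_add, pow_mul, hz]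

/-- The data attached to the Frobenius powers of exponents `s` and `l` on a field of order
`p ^ (2 * s)`. -/
noncomputable def ConjugationData.ofFrobenius (p s l d : ℕ) [Fact p.Prime] (F : Type) [Field F]
    [Fintype F] [DecidableEq F] [CharP F p] [Algebra (ZMod p) F] (hodd : Odd p)
    (hF : Fintype.card F = p ^ (2 * s)) (hd : Nat.gcd s l = d)
    (hd' : Nat.gcd (s + l) (2 * l) = d) : ConjugationData p s d F :=
  have hp : p.Prime := Fact.out
  have hτ : ∀ x : F, (x ^ p ^ s) ^ p ^ s = x := fun x => by
    rw [← pow_mul, ← pow_add, ← two_mul, ← hF, FiniteField.pow_card]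
  have hgcd : Nat.gcd (l + s) (2 * s) = d := by
    rw [← hd', add_comm l s, show 2 * s = 2 * (s + l) - 2 * l by omega]
    have h1 : Nat.gcd (s + l) (2 * (s + l) - 2 * l) ∣ 2 * l := by
      have h2 := Nat.dvd_sub (Dvd.dvd.mul_left (Nat.gcd_dvd_left (s + l) (2 * (s + l) - 2 * l)) 2)
        (Nat.gcd_dvd_right (s + l) (2 * (s + l) - 2 * l))
      rwa [Nat.sub_sub_self (by omega)] at h2
    refine Nat.dvd_antisymm (Nat.dvd_gcd (Nat.gcd_dvd_left _ _) h1)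
      (Nat.dvd_gcd (Nat.gcd_dvd_left _ _) (Nat.dvd_sub
        (Dvd.dvd.mul_left (Nat.gcd_dvd_left _ _) 2) (Nat.gcd_dvd_right _ _)))
  have hds : d ∣ s := hd ▸ Nat.gcd_dvd_left s l
  have hdl : d ∣ l := hd ▸ Nat.gcd_dvd_right s l
  have hagree : ∀ x : F, x ^ p ^ l = x ^ p ^ s ↔ x ^ p ^ d = x := fun x => by
    constructor
    · intro h
      rw [← hgcd]
      refine pow_gcd_eq_self ?_ (pow_eq_self_of_dvd (by rw [← hF, FiniteField.pow_card]) dvd_rfl)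
      rw [pow_add, pow_mul, h, hτ]
    · intro h
      rw [pow_eq_self_of_dvd h hds, pow_eq_self_of_dvd h hdl]
  have htr : ∀ (n : ℕ) (x : F), Algebra.trace (ZMod p) F (x ^ p ^ n)
      = Algebra.trace (ZMod p) F x := fun n x => by
    have h := Algebra.trace_eq_of_algEquiv
      ((FiniteField.frobeniusAlgEquivOfAlgebraic (ZMod p) F) ^ n) x
    rwa [AlgEquiv.coe_pow, FiniteField.coe_frobeniusAlgEquivOfAlgebraic_iterate, ZMod.card] at h
  { τ := iterateFrobeniusEquiv F p s
    σ := iterateFrobeniusEquiv F p l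
    tr := Algebra.trace (ZMod p) F
    p_ne_two := fun h => by rw [h] at hodd; exact absurd hodd (by decide)
    two_ne_zero := by
      apply Ring.two_ne_zero
      rw [ringChar.eq F p]
      rintro rfl
      exact absurd hodd (by decide)
    τ_τ := fun x => hτ x
    σ_τ := fun x => by
      simp only [iterateFrobeniusEquiv_def, ← pow_mul, mul_comm]
    τ_eq_of_σ_eq := fun x h => pow_eq_self_of_dvd ((hagree x).mp h) hds
    tr_τ := htr s
    tr_σ := htr l
    tr_nondeg := fun a ha => by
      by_contra! hf
      exact ha ((traceForm_nondegenerate (ZMod p) F).1 a hf)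
    card_eq := hF
    card_fixed := card_pow_eq_self_of_dvd hp.one_lt hF ⟨2, mul_comm _ _⟩
    card_agree := by
      simp only [iterateFrobeniusEquiv_def, hagree]
      exact card_pow_eq_self_of_dvd hp.one_lt hF (hds.mul_left 2) }

section Codewords

variable {p s l d : ℕ} [Fact p.Prime] {F : Type} [Field F] [Fintype F] [DecidableEq F] [CharP F p]
  [Algebra (ZMod p) F]

lemma two_mul_cword (hodd : Odd p) (hF : Fintype.card F = p ^ (2 * s))
    (hd : Nat.gcd s l = d) (hd' : Nat.gcd (s + l) (2 * l) = d) {a : F} (ha : a ^ p ^ s = a)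
    (b c : F) (h : ZMod p) (x : F) :
    2 * cword p s l a b c h x = algebraMap (ZMod p) F
      ((ConjugationData.ofFrobenius p s l d F hodd hF hd hd').form a b x x
        + 2 * Algebra.trace (ZMod p) F (c * x) + 2 * h) := by
  have hτ : ∀ x : F, (x ^ p ^ s) ^ p ^ s = x := fun x => by
    rw [← pow_mul, ← pow_add, ← two_mul, ← hF, FiniteField.pow_card]
  have hz : (a * x ^ (p ^ s + 1)) ^ p ^ s = a * x ^ (p ^ s + 1) := by
    rw [mul_pow, ha, pow_succ, mul_pow, hτ, mul_comm x]
  have hh : (ZMod.cast h : F) = algebraMap (ZMod p) F h :=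
    RingHom.congr_fun (Subsingleton.elim (ZMod.castHom dvd_rfl F) (algebraMap (ZMod p) F)) h
  rw [ConjugationData.form_self]
  change _ = algebraMap (ZMod p) F (Algebra.trace (ZMod p) F
    (a * (x * x ^ p ^ s) + 2 * (b * (x * x ^ p ^ l))) + _ + _)
  have h2 : a * (x * x ^ p ^ s) + 2 * (b * (x * x ^ p ^ l))
      = a * x ^ (p ^ s + 1) + (b * x ^ (p ^ l + 1) + b * x ^ (p ^ l + 1)) := by ring
  rw [h2, cword, hh]
  simp only [map_add, map_mul, map_ofNat, ← algebraMap_trace_eq_trp hF]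
  rw [mul_add, mul_add, ← trp_two_mul hz, ← algebraMap_trace_eq_trp hF]
  ring

lemma card_suppw (hodd : Odd p) (hF : Fintype.card F = p ^ (2 * s))
    (hd : Nat.gcd s l = d) (hd' : Nat.gcd (s + l) (2 * l) = d) {a : F} (ha : a ^ p ^ s = a)
    (b c : F) (h : ZMod p) :
    ((suppw p s l a b c h).card : ℤ) = p ^ (2 * s)
      - zeroCount ((ConjugationData.ofFrobenius p s l d F hodd hF hd hd').form a b)
        (Algebra.trace (ZMod p) F ∘ₗ LinearMap.mulLeft (ZMod p) c) h := by
  have h2 : (2 : F) ≠ 0 := (ConjugationData.ofFrobenius p s l d F hodd hF hd hd').two_ne_zero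
  have hiff : ∀ x, (ConjugationData.ofFrobenius p s l d F hodd hF hd hd').form a b x x
      + 2 * (Algebra.trace (ZMod p) F ∘ₗ LinearMap.mulLeft (ZMod p) c) x + 2 * h = 0
      ↔ cword p s l a b c h x = 0 := by
    intro x
    rw [← mul_eq_zero_iff_left h2, two_mul_cword hodd hF hd hd' ha,
      map_eq_zero_iff _ (algebraMap (ZMod p) F).injective]
    rfl
  simp only [zeroCount, hiff, Finset.sum_boole, suppw]
  have := Finset.card_filter_add_card_filter_not (s := (Finset.univ : Finset F))
    (fun x => cword p s l a b c h x = 0)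
  rw [Finset.card_univ, hF] at this
  rw [eq_sub_iff_add_eq]
  exact_mod_cast (add_comm _ _).trans this

lemma card_suppw_eq_iff (hodd : Odd p) (hs : 2 ≤ s) (hF : Fintype.card F = p ^ (2 * s))
    (hd : Nat.gcd s l = d) (hd' : Nat.gcd (s + l) (2 * l) = d) {a : F} (ha : a ^ p ^ s = a)
    (b c : F) (h : ZMod p) :
    (suppw p s l a b c h).card = (p - 1) * (p ^ (2 * s - 1) - p ^ (s - 1)) ↔
      (p : ℤ) * zeroCount
        ((ConjugationData.ofFrobenius p s l d F hodd hF hd hd').form a b)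
        (Algebra.trace (ZMod p) F ∘ₗ LinearMap.mulLeft (ZMod p) c) h - p ^ (2 * s)
        = (p - 1) * p ^ s := by
  have hp : p.Prime := Fact.out
  have hp0 : (p : ℤ) ≠ 0 := by exact_mod_cast hp.ne_zero
  have h1 := card_suppw hodd hF hd hd' ha b c h
  have hle : p ^ (s - 1) ≤ p ^ (2 * s - 1) := Nat.pow_le_pow_right hp.pos (by omega)
  have e1 : (p : ℤ) ^ (2 * s) = p * p ^ (2 * s - 1) := by
    rw [← pow_succ']; congr 1; omega
  have e2 : (p : ℤ) ^ s = p * p ^ (s - 1) := by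
    rw [← pow_succ']; congr 1; omega
  rw [← Nat.cast_inj (R := ℤ), h1]
  push_cast [Nat.cast_sub hle, Nat.cast_sub hp.one_le]
  rw [← mul_right_inj' hp0]
  constructor
  · intro h
    linear_combination -h + (p - 1) * (e1 - e2)
  · intro h
    linear_combination -h + (p - 1) * (e1 - e2)

end Codewords

theorem stmt3 (p s l : ℕ) [Fact p.Prime] (F : Type) [Field F] [Fintype F] [DecidableEq F]
    [CharP F p] (hodd : Odd p) (hs : 2 ≤ s) (hl1 : 1 ≤ l) (hls : l ≠ s)
    (hl2 : l ≤ 2 * s - 1) (hF : Fintype.card F = p ^ (2 * s)) (d : ℕ)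
    (hd : Nat.gcd s l = d) (hd' : Nat.gcd (s + l) (2 * l) = d) (hdodd : Odd d) :
    (((Finset.univ : Finset (F × F × F × ZMod p)).filter fun t =>
        t.1 ^ p ^ s = t.1 ∧ (suppw p s l t.1 t.2.1 t.2.2.1 t.2.2.2).card
          = (p - 1) * (p ^ (2 * s - 1) - p ^ (s - 1))).card : ℚ)
      = (p : ℚ) ^ (2 * s + d) * ((p : ℚ) ^ s + 1) * ((p : ℚ) ^ (2 * s) - 1)
          / (2 * ((p : ℚ) ^ d + 1)) := by
  classical
  let _ : Algebra (ZMod p) F := ZMod.algebra F p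
  have hs0 : s ≠ 0 := by omega
  set D := ConjugationData.ofFrobenius p s l d F hodd hF hd hd' with hD
  have hmain := D.two_mul_card_hyperbolic hdodd hs0
  have hcount : ∀ a ∈ D.fixed, ∀ b c : F, (Finset.univ.filter fun h : ZMod p =>
      (suppw p s l a b c h).card = (p - 1) * (p ^ (2 * s - 1) - p ^ (s - 1))).card
      = if IsHyperbolicCount (D.form a b) s then 1 else 0 := by
    intro a ha b c
    rw [← card_zeroCount_eq (D.form a b) D.p_ne_two (D.form_symm (D.mem_fixed.mp ha) b) hF
      (Algebra.trace (ZMod p) F ∘ₗ LinearMap.mulLeft (ZMod p) c)]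
    congr 1
    ext h
    simp only [Finset.mem_filter, Finset.mem_univ, true_and]
    exact card_suppw_eq_iff hodd hs hF hd hd' (D.mem_fixed.mp ha) b c h
  have htotal : ((Finset.univ : Finset (F × F × F × ZMod p)).filter fun t =>
        t.1 ^ p ^ s = t.1 ∧ (suppw p s l t.1 t.2.1 t.2.2.1 t.2.2.2).card
          = (p - 1) * (p ^ (2 * s - 1) - p ^ (s - 1))).card
      = p ^ (2 * s) * ∑ a ∈ D.fixed, ∑ b, if IsHyperbolicCount (D.form a b) s then 1 else 0 := by
    rw [Finset.card_filter, Fintype.sum_prod_type, Finset.mul_sum, ConjugationData.fixed,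
      Finset.sum_filter]
    refine Finset.sum_congr rfl fun a _ => ?_
    change _ = if a ^ p ^ s = a then _ else _
    split_ifs with ha
    · rw [Fintype.sum_prod_type, Finset.mul_sum]
      refine Finset.sum_congr rfl fun b _ => ?_
      rw [Fintype.sum_prod_type, Finset.sum_congr rfl fun c _ => ?_, Finset.sum_const,
        Finset.card_univ, hF, smul_eq_mul]
      rw [← hcount a (D.mem_fixed.mpr ha) b c, Finset.card_filter]
      simp only [ha, true_and]
    · simp [ha]
  rw [htotal, eq_div_iff (by positivity)]
  have hq : (2 : ℚ) * (p ^ d + 1) * ((∑ a ∈ D.fixed, ∑ b,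
      if IsHyperbolicCount (D.form a b) s then 1 else 0 : ℕ) : ℚ)
      = p ^ d * (p ^ s + 1) * (p ^ (2 * s) - 1) := by
    exact_mod_cast hmain
  push_cast at hq ⊢
  linear_combination (p : ℚ) ^ (2 * s) * hq
end

section
/- Assume gcd(s+l,2l) = gcd(s,l) = d and d is odd. Then the number of quadruples (a,b,c,h) ∈ F_{p^s} × F_q × F_q × F_p for which the codeword c(a,b,c,h) has Hamming weight p^{m−1}(p−1) + p^{s−1} equals p^{m+d}(p−1)(p^s+1)(p^m−1)/(2(p^d+1)). -/
section QuadraticSums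

variable {p : ℕ} [Fact p.Prime]

/-- The quadratic character of `ZMod p` with complex values. -/
noncomputable def qchar (p : ℕ) [Fact p.Prime] : MulChar (ZMod p) ℂ :=
  (quadraticChar (ZMod p)).ringHomComp (Int.castRingHom ℂ)

/-- The quadratic Gauss sum of `ZMod p`. -/
noncomputable def quadGauss (p : ℕ) [Fact p.Prime] : ℂ :=
  gaussSum (qchar p) (ZMod.stdAddChar (N := p))

lemma qchar_apply (a : ZMod p) : qchar p a = ((quadraticChar (ZMod p) a : ℤ) : ℂ) := rfl

lemma qchar_sq {a : ZMod p} (ha : a ≠ 0) : qchar p a ^ 2 = 1 := by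
  rw [qchar_apply]
  exact_mod_cast quadraticChar_sq_one ha

lemma qchar_ne_one (hp : p ≠ 2) : qchar p ≠ 1 := by
  obtain ⟨a, ha⟩ := quadraticChar_exists_neg_one (F := ZMod p) (by rwa [ZMod.ringChar_zmod_n])
  intro h
  have h1 : qchar p a = -1 := by rw [qchar_apply, ha]; simp
  have ha0 : a ≠ 0 := by
    rintro rfl
    simp at ha
  rw [h, MulChar.one_apply (isUnit_iff_ne_zero.mpr ha0)] at h1
  norm_num at h1

lemma qchar_isQuadratic : (qchar p).IsQuadratic :=
  (quadraticChar_isQuadratic (ZMod p)).comp _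

lemma quadGauss_sq (hp : p ≠ 2) : quadGauss p ^ 2 = qchar p (-1) * p := by
  have h := gaussSum_sq (qchar_ne_one hp) (qchar_isQuadratic (p := p))
    (ZMod.isPrimitive_stdAddChar p)
  rwa [ZMod.card] at h

lemma AddChar.apply_sum_eq_prod {A M ι : Type*} [AddCommMonoid A] [CommMonoid M]
    (ψ : AddChar A M) (s : Finset ι) (f : ι → A) : ψ (∑ i ∈ s, f i) = ∏ i ∈ s, ψ (f i) :=
  map_prod ψ.toMonoidHom (fun i => Multiplicative.ofAdd (f i)) s

lemma sum_stdAddChar_mul (b : ZMod p) :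
    ∑ t : ZMod p, ZMod.stdAddChar (N := p) (t * b) = if b = 0 then (p : ℂ) else 0 := by
  rw [AddChar.sum_mulShift b (ZMod.isPrimitive_stdAddChar p), ZMod.card]
  split_ifs <;> simp

lemma sum_stdAddChar_sq (hp : p ≠ 2) {a : ZMod p} (ha : a ≠ 0) :
    ∑ t : ZMod p, ZMod.stdAddChar (N := p) (a * t ^ 2) = qchar p a * quadGauss p := by
  have hroots (u : ZMod p) : ((Finset.univ.filter fun t : ZMod p => t ^ 2 = u).card : ℂ)
      = qchar p u + 1 := by
    have := quadraticChar_card_sqrts (F := ZMod p) (by rwa [ZMod.ringChar_zmod_n]) u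
    rw [qchar_apply, ← Int.cast_one, ← Int.cast_add, ← this]
    simp
  have hG : gaussSum (qchar p) ((ZMod.stdAddChar (N := p)).mulShift a)
      = qchar p a * quadGauss p := by
    have h := gaussSum_mulShift_eq (qchar p) (ZMod.stdAddChar (N := p)) (Units.mk0 a ha)
    rw [qchar_isQuadratic.inv] at h
    exact h
  calc ∑ t : ZMod p, ZMod.stdAddChar (N := p) (a * t ^ 2)
      = ∑ u : ZMod p, ∑ t ∈ Finset.univ.filter (fun t : ZMod p => t ^ 2 = u),
          ZMod.stdAddChar (N := p) (a * t ^ 2) :=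
        (Finset.sum_fiberwise _ _ _).symm
    _ = ∑ u : ZMod p, (qchar p u + 1) * ZMod.stdAddChar (N := p) (a * u) := by
        refine Finset.sum_congr rfl fun u _ => ?_
        rw [← hroots, ← nsmul_eq_mul, ← Finset.sum_const]
        refine Finset.sum_congr rfl fun t ht => ?_
        rw [(Finset.mem_filter.mp ht).2]
    _ = gaussSum (qchar p) ((ZMod.stdAddChar (N := p)).mulShift a)
        + ∑ u : ZMod p, ZMod.stdAddChar (N := p) (u * a) := by
        simp only [gaussSum, AddChar.mulShift_apply, ← Finset.sum_add_distrib]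
        refine Finset.sum_congr rfl fun u _ => ?_
        rw [mul_comm u a]
        ring
    _ = _ := by rw [sum_stdAddChar_mul, if_neg ha, hG, add_zero]

lemma sum_stdAddChar_quadratic (hp : p ≠ 2) {w y : ZMod p} (hw : w ≠ 0) (hy : y ≠ 0)
    (c : ZMod p) :
    ∑ t : ZMod p, ZMod.stdAddChar (N := p) (y * (w * t ^ 2 + c * t))
      = qchar p y * ZMod.stdAddChar (N := p) (-(y * (c ^ 2 / (4 * w))))
        * (qchar p w * quadGauss p) := by
  have h2 : (2 : ZMod p) ≠ 0 := by
    intro h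
    have := (ZMod.natCast_eq_zero_iff 2 p).mp (by exact_mod_cast h)
    exact hp ((Nat.prime_dvd_prime_iff_eq (Fact.out) Nat.prime_two).mp this)
  have h4 : (4 : ZMod p) ≠ 0 := by
    have : (4 : ZMod p) = 2 * 2 := by norm_num
    rw [this]; exact mul_ne_zero h2 h2
  rw [← Equiv.sum_comp (Equiv.subRight (c / (2 * w)))]
  have (t : ZMod p) : ZMod.stdAddChar (N := p) (y * (w * (Equiv.subRight (c / (2 * w)) t) ^ 2
      + c * Equiv.subRight (c / (2 * w)) t))
      = ZMod.stdAddChar (N := p) (-(y * (c ^ 2 / (4 * w))))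
        * ZMod.stdAddChar (N := p) ((y * w) * t ^ 2) := by
    rw [← AddChar.map_add_eq_mul]
    congr 1
    simp only [Equiv.subRight_apply]
    field_simp
    ring
  simp_rw [this]
  rw [← Finset.mul_sum, sum_stdAddChar_sq hp (mul_ne_zero hy hw), map_mul]
  ring

open Finset in
lemma exists_sum_stdAddChar_weighted (hp : p ≠ 2) {n : ℕ} (w : Fin n → ZMod p) :
    ∃ r ≤ n, ∃ S : ℂ, S ^ 2 = (qchar p (-1) * p) ^ r * (p ^ (n - r)) ^ 2 ∧
      (∀ y ≠ 0, ∑ v : Fin n → ZMod p, ZMod.stdAddChar (N := p) (y * ∑ i, w i * v i ^ 2)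
        = qchar p y ^ r * S) ∧
      ∀ c : Fin n → ZMod p,
        (∃ θ : ZMod p, ∀ y ≠ 0,
          ∑ v : Fin n → ZMod p, ZMod.stdAddChar (N := p) (y * ∑ i, (w i * v i ^ 2 + c i * v i))
            = qchar p y ^ r * ZMod.stdAddChar (N := p) (-(y * θ)) * S)
        ∨ (r < n ∧ ∀ y ≠ 0,
          ∑ v : Fin n → ZMod p, ZMod.stdAddChar (N := p) (y * ∑ i, (w i * v i ^ 2 + c i * v i))
            = 0) := by
  have hprod (c : Fin n → ZMod p) (y : ZMod p) :
      ∑ v : Fin n → ZMod p, ZMod.stdAddChar (N := p) (y * ∑ i, (w i * v i ^ 2 + c i * v i))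
        = ∏ i, ∑ t : ZMod p, ZMod.stdAddChar (N := p) (y * (w i * t ^ 2 + c i * t)) := by
    rw [Fintype.prod_sum]
    refine sum_congr rfl fun v _ => ?_
    rw [mul_sum, AddChar.apply_sum_eq_prod]
  set I : Finset (Fin n) := univ.filter fun i => w i ≠ 0 with hI
  have hIc : #Iᶜ = n - #I := by rw [card_compl, Fintype.card_fin]
  have hsum (c : Fin n → ZMod p) (hc : ∀ i, w i = 0 → c i = 0) (y : ZMod p) (hy : y ≠ 0) :
      ∑ v : Fin n → ZMod p, ZMod.stdAddChar (N := p) (y * ∑ i, (w i * v i ^ 2 + c i * v i))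
        = qchar p y ^ #I * ZMod.stdAddChar (N := p) (-(y * ∑ i ∈ I, c i ^ 2 / (4 * w i)))
          * ((∏ i ∈ I, (qchar p (w i) * quadGauss p)) * p ^ (n - #I)) := by
    rw [hprod, ← prod_mul_prod_compl I]
    have h1 : ∏ i ∈ Iᶜ, ∑ t : ZMod p, ZMod.stdAddChar (N := p) (y * (w i * t ^ 2 + c i * t))
        = (p : ℂ) ^ (n - #I) := by
      rw [← hIc, ← prod_const]
      refine prod_congr rfl fun i hi => ?_
      have hwi : w i = 0 := by simpa [hI] using hi
      simp [hwi, hc i hwi, ZMod.card]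
    rw [h1, prod_congr rfl fun i hi =>
      sum_stdAddChar_quadratic hp (mem_filter.mp hi).2 hy (c i), prod_mul_distrib,
      prod_mul_distrib, prod_const, ← AddChar.apply_sum_eq_prod, sum_neg_distrib, mul_sum]
    ring
  refine ⟨#I, by simpa using card_le_univ I,
    (∏ i ∈ I, (qchar p (w i) * quadGauss p)) * p ^ (n - #I), ?_, fun y hy => ?_, fun c => ?_⟩
  · rw [mul_pow, ← prod_pow]
    congr 1
    rw [← prod_const]
    refine prod_congr rfl fun i hi => ?_
    rw [mul_pow, qchar_sq (mem_filter.mp hi).2, quadGauss_sq hp, one_mul]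
  · simpa using hsum 0 (fun _ _ => rfl) y hy
  by_cases hc : ∀ i, w i = 0 → c i = 0
  · left
    exact ⟨∑ i ∈ I, c i ^ 2 / (4 * w i), hsum c hc⟩
  · right
    push Not at hc
    obtain ⟨i, hwi, hci⟩ := hc
    refine ⟨?_, fun y hy => ?_⟩
    · have : #I < #(univ : Finset (Fin n)) := card_lt_card
        ⟨subset_univ _, fun h => (mem_filter.mp (h (mem_univ i))).2 hwi⟩
      simpa using this
    · rw [hprod]
      refine prod_eq_zero (mem_univ i) ?_
      have := sum_stdAddChar_mul (p := p) (y * c i)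
      rw [if_neg (mul_ne_zero hy hci)] at this
      rw [← this]
      refine sum_congr rfl fun t _ => ?_
      rw [hwi]
      congr 1
      ring

theorem exists_sum_stdAddChar_quadraticForm (hp : p ≠ 2) {V : Type*} [AddCommGroup V]
    [Module (ZMod p) V] [Fintype V] (Q : QuadraticForm (ZMod p) V) :
    ∃ r ≤ Module.finrank (ZMod p) V, ∃ S : ℂ,
      S ^ 2 = (qchar p (-1) * p) ^ r * (p ^ (Module.finrank (ZMod p) V - r)) ^ 2 ∧
      (∀ y ≠ 0, ∑ v, ZMod.stdAddChar (N := p) (y * Q v) = qchar p y ^ r * S) ∧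
      ∀ L : V →ₗ[ZMod p] ZMod p,
        (∃ θ : ZMod p, ∀ y ≠ 0, ∑ v, ZMod.stdAddChar (N := p) (y * (Q v + L v))
            = qchar p y ^ r * ZMod.stdAddChar (N := p) (-(y * θ)) * S)
        ∨ (r < Module.finrank (ZMod p) V ∧
          ∀ y ≠ 0, ∑ v, ZMod.stdAddChar (N := p) (y * (Q v + L v)) = 0) := by
  have h2 : (2 : ZMod p) ≠ 0 := by
    intro h
    have := (ZMod.natCast_eq_zero_iff 2 p).mp (by exact_mod_cast h)
    exact hp ((Nat.prime_dvd_prime_iff_eq (Fact.out) Nat.prime_two).mp this)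
  have : Invertible (2 : ZMod p) := invertibleOfNonzero h2
  have : Module.Finite (ZMod p) V := Module.Finite.of_finite
  obtain ⟨w, ⟨f⟩⟩ := QuadraticForm.equivalent_weightedSumSquares Q
  obtain ⟨r, hr, S, hS, h0, h⟩ := exists_sum_stdAddChar_weighted hp w
  have key (L : V →ₗ[ZMod p] ZMod p) (y : ZMod p) : ∑ v, ZMod.stdAddChar (N := p) (y * (Q v + L v))
      = ∑ v : Fin (Module.finrank (ZMod p) V) → ZMod p, ZMod.stdAddChar (N := p)
        (y * ∑ i, (w i * v i ^ 2 + L (f.symm (Pi.single i 1)) * v i)) := by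
    rw [← Equiv.sum_comp f.symm.toLinearEquiv.toEquiv]
    refine Finset.sum_congr rfl fun v _ => ?_
    congr 2
    rw [Finset.sum_add_distrib]
    congr 1
    · have := f.symm.map_app v
      refine this.trans ?_
      simp [QuadraticMap.weightedSumSquares_apply, pow_two]
    · change L.comp f.symm.toLinearEquiv.toLinearMap v = _
      rw [LinearMap.pi_apply_eq_sum_univ]
      simp only [smul_eq_mul, LinearMap.comp_apply]
      refine Finset.sum_congr rfl fun i _ => ?_
      rw [mul_comm]
      congr 2
      change f.symm.toLinearEquiv _ = f.symm.toLinearEquiv _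
      congr 1
      ext j
      simp [Pi.single_apply, eq_comm]
  refine ⟨r, hr, S, hS, fun y hy => ?_, fun L => ?_⟩
  · simpa [h0 y hy] using key 0 y
  · simp_rw [key]
    exact h _

lemma card_mul_card_filter_eq_zero {V : Type*} [Fintype V] (f : V → ZMod p) :
    (p : ℂ) * (Finset.univ.filter fun v => f v = 0).card
      = Fintype.card V + ∑ y ∈ Finset.univ.erase (0 : ZMod p), ∑ v,
          ZMod.stdAddChar (N := p) (y * f v) := by
  have h0 : (Fintype.card V : ℂ) = ∑ v, ZMod.stdAddChar (N := p) (0 * f v) := by simp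
  rw [h0, Finset.add_sum_erase _ (fun y => ∑ v, ZMod.stdAddChar (N := p) (y * f v))
    (Finset.mem_univ 0), Finset.sum_comm]
  simp_rw [sum_stdAddChar_mul]
  rw [← Finset.sum_filter, Finset.sum_const, nsmul_eq_mul, mul_comm]

lemma norm_qchar {a : ZMod p} (ha : a ≠ 0) : ‖qchar p a‖ = 1 := by
  have h := congrArg norm (qchar_sq ha)
  rw [norm_pow, norm_one] at h
  exact (pow_eq_one_iff_of_nonneg (norm_nonneg _) two_ne_zero).mp h

lemma sum_erase_stdAddChar_mul (k : ZMod p) :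
    ∑ y ∈ Finset.univ.erase (0 : ZMod p), ZMod.stdAddChar (N := p) (y * k)
      = (if k = 0 then (p : ℂ) else 0) - 1 := by
  rw [← sum_stdAddChar_mul, ← Finset.add_sum_erase _ _ (Finset.mem_univ (0 : ZMod p))]
  simp

lemma sum_erase_qchar_stdAddChar_mul (hp : p ≠ 2) (k : ZMod p) :
    ∑ y ∈ Finset.univ.erase (0 : ZMod p), qchar p y * ZMod.stdAddChar (N := p) (y * k)
      = qchar p k * quadGauss p := by
  have h : ∑ y ∈ Finset.univ.erase (0 : ZMod p), qchar p y * ZMod.stdAddChar (N := p) (y * k)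
      = gaussSum (qchar p) ((ZMod.stdAddChar (N := p)).mulShift k) := by
    rw [gaussSum, ← Finset.add_sum_erase _ _ (Finset.mem_univ (0 : ZMod p))]
    simp [AddChar.mulShift_apply, mul_comm, MulChar.map_zero (qchar p)]
  rw [h]
  by_cases hk : k = 0
  · subst hk
    rw [AddChar.mulShift_zero, gaussSum_one_right (qchar_ne_one hp), MulChar.map_zero, zero_mul]
  · have h := gaussSum_mulShift_eq (qchar p) (ZMod.stdAddChar (N := p)) (Units.mk0 k hk)
    rw [qchar_isQuadratic.inv] at h
    exact h

theorem quadraticForm_sum_and_weight (hp : p ≠ 2) {V : Type*} [AddCommGroup V]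
    [Module (ZMod p) V] [Fintype V] (Q : QuadraticForm (ZMod p) V) {s : ℕ} (hs : 1 ≤ s)
    (hV : Module.finrank (ZMod p) V = 2 * s) :
    ∃ r ≤ 2 * s, ∃ S : ℂ, ‖S‖ ^ 2 = (p : ℝ) ^ (4 * s - r) ∧
      (∀ y ≠ 0, ∑ v, ZMod.stdAddChar (N := p) (y * Q v) = qchar p y ^ r * S) ∧
      (r = 2 * s → S = p ^ s ∨ S = -p ^ s) ∧
      ∃ θ : (V →ₗ[ZMod p] ZMod p) → ZMod p, ∀ L h,
        (Finset.univ.filter fun v => Q v + L v + h ≠ 0).card = p ^ (2 * s - 1) * (p - 1) + p ^ (s - 1)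
          ↔ S = p ^ s ∧ h ≠ θ L := by
  obtain ⟨r, hr, S, hS, h0, hL⟩ := exists_sum_stdAddChar_quadraticForm hp Q
  rw [hV] at hr hS hL
  have hp3 : 3 ≤ p := by
    have := (Fact.out : p.Prime).two_le
    omega
  have hpR : (3 : ℝ) ≤ p := by exact_mod_cast hp3
  have hn1 : ‖qchar p (-1)‖ = 1 := norm_qchar (by simp)
  have hnorm : ‖S‖ ^ 2 = (p : ℝ) ^ (4 * s - r) := by
    have := congrArg norm hS
    simp only [norm_pow, norm_mul, hn1, one_mul, Complex.norm_natCast] at this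
    rw [this, ← pow_mul, ← pow_add]
    congr 1
    omega
  have hrS : S = p ^ s → r = 2 * s := by
    intro h
    rw [h, norm_pow, Complex.norm_natCast, ← pow_mul] at hnorm
    have := pow_right_injective₀ (by linarith) (by linarith) hnorm
    omega
  have hcount (L : V →ₗ[ZMod p] ZMod p) (h : ZMod p) :
      (Finset.univ.filter fun v => Q v + L v + h ≠ 0).card
        = p ^ (2 * s - 1) * (p - 1) + p ^ (s - 1)
      ↔ ∑ y ∈ Finset.univ.erase (0 : ZMod p), ZMod.stdAddChar (N := p) (y * h) *
        ∑ v, ZMod.stdAddChar (N := p) (y * (Q v + L v)) = -(p : ℂ) ^ s := by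
    have h1 := card_mul_card_filter_eq_zero (p := p) fun v => Q v + L v + h
    have h2 := Finset.card_filter_add_card_filter_not (s := (Finset.univ : Finset V))
      (fun v => Q v + L v + h = 0)
    have hcV : Fintype.card V = p ^ (2 * s) := by
      rw [Module.card_eq_pow_finrank (K := ZMod p), hV, ZMod.card]
    rw [Finset.card_univ, hcV] at h2
    rw [hcV] at h1
    have h3 : ∑ y ∈ Finset.univ.erase (0 : ZMod p), ∑ v,
          ZMod.stdAddChar (N := p) (y * (Q v + L v + h))
        = ∑ y ∈ Finset.univ.erase (0 : ZMod p), ZMod.stdAddChar (N := p) (y * h) *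
        ∑ v, ZMod.stdAddChar (N := p) (y * (Q v + L v)) := by
      refine Finset.sum_congr rfl fun y _ => ?_
      rw [Finset.mul_sum]
      refine Finset.sum_congr rfl fun v _ => ?_
      rw [← AddChar.map_add_eq_mul]
      congr 1
      ring
    rw [h3] at h1
    have e1 : (p : ℂ) ^ (2 * s) = p * p ^ (2 * s - 1) := by
      rw [← pow_succ']; congr 1; omega
    have e2 : (p : ℂ) ^ s = p * p ^ (s - 1) := by
      rw [← pow_succ']; congr 1; omega
    have hp0 : (p : ℂ) ≠ 0 := by
      have : p ≠ 0 := by omega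
      exact_mod_cast this
    set N := (Finset.univ.filter fun v => Q v + L v + h = 0).card
    set W := (Finset.univ.filter fun v => ¬ (Q v + L v + h = 0)).card
    change W = _ ↔ _
    have h2' : (N : ℂ) + W = p ^ (2 * s) := by exact_mod_cast h2
    have h4 : W = p ^ (2 * s - 1) * (p - 1) + p ^ (s - 1)
        ↔ (W : ℂ) = p ^ (2 * s - 1) * (p - 1) + p ^ (s - 1) := by
      rw [← Nat.cast_inj (R := ℂ)]
      push_cast [show 1 ≤ p by omega]
      rfl
    rw [h4]
    push_cast at h1
    constructor
    · intro hW
      linear_combination (-1 : ℂ) * h1 + p * h2' - p * hW + e2 + (p - 1) * e1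
    · intro hT
      apply mul_left_cancel₀ hp0
      linear_combination (-1 : ℂ) * h1 + p * h2' - hT + e2 + (p - 1) * e1
  have hev (k : ℕ) (hk : r = 2 * k) : S ^ 2 = (p : ℂ) ^ (4 * s - r) := by
    rw [hS, mul_pow, hk, pow_mul (qchar p (-1)), qchar_sq (by simp), one_pow, one_mul,
      ← pow_mul, ← pow_add]
    congr 1
    omega
  refine ⟨r, hr, S, hnorm, h0, fun hr2 => ?_, ?_⟩
  · rw [← sq_eq_sq_iff_eq_or_eq_neg, hev s hr2, ← pow_mul]
    congr 1
    omega
  have main (L : V →ₗ[ZMod p] ZMod p) : ∃ θ : ZMod p, ∀ h,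
      (Finset.univ.filter fun v => Q v + L v + h ≠ 0).card
        = p ^ (2 * s - 1) * (p - 1) + p ^ (s - 1) ↔ S = p ^ s ∧ h ≠ θ := by
    rcases hL L with ⟨θ, hθ⟩ | ⟨hlt, hzero⟩
    · refine ⟨θ, fun h => ?_⟩
      rw [hcount]
      have hsum : ∑ y ∈ Finset.univ.erase (0 : ZMod p), ZMod.stdAddChar (N := p) (y * h) *
          ∑ v, ZMod.stdAddChar (N := p) (y * (Q v + L v))
          = S * ∑ y ∈ Finset.univ.erase (0 : ZMod p), qchar p y ^ r *
            ZMod.stdAddChar (N := p) (y * (h - θ)) := by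
        rw [Finset.mul_sum]
        refine Finset.sum_congr rfl fun y hy => ?_
        rw [hθ y (Finset.ne_of_mem_erase hy), mul_sub, sub_eq_add_neg, AddChar.map_add_eq_mul]
        ring
      rw [hsum]
      obtain ⟨k, hk | hk⟩ := Nat.even_or_odd' r
      · have h1 : ∑ y ∈ Finset.univ.erase (0 : ZMod p), qchar p y ^ r *
            ZMod.stdAddChar (N := p) (y * (h - θ))
            = (if h - θ = 0 then (p : ℂ) else 0) - 1 := by
          rw [← sum_erase_stdAddChar_mul]
          refine Finset.sum_congr rfl fun y hy => ?_
          rw [hk, pow_mul, qchar_sq (Finset.ne_of_mem_erase hy), one_pow, one_mul]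
        rw [h1]
        by_cases hh : h = θ
        · simp only [hh, sub_self, if_true, ne_eq, not_true_eq_false, and_false, iff_false]
          intro hbad
          have h3 := congrArg (fun z => ‖z‖ ^ 2) hbad
          have h4 : ‖(p : ℂ) - 1‖ = (p : ℝ) - 1 := by
            have : (p : ℂ) - 1 = ((p - 1 : ℝ) : ℂ) := by push_cast; rfl
            rw [this, Complex.norm_real, Real.norm_of_nonneg (by linarith)]
          simp only [norm_mul, mul_pow, hnorm, norm_neg, norm_pow, Complex.norm_natCast, h4] at h3
          have h5 : (p : ℝ) ^ (2 * s) ≤ (p : ℝ) ^ (4 * s - r) :=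
            pow_le_pow_right₀ (by linarith) (by omega)
          rw [← pow_mul, mul_comm s 2] at h3
          have h6 : (0 : ℝ) < (p : ℝ) ^ (2 * s) := by positivity
          have h7 : (4 : ℝ) ≤ ((p : ℝ) - 1) ^ 2 := by nlinarith
          nlinarith
        · simp only [sub_eq_zero, hh, if_false, ne_eq, not_false_eq_true, and_true]
          constructor
          · intro h3; linear_combination -h3
          · intro h3; rw [h3]; ring
      · have h1 : ∑ y ∈ Finset.univ.erase (0 : ZMod p), qchar p y ^ r *
            ZMod.stdAddChar (N := p) (y * (h - θ)) = qchar p (h - θ) * quadGauss p := by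
          rw [← sum_erase_qchar_stdAddChar_mul hp]
          refine Finset.sum_congr rfl fun y hy => ?_
          rw [hk, pow_succ, pow_mul, qchar_sq (Finset.ne_of_mem_erase hy), one_pow, one_mul]
        rw [h1]
        refine iff_of_false ?_ fun h => by have := hrS h.1; omega
        intro hbad
        have h3 := congrArg (fun z => ‖z‖ ^ 2) hbad
        have hG : ‖quadGauss p‖ ^ 2 = p := by
          rw [← norm_pow, quadGauss_sq hp, norm_mul, hn1, one_mul, Complex.norm_natCast]
        simp only [norm_mul, mul_pow, hnorm, norm_neg, norm_pow, Complex.norm_natCast, hG] at h3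
        have h6 : (0 : ℝ) < ((p : ℝ) ^ s) ^ 2 := by positivity
        by_cases hh : h - θ = 0
        · rw [hh, MulChar.map_zero, norm_zero, zero_pow two_ne_zero, zero_mul, mul_zero] at h3
          exact absurd h3 h6.ne
        · rw [norm_qchar hh, one_pow, one_mul, ← pow_succ, ← pow_mul] at h3
          have := pow_right_injective₀ (by linarith) (by linarith) h3
          omega
    · refine ⟨0, fun h => ?_⟩
      rw [hcount, Finset.sum_eq_zero fun y hy => by
        rw [hzero y (Finset.ne_of_mem_erase hy), mul_zero]]
      refine iff_of_false ?_ fun h => by have := hrS h.1; omega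
      intro hbad
      have hp0 : (p : ℂ) ≠ 0 := by
        have : p ≠ 0 := by omega
        exact_mod_cast this
      exact pow_ne_zero s hp0 (by linear_combination hbad)
  choose θ hθ using main
  exact ⟨θ, fun L h => hθ L h⟩

end QuadraticSums

section CommutingAutomorphisms

open Finset

variable {F : Type*} [Field F] [Fintype F] [DecidableEq F]

/-- The exponential sum `∑ x, Ψ (a x c(x) + b x σ(x))`. -/
noncomputable def autSum (Ψ : AddChar F ℂ) (σ c : F ≃+* F) (a b : F) : ℂ :=
  ∑ x, Ψ (a * (x * c x) + b * (x * σ x))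

/-- The additive map polarizing `a x c(x) + b x σ(x)`. -/
def autPolar (σ c : F ≃+* F) (a b x : F) : F :=
  2 * a * c x + b * σ x + σ.symm (b * x)

/-- An involution `c` and a commuting automorphism `σ` of a finite field of odd characteristic,
with a primitive additive character invariant under both, such that `c` fixes every element fixed
by `σ ∘ c`. -/
structure CommutingAutomorphisms (Ψ : AddChar F ℂ) (σ c : F ≃+* F) : Prop where
  prim : Ψ.IsPrimitive
  char_left : ∀ x, Ψ (σ x) = Ψ x
  char_right : ∀ x, Ψ (c x) = Ψ x
  invol : ∀ x, c (c x) = x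
  comm : ∀ x, c (σ x) = σ (c x)
  two_ne : (2 : F) ≠ 0
  fixed : ∀ x, σ (c x) = x → c x = x

omit [DecidableEq F] in
lemma sum_addChar_addSubgroup (χ : AddChar F ℂ) (A : AddSubgroup F) [DecidablePred (· ∈ A)] :
    ∑ x ∈ univ.filter (· ∈ A), χ x
      = if ∀ x ∈ A, χ x = 1 then ((univ.filter (· ∈ A)).card : ℂ) else 0 := by
  split_ifs with h
  · rw [sum_congr rfl fun x hx => h x (mem_filter.mp hx).2]
    simp
  · push Not at h
    obtain ⟨t, ht, hne⟩ := h
    have h1 : χ t * ∑ x ∈ univ.filter (· ∈ A), χ x = ∑ x ∈ univ.filter (· ∈ A), χ x := by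
      rw [mul_sum]
      refine sum_bij' (fun x _ => t + x) (fun x _ => -t + x) ?_ ?_ ?_ ?_ ?_
      · intro x hx
        simpa using A.add_mem ht (mem_filter.mp hx).2
      · intro x hx
        simpa using A.add_mem (A.neg_mem ht) (mem_filter.mp hx).2
      · intro x _; simp
      · intro x _; simp
      · intro x _
        rw [AddChar.map_add_eq_mul]
    have h2 : (χ t - 1) * ∑ x ∈ univ.filter (· ∈ A), χ x = 0 := by
      rw [sub_mul, h1, one_mul, sub_self]
    exact (mul_eq_zero.mp h2).resolve_left (sub_ne_zero.mpr hne)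

/-- The elements fixed by a ring automorphism, as an additive subgroup. -/
def fixedAddSubgroup (τ : F ≃+* F) : AddSubgroup F where
  carrier := {x | τ x = x}
  zero_mem' := map_zero τ
  add_mem' := fun {x y} hx hy => by
    simp only [Set.mem_ofPred_eq] at *
    rw [map_add, hx, hy]
  neg_mem' := fun {x} hx => by
    simp only [Set.mem_ofPred_eq] at *
    rw [map_neg, hx]

/-- The elements fixed by a ring automorphism, as a finite set. -/
def fixedFinset (τ : F ≃+* F) : Finset F := univ.filter fun x => τ x = x

lemma mem_fixedFinset {τ : F ≃+* F} {x : F} : x ∈ fixedFinset τ ↔ τ x = x := by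
  simp [fixedFinset]

lemma sum_fixedFinset (χ : AddChar F ℂ) (τ : F ≃+* F) [Decidable (∀ x, τ x = x → χ x = 1)] :
    ∑ x ∈ fixedFinset τ, χ x
      = if ∀ x, τ x = x → χ x = 1 then ((fixedFinset τ).card : ℂ) else 0 := by
  classical
  have h := sum_addChar_addSubgroup χ (fixedAddSubgroup τ)
  have h1 : (univ.filter (· ∈ fixedAddSubgroup τ)) = fixedFinset τ := by
    ext x
    simp only [mem_filter, mem_univ, true_and, mem_fixedFinset]
    exact Iff.rfl
  rw [h1] at h
  convert h using 1
  exact if_congr Iff.rfl rfl rfl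

lemma addChar_sum_mul {Ψ : AddChar F ℂ} (hΨ : Ψ.IsPrimitive) (b : F) :
    ∑ x, Ψ (x * b) = if b = 0 then (Fintype.card F : ℂ) else 0 := by
  rw [AddChar.sum_mulShift b hΨ]
  split_ifs <;> simp

omit [Fintype F] [DecidableEq F] in
lemma exists_addChar_mul_ne_one {Ψ : AddChar F ℂ} (hΨ : Ψ.IsPrimitive) {b : F} (hb : b ≠ 0) :
    ∃ x, Ψ (b * x) ≠ 1 := by
  obtain ⟨x, hx⟩ := AddChar.ne_one_iff.mp (hΨ hb)
  exact ⟨x, by simpa [AddChar.mulShift_apply] using hx⟩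

/-- The nonzero pairs `(a, b)` with `c a = a`. -/
def nonzeroFixedPairs (c : F ≃+* F) : Finset (F × F) :=
  univ.filter fun w => c w.1 = w.1 ∧ w ≠ 0

lemma mem_nonzeroFixedPairs {c : F ≃+* F} {w : F × F} :
    w ∈ nonzeroFixedPairs c ↔ c w.1 = w.1 ∧ w ≠ 0 := by
  simp [nonzeroFixedPairs]

namespace CommutingAutomorphisms

variable {Ψ : AddChar F ℂ} {σ c : F ≃+* F} (H : CommutingAutomorphisms Ψ σ c)

include H

omit [Fintype F] [DecidableEq F] in
lemma char_symm (x : F) : Ψ (σ.symm x) = Ψ x := by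
  rw [← H.char_left, RingEquiv.apply_symm_apply]

omit [Fintype F] [DecidableEq F] in
lemma comm_symm (x : F) : c (σ.symm x) = σ.symm (c x) := by
  apply σ.injective
  rw [← H.comm, RingEquiv.apply_symm_apply, RingEquiv.apply_symm_apply]

omit [Fintype F] [DecidableEq F] in
lemma char_add {a : F} (ha : c a = a) (b y v : F) :
    Ψ (a * ((y + v) * c (y + v)) + b * ((y + v) * σ (y + v)))
      = Ψ (a * (y * c y) + b * (y * σ y)) * Ψ (a * (v * c v) + b * (v * σ v))
        * Ψ (y * autPolar σ c a b v) := by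
  have h1 : Ψ (a * (v * c y)) = Ψ (y * (a * c v)) := by
    have e : c (a * (v * c y)) = y * (a * c v) := by
      simp only [map_mul, ha, H.invol]; ring
    rw [← H.char_right, e]
  have h2 : Ψ (b * (v * σ y)) = Ψ (y * σ.symm (b * v)) := by
    rw [← H.char_symm, ← mul_assoc, map_mul, RingEquiv.symm_apply_apply, mul_comm]
  have e1 : a * ((y + v) * c (y + v)) + b * ((y + v) * σ (y + v))
      = (a * (y * c y) + b * (y * σ y)) + (a * (v * c v) + b * (v * σ v))
        + (y * (a * c v) + a * (v * c y)) + (y * (b * σ v) + b * (v * σ y)) := by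
    simp only [map_add]; ring
  have e2 : y * autPolar σ c a b v
      = (y * (a * c v) + y * (a * c v)) + (y * (b * σ v) + y * σ.symm (b * v)) := by
    rw [autPolar]; ring
  rw [e1, e2]
  simp only [AddChar.map_add_eq_mul, h1, h2]
  ring

omit [Fintype F] [DecidableEq F] in
lemma char_eq_polar (a b v : F) :
    Ψ (a * (v * c v) + b * (v * σ v)) = Ψ (v * autPolar σ c a b v / 2) := by
  have h2 := H.two_ne
  have hs2 : σ 2 = 2 := map_ofNat σ 2
  have h1 : Ψ (v * σ.symm (b * v) / 2) = Ψ (b * (v * σ v) / 2) := by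
    rw [← H.char_left, map_div₀, map_mul, RingEquiv.apply_symm_apply, hs2]
    congr 1; ring
  have e1 : v * autPolar σ c a b v / 2
      = (a * (v * c v) + b * (v * σ v) / 2) + v * σ.symm (b * v) / 2 := by
    rw [autPolar]; field_simp
  rw [e1, AddChar.map_add_eq_mul Ψ (a * (v * c v) + b * (v * σ v) / 2), h1,
    ← AddChar.map_add_eq_mul]
  congr 1
  field_simp
  ring

lemma autSum_mul_conj {a : F} (ha : c a = a) (b : F) :
    autSum Ψ σ c a b * (starRingEnd ℂ) (autSum Ψ σ c a b)
      = Fintype.card F * (univ.filter fun x => autPolar σ c a b x = 0).card := by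
  have hinner (v : F) : ∑ y, Ψ (a * ((y + v) * c (y + v)) + b * ((y + v) * σ (y + v)))
        * (starRingEnd ℂ) (Ψ (a * (y * c y) + b * (y * σ y)))
      = if autPolar σ c a b v = 0 then (Fintype.card F : ℂ) else 0 := by
    have h1 (y : F) : Ψ (a * ((y + v) * c (y + v)) + b * ((y + v) * σ (y + v)))
        * (starRingEnd ℂ) (Ψ (a * (y * c y) + b * (y * σ y)))
        = Ψ (a * (v * c v) + b * (v * σ v)) * Ψ (y * autPolar σ c a b v) := by
      rw [H.char_add ha, ← AddChar.map_neg_eq_conj, mul_comm, ← mul_assoc, ← mul_assoc,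
        ← AddChar.map_add_eq_mul, neg_add_cancel, AddChar.map_zero_eq_one, one_mul]
    simp_rw [h1]
    rw [← mul_sum, addChar_sum_mul H.prim]
    split_ifs with h
    · rw [H.char_eq_polar, h]
      simp
    · rw [mul_zero]
  calc autSum Ψ σ c a b * (starRingEnd ℂ) (autSum Ψ σ c a b)
      = ∑ y, ∑ x, Ψ (a * (x * c x) + b * (x * σ x))
          * (starRingEnd ℂ) (Ψ (a * (y * c y) + b * (y * σ y))) := by
        rw [autSum, map_sum, sum_mul_sum, sum_comm]
    _ = ∑ y, ∑ v, Ψ (a * ((y + v) * c (y + v)) + b * ((y + v) * σ (y + v)))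
          * (starRingEnd ℂ) (Ψ (a * (y * c y) + b * (y * σ y))) := by
        refine sum_congr rfl fun y _ => ?_
        rw [← Equiv.sum_comp (Equiv.addLeft y)]
        rfl
    _ = _ := by
        rw [sum_comm]
        simp_rw [hinner]
        rw [← sum_filter, sum_const, nsmul_eq_mul, mul_comm]

lemma norm_autSum_sq {a : F} (ha : c a = a) (b : F) :
    ‖autSum Ψ σ c a b‖ ^ 2
      = (Fintype.card F : ℝ) * (univ.filter fun x => autPolar σ c a b x = 0).card := by
  have h := H.autSum_mul_conj ha b
  rw [Complex.mul_conj'] at h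
  exact_mod_cast h

omit H [DecidableEq F] in
lemma autSum_scale (a b : F) {r : F} (hr : r ≠ 0) :
    autSum Ψ σ c (a * (r * c r)) (b * (r * σ r)) = autSum Ψ σ c a b := by
  rw [autSum, autSum, ← Equiv.sum_comp (Equiv.mulLeft₀ r hr)
    (fun x => Ψ (a * (x * c x) + b * (x * σ x)))]
  refine sum_congr rfl fun x _ => ?_
  congr 1
  simp only [Equiv.mulLeft₀_apply, map_mul]
  ring

omit H [Fintype F] [DecidableEq F] in
lemma autPolar_scale (a b r x : F) :
    autPolar σ c (a * (r * c r)) (b * (r * σ r)) x = r * autPolar σ c a b (r * x) := by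
  simp only [autPolar, map_mul, RingEquiv.symm_apply_apply]
  ring

omit [Fintype F] [DecidableEq F] in
lemma autPolar_one_iff {a b : F} :
    (c a = a ∧ autPolar σ c a b 1 = 0) ↔ (c b = b ∧ a = -(b + σ.symm b) / 2) := by
  have h2 := H.two_ne
  have hc2 : c 2 = 2 := map_ofNat c 2
  constructor
  · rintro ⟨ha, h⟩
    simp only [autPolar, map_one, mul_one] at h
    refine ⟨?_, by field_simp; linear_combination h⟩
    have h' := congrArg c h
    simp only [map_add, map_mul, hc2, ha, map_zero, H.comm_symm] at h'
    set e := b - c b with he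
    have e1 : σ.symm e = -e := by
      rw [he, map_sub]; linear_combination h - h'
    have e2 : σ e = -e := by
      have := congrArg σ e1
      rw [RingEquiv.apply_symm_apply, map_neg] at this
      linear_combination this
    have e3 : c e = -e := by rw [he, map_sub, H.invol]; ring
    have e4 : c e = e := H.fixed e (by rw [e3, map_neg, e2, neg_neg])
    have e5 : 2 * e = 0 := by linear_combination e3 - e4
    have e6 : e = 0 := (mul_eq_zero.mp e5).resolve_left h2
    rw [he] at e6
    linear_combination -e6
  · rintro ⟨hb, rfl⟩
    refine ⟨?_, ?_⟩
    · rw [map_div₀, map_neg, map_add, hc2, hb, H.comm_symm, hb]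
    · simp only [autPolar, map_one, mul_one]
      field_simp
      ring

lemma sum_fixed_mul {γ : F} (hγ : c γ = γ) :
    ∑ t ∈ fixedFinset c, Ψ (γ * t) = if γ = 0 then ((fixedFinset c).card : ℂ) else 0 := by
  classical
  have h := sum_fixedFinset (Ψ.mulShift γ) c
  simp only [AddChar.mulShift_apply] at h
  rw [h]
  refine if_congr ⟨fun h1 => ?_, ?_⟩ rfl rfl
  · by_contra h0
    obtain ⟨x, hx⟩ := exists_addChar_mul_ne_one H.prim (mul_ne_zero H.two_ne h0)
    apply hx
    have h3 := h1 (x + c x) (by rw [map_add, H.invol, add_comm])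
    have h4 : Ψ (γ * c x) = Ψ (γ * x) := by
      rw [← H.char_right, map_mul, H.invol, hγ]
    rw [mul_add, AddChar.map_add_eq_mul, h4, ← AddChar.map_add_eq_mul] at h3
    rw [← h3]
    congr 1
    ring
  · rintro rfl
    simp

lemma autSum_zero_right {n : ℕ} (hE : (fixedFinset c).card = n) (hF : Fintype.card F = n ^ 2)
    {β : F} (hβ : c β = β) (h0 : β ≠ 0) : autSum Ψ σ c β 0 = -n := by
  have hnorm (β : F) (hβ : c β = β) (h0 : β ≠ 0) : ‖autSum Ψ σ c β 0‖ = n := by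
    have h1 := H.norm_autSum_sq hβ 0
    have h2 : (univ.filter fun x => autPolar σ c β 0 x = 0) = {0} := by
      ext x
      simp [autPolar, H.two_ne, h0]
    rw [h2, hF] at h1
    simp only [card_singleton, Nat.cast_one, mul_one, Nat.cast_pow] at h1
    exact (pow_left_inj₀ (norm_nonneg _) (Nat.cast_nonneg _) two_ne_zero).mp h1
  have hsum : ∑ β ∈ fixedFinset c, autSum Ψ σ c β 0 = n := by
    simp only [autSum, zero_mul, add_zero]
    rw [sum_comm]
    have h1 (x : F) : ∑ β ∈ fixedFinset c, Ψ (β * (x * c x)) = if x = 0 then (n : ℂ) else 0 := by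
      have h2 := H.sum_fixed_mul (γ := x * c x) (by rw [map_mul, H.invol, mul_comm])
      simp_rw [mul_comm (x * c x)] at h2
      rw [h2, hE]
      exact if_congr (by simp) rfl rfl
    simp_rw [h1]
    simp
  have h00 : autSum Ψ σ c 0 0 = (n : ℂ) ^ 2 := by
    simp [autSum, hF]
  have hmem0 : (0 : F) ∈ fixedFinset c := mem_fixedFinset.mpr (map_zero c)
  have hre : ∑ β ∈ (fixedFinset c).erase 0, ((autSum Ψ σ c β 0).re + n) = 0 := by
    rw [← add_sum_erase _ _ hmem0, h00] at hsum
    have h3 := congrArg Complex.re hsum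
    rw [Complex.add_re, Complex.re_sum] at h3
    have h4 : ((n : ℂ) ^ 2).re = (n : ℝ) ^ 2 := by
      rw [← Nat.cast_pow, Complex.natCast_re, Nat.cast_pow]
    rw [h4, Complex.natCast_re] at h3
    have hpos : 0 < n := by rw [← hE]; exact card_pos.mpr ⟨0, hmem0⟩
    rw [sum_add_distrib, sum_const, card_erase_of_mem hmem0, hE, nsmul_eq_mul,
      Nat.cast_sub (by omega)]
    push_cast
    linarith
  have hterm := (sum_eq_zero_iff_of_nonneg fun β hβ => by
    have h5 := hnorm β (mem_fixedFinset.mp (mem_of_mem_erase hβ)) (ne_of_mem_erase hβ)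
    have h6 := Complex.abs_re_le_norm (autSum Ψ σ c β 0)
    rw [h5] at h6
    linarith [neg_le_of_abs_le h6]).mp hre β (mem_erase.mpr ⟨h0, mem_fixedFinset.mpr hβ⟩)
  have h7 : (autSum Ψ σ c β 0).re = -n := by linarith
  have h8 : (autSum Ψ σ c β 0).im = 0 := by
    have h9 := hnorm β hβ h0
    have h10 := Complex.sq_norm (autSum Ψ σ c β 0)
    rw [h9, Complex.normSq_apply, h7] at h10
    nlinarith
  apply Complex.ext <;> simp [h7, h8]

lemma autSum_degenerate {n : ℕ} (hE : (fixedFinset c).card = n) (hF : Fintype.card F = n ^ 2)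
    {b : F} (hb : c b = b) (h0 : b ≠ 0) :
    autSum Ψ σ c (-(b + σ.symm b) / 2) b
      = -n * ∑ k ∈ fixedFinset (c.trans σ), Ψ (k ^ 2 * (2 * b)⁻¹) := by
  have h2 := H.two_ne
  have hs2 : σ 2 = 2 := map_ofNat σ 2
  have hc2 : c 2 = 2 := map_ofNat c 2
  have hpull (x : F) : Ψ (-(b + σ.symm b) / 2 * (x * c x) + b * (x * σ x))
      = Ψ (-(b / 2) * ((σ (c x) - x) * c (σ (c x) - x))) := by
    have e1 : -(b + σ.symm b) / 2 * (x * c x) + b * (x * σ x)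
        = (-(b / 2) * (x * c x) + b / 2 * (x * σ x)) + -(σ.symm b / 2 * (x * c x))
          + b / 2 * (x * σ x) := by
      field_simp; ring
    have e2 : Ψ (-(σ.symm b / 2 * (x * c x))) = Ψ (-(b / 2 * (σ x * σ (c x)))) := by
      rw [← H.char_left]
      simp only [map_neg, map_mul, map_div₀, RingEquiv.apply_symm_apply, hs2]
    have e3 : Ψ (b / 2 * (x * σ x)) = Ψ (b / 2 * (c x * σ (c x))) := by
      rw [← H.char_right]
      simp only [map_mul, map_div₀, hc2, hb, H.comm]
    rw [e1, AddChar.map_add_eq_mul, AddChar.map_add_eq_mul, e2, e3, ← AddChar.map_add_eq_mul,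
      ← AddChar.map_add_eq_mul]
    congr 1
    simp only [map_sub, H.comm, H.invol]
    ring
  have hq : (Fintype.card F : ℂ) ≠ 0 := by
    exact_mod_cast Fintype.card_ne_zero
  have hdelta (y z : F) : (if y = z then (Fintype.card F : ℂ) else 0)
      = ∑ k, Ψ (k * (y - z)) := by
    rw [addChar_sum_mul H.prim]
    exact if_congr sub_eq_zero.symm rfl rfl
  have hadj (k : F) : ∑ x, Ψ (-(k * (σ (c x) - x)))
      = if σ (c k) = k then (Fintype.card F : ℂ) else 0 := by
    have h1 (x : F) : Ψ (-(k * (σ (c x) - x))) = Ψ (x * (k - c (σ.symm k))) := by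
      have e1 : -(k * (σ (c x) - x)) = -(k * σ (c x)) + x * k := by ring
      have e2 : Ψ (-(k * σ (c x))) = Ψ (-(x * c (σ.symm k))) := by
        rw [← H.char_symm, ← H.char_right]
        simp only [map_neg, map_mul, RingEquiv.symm_apply_apply, H.invol]
        rw [mul_comm]
      rw [e1, AddChar.map_add_eq_mul, e2, ← AddChar.map_add_eq_mul]
      congr 1
      ring
    simp_rw [h1]
    rw [addChar_sum_mul H.prim]
    refine if_congr ?_ rfl rfl
    rw [sub_eq_zero]
    constructor
    · intro h
      conv_lhs => rw [h, H.invol, RingEquiv.apply_symm_apply]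
    · intro h
      have h' := congrArg (fun z => c (σ.symm z)) h
      simp only [RingEquiv.symm_apply_apply, H.invol] at h'
      exact h'
  have hsq (k : F) (hk : σ (c k) = k) :
      ∑ y, Ψ (-(b / 2) * (y * c y) + k * y) = -n * Ψ (k ^ 2 * (2 * b)⁻¹) := by
    have hck : c k = k := H.fixed k hk
    have hN := H.autSum_zero_right hE hF (β := -(b / 2))
      (by rw [map_neg, map_div₀, hb, hc2]) (neg_ne_zero.mpr (div_ne_zero h0 h2))
    rw [← hN, autSum, sum_mul, ← Equiv.sum_comp (Equiv.addRight (k / b))]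
    refine sum_congr rfl fun z _ => ?_
    have hce : c (k / b) = k / b := by rw [map_div₀, hck, hb]
    have e1 : -(b / 2) * (Equiv.addRight (k / b) z * c (Equiv.addRight (k / b) z))
        + k * Equiv.addRight (k / b) z
        = (-(b / 2) * (z * c z) + 0 * (z * σ z)) + (k ^ 2 * (2 * b)⁻¹) + k * z / 2
          + -(k * c z / 2) := by
      simp only [Equiv.coe_addRight, map_add, hce]
      field_simp
      ring
    have e2 : Ψ (-(k * c z / 2)) = Ψ (-(k * z / 2)) := by
      rw [← H.char_right]
      simp only [map_neg, map_mul, map_div₀, hc2, H.invol, hck]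
    rw [e1, AddChar.map_add_eq_mul, AddChar.map_add_eq_mul, AddChar.map_add_eq_mul, e2,
      mul_assoc _ (Ψ (k * z / 2)), ← AddChar.map_add_eq_mul Ψ (k * z / 2), add_neg_cancel,
      AddChar.map_zero_eq_one, mul_one]
  apply mul_left_cancel₀ hq
  calc (Fintype.card F : ℂ) * autSum Ψ σ c (-(b + σ.symm b) / 2) b
      = ∑ x, ∑ y, (if y = σ (c x) - x then (Fintype.card F : ℂ) else 0)
          * Ψ (-(b / 2) * (y * c y)) := by
        rw [autSum, mul_sum]
        refine sum_congr rfl fun x _ => ?_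
        rw [hpull]
        simp
    _ = ∑ x, ∑ y, ∑ k, Ψ (-(k * (σ (c x) - x))) * Ψ (-(b / 2) * (y * c y) + k * y) := by
        refine sum_congr rfl fun x _ => sum_congr rfl fun y _ => ?_
        rw [hdelta, sum_mul]
        refine sum_congr rfl fun k _ => ?_
        rw [← AddChar.map_add_eq_mul, ← AddChar.map_add_eq_mul]
        congr 1
        ring
    _ = ∑ k, (∑ x, Ψ (-(k * (σ (c x) - x)))) * ∑ y, Ψ (-(b / 2) * (y * c y) + k * y) := by
        rw [sum_congr rfl fun x _ => sum_comm, sum_comm]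
        simp_rw [sum_mul_sum]
    _ = _ := by
        simp_rw [hadj, ite_mul, zero_mul]
        rw [← sum_filter, mul_sum, mul_sum]
        refine sum_congr rfl fun k hk => ?_
        rw [hsq k (mem_filter.mp hk).2]

omit [Fintype F] [DecidableEq F] in
lemma addChar_sq_eq_one_iff (β : F) :
    (∀ k, c.trans σ k = k → Ψ (k ^ 2 * β) = 1) ↔ ∀ k, c.trans σ k = k → Ψ (k * β) = 1 := by
  have h2 := H.two_ne
  constructor
  · intro h k hk
    have hk4 : c.trans σ (k / 4) = k / 4 := by
      rw [map_div₀, hk, map_ofNat]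
    have h1 := h (k / 4 + 1) (by rw [map_add, hk4, map_one])
    have h3 := h (k / 4 - 1) (by rw [map_sub, hk4, map_one])
    have h4 : (4 : F) ≠ 0 := by
      have : (4 : F) = 2 * 2 := by norm_num
      rw [this]; exact mul_ne_zero h2 h2
    have e : (k / 4 + 1) ^ 2 * β = k * β + (k / 4 - 1) ^ 2 * β := by
      field_simp; ring
    rw [e, AddChar.map_add_eq_mul, h3, mul_one] at h1
    exact h1
  · intro h k hk
    exact h _ (by rw [map_pow, hk])

lemma card_filter_addChar_eq_one {n M : ℕ} (hE : (fixedFinset c).card = n)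
    (hMK : M * (fixedFinset (c.trans σ)).card = n) :
    ((fixedFinset c).filter fun β => ∀ k, c.trans σ k = k → Ψ (k * β) = 1).card = M := by
  classical
  set K := fixedFinset (c.trans σ) with hK
  have hsub {k : F} (hk : k ∈ K) : c k = k :=
    H.fixed k (by simpa using mem_fixedFinset.mp hk)
  have h0 : (0 : F) ∈ K := mem_fixedFinset.mpr (map_zero _)
  have hpos : 0 < K.card := card_pos.mpr ⟨0, h0⟩
  have h1 : ∑ β ∈ fixedFinset c, ∑ k ∈ K, Ψ (k * β) = n := by
    rw [sum_comm]
    have h2 : ∀ k ∈ K, ∑ β ∈ fixedFinset c, Ψ (k * β) = if k = 0 then (n : ℂ) else 0 :=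
      fun k hk => by rw [H.sum_fixed_mul (hsub hk), hE]
    rw [sum_congr rfl h2, sum_ite_eq', if_pos h0]
  have h3 (β : F) : ∑ k ∈ K, Ψ (k * β)
      = if ∀ k, c.trans σ k = k → Ψ (k * β) = 1 then (K.card : ℂ) else 0 := by
    have h := sum_fixedFinset (Ψ.mulShift β) (c.trans σ)
    simp only [AddChar.mulShift_apply, mul_comm β] at h
    exact h
  simp_rw [h3] at h1
  rw [← sum_filter, sum_const, nsmul_eq_mul] at h1
  have h4 : ((fixedFinset c).filter fun β => ∀ k, c.trans σ k = k → Ψ (k * β) = 1).card * K.card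
      = n := by exact_mod_cast h1
  rw [← hMK] at h4
  exact Nat.eq_of_mul_eq_mul_right hpos h4

lemma card_filter_degenerate {n M : ℕ} (hE : (fixedFinset c).card = n)
    (hMK : M * (fixedFinset (c.trans σ)).card = n) :
    (((fixedFinset c).erase 0).filter fun b =>
      ∀ k, c.trans σ k = k → Ψ (k ^ 2 * (2 * b)⁻¹) = 1).card = M - 1 := by
  classical
  rw [← H.card_filter_addChar_eq_one hE hMK]
  have h2 := H.two_ne
  have hc2 : c 2 = 2 := map_ofNat c 2
  have h0 : (0 : F) ∈ (fixedFinset c).filter fun β => ∀ k, c.trans σ k = k → Ψ (k * β) = 1 := by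
    exact mem_filter.mpr ⟨mem_fixedFinset.mpr (map_zero c), fun k _ => by simp⟩
  rw [← card_erase_of_mem h0]
  refine card_bij' (fun b _ => (2 * b)⁻¹) (fun b _ => (2 * b)⁻¹) ?_ ?_ ?_ ?_
  · intro b hb
    simp only [mem_filter, mem_erase, mem_fixedFinset] at hb ⊢
    refine ⟨inv_ne_zero (mul_ne_zero h2 hb.1.1), ?_, (H.addChar_sq_eq_one_iff _).mp hb.2⟩
    rw [map_inv₀, map_mul, hc2, hb.1.2]
  · intro b hb
    simp only [mem_filter, mem_erase, mem_fixedFinset] at hb ⊢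
    have hb0 := hb.1
    have e : (2 * (2 * b)⁻¹)⁻¹ = b := by field_simp
    refine ⟨⟨inv_ne_zero (mul_ne_zero h2 hb.1), ?_⟩, (H.addChar_sq_eq_one_iff _).mpr ?_⟩
    · rw [map_inv₀, map_mul, hc2, hb.2.1]
    · rw [e]; exact hb.2.2
  · intro b hb
    field_simp
  · intro b hb
    field_simp

lemma norm_sum_sq_fixed {β : F} (h : ∃ k, c.trans σ k = k ∧ Ψ (k ^ 2 * β) ≠ 1) :
    ‖∑ k ∈ fixedFinset (c.trans σ), Ψ (k ^ 2 * β)‖ ^ 2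
      = ((fixedFinset (c.trans σ)).card : ℝ) := by
  classical
  have h2 := H.two_ne
  set τ := c.trans σ with hτ
  set K := fixedFinset τ with hK
  have ht2 : τ 2 = 2 := map_ofNat τ 2
  obtain ⟨k₀, hk₀, hne⟩ := h
  have hinner : ∀ v ∈ K, ∑ j ∈ K, Ψ ((j + v) ^ 2 * β) * (starRingEnd ℂ) (Ψ (j ^ 2 * β))
      = if v = 0 then (K.card : ℂ) else 0 := by
    intro v hv
    have hv' : τ v = v := mem_fixedFinset.mp hv
    have h1 (j : F) : Ψ ((j + v) ^ 2 * β) * (starRingEnd ℂ) (Ψ (j ^ 2 * β))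
        = Ψ (v ^ 2 * β) * Ψ.mulShift (2 * v * β) j := by
      rw [← AddChar.map_neg_eq_conj, AddChar.mulShift_apply, ← AddChar.map_add_eq_mul,
        ← AddChar.map_add_eq_mul]
      congr 1; ring
    simp_rw [h1]
    rw [← mul_sum, sum_fixedFinset]
    split_ifs with h3 h4 h4
    · subst h4; simp [hK]
    · refine absurd ?_ hne
      have h5 := h3 (k₀ ^ 2 / (2 * v)) (by rw [map_div₀, map_pow, map_mul, hk₀, hv', ht2])
      rw [AddChar.mulShift_apply] at h5
      rw [← h5]
      congr 1
      field_simp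
    · subst h4
      exact absurd (fun x _ => by simp) h3
    · simp
  have hmul : (∑ k ∈ K, Ψ (k ^ 2 * β)) * (starRingEnd ℂ) (∑ k ∈ K, Ψ (k ^ 2 * β)) = K.card := by
    calc _ = ∑ j ∈ K, ∑ k ∈ K, Ψ (k ^ 2 * β) * (starRingEnd ℂ) (Ψ (j ^ 2 * β)) := by
          rw [map_sum, sum_mul_sum, sum_comm]
      _ = ∑ j ∈ K, ∑ v ∈ K, Ψ ((j + v) ^ 2 * β) * (starRingEnd ℂ) (Ψ (j ^ 2 * β)) := by
          refine sum_congr rfl fun j hj => ?_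
          have hj' := mem_fixedFinset.mp hj
          refine sum_bij' (fun k _ => k - j) (fun v _ => j + v) ?_ ?_ ?_ ?_ ?_
          · intro k hk
            rw [mem_fixedFinset] at hk ⊢
            rw [map_sub, hk, hj']
          · intro k hk
            rw [mem_fixedFinset] at hk ⊢
            rw [map_add, hk, hj']
          · intro k _; ring
          · intro k _; ring
          · intro k _; rw [add_sub_cancel]
      _ = _ := by
          rw [sum_comm, sum_congr rfl hinner, sum_ite_eq',
            if_pos (mem_fixedFinset.mpr (map_zero τ))]
  rw [Complex.mul_conj'] at hmul
  exact_mod_cast hmul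

omit [Fintype F] [DecidableEq F] in
lemma scale_of_autPolar_eq_zero {w : F × F} (hw : c w.1 = w.1) {r : F}
    (hpol : autPolar σ c w.1 w.2 r = 0) :
    c (w.2 * (r * σ r)) = w.2 * (r * σ r) ∧
      w.1 * (r * c r) = -(w.2 * (r * σ r) + σ.symm (w.2 * (r * σ r))) / 2 := by
  refine H.autPolar_one_iff.mp ⟨?_, ?_⟩
  · simp only [map_mul, hw, H.invol]; ring
  · rw [autPolar_scale, mul_one, hpol, mul_zero]

lemma exists_degenerate {w : F × F} (hw : w ∈ nonzeroFixedPairs c) {r : F} (hr : r ≠ 0)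
    (hpol : autPolar σ c w.1 w.2 r = 0) :
    ∃ b, c b = b ∧ b ≠ 0 ∧
      autSum Ψ σ c w.1 w.2 = autSum Ψ σ c (-(b + σ.symm b) / 2) b := by
  obtain ⟨hc, hw0⟩ := mem_nonzeroFixedPairs.mp hw
  obtain ⟨h1, h3⟩ := H.scale_of_autPolar_eq_zero hc hpol
  have hσr : σ r ≠ 0 := (map_ne_zero σ).mpr hr
  have hcr : c r ≠ 0 := (map_ne_zero c).mpr hr
  refine ⟨w.2 * (r * σ r), h1, fun h0 => hw0 ?_, ?_⟩
  · rw [h0] at h3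
    have e2 : w.2 = 0 := by simpa [hr, hσr] using h0
    have e1 : w.1 = 0 := by simpa [hr, hcr] using h3
    exact Prod.ext e1 e2
  · rw [← h3, autSum_scale _ _ hr]

open Classical in
lemma sum_card_radical (P : ℂ → Prop) :
    ∑ w ∈ (nonzeroFixedPairs c).filter fun w => P (autSum Ψ σ c w.1 w.2),
        ((univ.filter fun x => autPolar σ c w.1 w.2 x = 0).card - 1)
      = (Fintype.card F - 1) * (((fixedFinset c).erase 0).filter fun b =>
          P (autSum Ψ σ c (-(b + σ.symm b) / 2) b)).card := by
  have h2 := H.two_ne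
  have h1 (w : F × F) : (univ.filter fun x => autPolar σ c w.1 w.2 x = 0).card - 1
      = ∑ r ∈ univ.erase (0 : F), if autPolar σ c w.1 w.2 r = 0 then 1 else 0 := by
    rw [← card_filter, ← card_erase_of_mem (a := (0 : F)) (by simp [autPolar])]
    congr 1
    ext x; simp [and_comm]
  simp_rw [h1]
  rw [sum_comm]
  have h3 : ∀ r ∈ univ.erase (0 : F),
      ∑ w ∈ (nonzeroFixedPairs c).filter (fun w => P (autSum Ψ σ c w.1 w.2)),
        (if autPolar σ c w.1 w.2 r = 0 then 1 else 0)
      = (((fixedFinset c).erase 0).filter fun b =>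
          P (autSum Ψ σ c (-(b + σ.symm b) / 2) b)).card := by
    intro r hr
    have hr : r ≠ 0 := ne_of_mem_erase hr
    have hσr : σ r ≠ 0 := (map_ne_zero σ).mpr hr
    have hcr : c r ≠ 0 := (map_ne_zero c).mpr hr
    rw [← card_filter]
    refine card_bij' (fun w _ => w.2 * (r * σ r))
      (fun b _ => (-(b + σ.symm b) / 2 / (r * c r), b / (r * σ r))) ?_ ?_ ?_ ?_
    · intro w hw
      simp only [mem_filter, mem_nonzeroFixedPairs, mem_erase, mem_fixedFinset] at hw ⊢
      obtain ⟨⟨⟨hc, hw0⟩, hP⟩, hpol⟩ := hw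
      obtain ⟨h4, h5⟩ := H.scale_of_autPolar_eq_zero hc hpol
      refine ⟨⟨fun h0 => hw0 ?_, h4⟩, ?_⟩
      · rw [h0] at h5
        have e2 : w.2 = 0 := by simpa [hr, hσr] using h0
        have e1 : w.1 = 0 := by simpa [hr, hcr] using h5
        exact Prod.ext e1 e2
      · rw [← h5, autSum_scale _ _ hr]
        exact hP
    · intro b hb
      simp only [mem_filter, mem_nonzeroFixedPairs, mem_erase, mem_fixedFinset] at hb ⊢
      obtain ⟨⟨hb0, hcb⟩, hP⟩ := hb
      obtain ⟨h4, h5⟩ := H.autPolar_one_iff.mpr ⟨hcb, rfl⟩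
      have e1 : -(b + σ.symm b) / 2 = -(b + σ.symm b) / 2 / (r * c r) * (r * c r) := by
        field_simp
      have e2 : b = b / (r * σ r) * (r * σ r) := by field_simp
      refine ⟨⟨⟨?_, fun h => ?_⟩, ?_⟩, ?_⟩
      · rw [map_div₀, h4, map_mul, H.invol, mul_comm (c r)]
      · have := congrArg Prod.snd h
        simp [hb0, hr, hσr] at this
      · rw [← autSum_scale _ _ hr, ← e1, ← e2]
        exact hP
      · have h6 := autPolar_scale (σ := σ) (c := c) (-(b + σ.symm b) / 2 / (r * c r))
          (b / (r * σ r)) r 1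
        rw [← e1, ← e2, h5, mul_one] at h6
        exact (mul_eq_zero.mp h6.symm).resolve_left hr
    · intro w hw
      simp only [mem_filter, mem_nonzeroFixedPairs] at hw
      obtain ⟨h4, h5⟩ := H.scale_of_autPolar_eq_zero hw.1.1.1 hw.2
      refine Prod.ext ?_ ?_
      · change -(w.2 * (r * σ r) + σ.symm (w.2 * (r * σ r))) / 2 / (r * c r) = w.1
        rw [← h5]
        field_simp
      · change w.2 * (r * σ r) / (r * σ r) = w.2
        field_simp
    · intro b hb
      change b / (r * σ r) * (r * σ r) = b
      field_simp
  rw [sum_congr rfl h3, sum_const, card_erase_of_mem (mem_univ _), card_univ, smul_eq_mul]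

lemma sum_autSum {n : ℕ} (hE : (fixedFinset c).card = n) (hF : Fintype.card F = n ^ 2) :
    ∑ w ∈ nonzeroFixedPairs c, autSum Ψ σ c w.1 w.2 = (n : ℂ) ^ 3 - n ^ 2 := by
  have h00 : autSum Ψ σ c 0 0 = (n : ℂ) ^ 2 := by
    simp [autSum, hF]
  have h1 : nonzeroFixedPairs c = (fixedFinset c ×ˢ univ).erase 0 := by
    ext w
    simp [mem_nonzeroFixedPairs, mem_fixedFinset, and_comm]
  have hmem : (0 : F × F) ∈ fixedFinset c ×ˢ (univ : Finset F) := by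
    simp [mem_fixedFinset]
  have h2 : ∑ w ∈ fixedFinset c ×ˢ (univ : Finset F), autSum Ψ σ c w.1 w.2 = (n : ℂ) ^ 3 := by
    rw [sum_product]
    have h3 (a : F) : ∑ b, autSum Ψ σ c a b = (n : ℂ) ^ 2 := by
      simp only [autSum]
      rw [sum_comm]
      simp_rw [AddChar.map_add_eq_mul]
      simp_rw [← mul_sum, addChar_sum_mul H.prim, hF]
      rw [sum_eq_single 0]
      · simp
      · intro x _ hx; simp [hx]
      · simp
    simp_rw [h3]
    rw [sum_const, hE, nsmul_eq_mul]
    ring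
  rw [h1, ← h2, ← add_sum_erase _ _ hmem]
  simp [h00]

lemma autSum_degenerate_cases {n κ : ℕ} (hE : (fixedFinset c).card = n)
    (hF : Fintype.card F = n ^ 2) (hK : (fixedFinset (c.trans σ)).card = κ)
    {b : F} (hb : c b = b) (h0 : b ≠ 0) :
    (∀ k, c.trans σ k = k → Ψ (k ^ 2 * (2 * b)⁻¹) = 1) ∧
        autSum Ψ σ c (-(b + σ.symm b) / 2) b = -(n * κ) ∨
      (¬ ∀ k, c.trans σ k = k → Ψ (k ^ 2 * (2 * b)⁻¹) = 1) ∧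
        ‖autSum Ψ σ c (-(b + σ.symm b) / 2) b‖ ^ 2 = (n : ℝ) ^ 2 * κ := by
  rw [H.autSum_degenerate hE hF hb h0]
  by_cases h : ∀ k, c.trans σ k = k → Ψ (k ^ 2 * (2 * b)⁻¹) = 1
  · refine Or.inl ⟨h, ?_⟩
    rw [sum_congr rfl fun k hk => h k (mem_fixedFinset.mp hk), sum_const, hK]
    simp
  · refine Or.inr ⟨h, ?_⟩
    push Not at h
    rw [norm_mul, mul_pow, H.norm_sum_sq_fixed h, hK]
    simp

open Classical in
/-- The number of pairs `(a, b)` with `c a = a` whose exponential sum is `+n`. -/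
theorem card_autSum_eq {n M κ : ℕ} (hE : (fixedFinset c).card = n)
    (hF : Fintype.card F = n ^ 2) (hK : (fixedFinset (c.trans σ)).card = κ)
    (hMK : M * κ = n) (hκ : 1 < κ) {u : F} (hu0 : u ≠ 0) (hcu : c u = u)
    (hA : ∀ a b, c a = a → ‖autSum Ψ σ c a b‖ ^ 2 = (n : ℝ) ^ 2 →
      autSum Ψ σ c a b = n ∨ autSum Ψ σ c a b = -n)
    (hB : ∀ a b, c a = a → ‖autSum Ψ σ c a b‖ ^ 2 = (n : ℝ) ^ 2 * κ →
      autSum Ψ σ c (u * a) (u * b) = -autSum Ψ σ c a b) :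
    (2 * (κ + 1) * (univ.filter fun w : F × F => c w.1 = w.1 ∧
        autSum Ψ σ c w.1 w.2 = n).card : ℚ) = κ * (n + 1) * (n ^ 2 - 1) := by
  set W := nonzeroFixedPairs c with hW
  have hn : 1 < n := by
    have h1 : 1 < Fintype.card F := Fintype.one_lt_card
    rw [hF] at h1
    by_contra h2
    interval_cases n <;> simp at h1
  have hM : 1 ≤ M := by
    rcases Nat.eq_zero_or_pos M with h | h
    · subst h; omega
    · exact h
  have hMn : M ≤ n := by rw [← hMK]; exact Nat.le_mul_of_pos_right _ (by omega)
  have hnR : (1 : ℝ) < n := by exact_mod_cast hn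
  have hκR : (1 : ℝ) < κ := by exact_mod_cast hκ
  have hdeg (b : F) (hb : c b = b) (h0 : b ≠ 0) :=
    H.autSum_degenerate_cases hE hF hK hb h0
  have hnormdeg {z : ℂ} (hz : z = -(n * κ)) : ‖z‖ ^ 2 = (n : ℝ) ^ 2 * κ ^ 2 := by
    rw [hz, norm_neg, norm_mul, mul_pow]; simp
  have hrad (w : F × F) (hw : w ∈ W) {t : ℕ} (h : ‖autSum Ψ σ c w.1 w.2‖ ^ 2 = (n : ℝ) ^ 2 * t) :
      (univ.filter fun x => autPolar σ c w.1 w.2 x = 0).card = t := by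
    rw [H.norm_autSum_sq (mem_nonzeroFixedPairs.mp hw).1, hF] at h
    push_cast at h
    exact_mod_cast mul_left_cancel₀ (by positivity) h
  set W0 := W.filter fun w => ‖autSum Ψ σ c w.1 w.2‖ ^ 2 = (n : ℝ) ^ 2 with hW0
  set W1 := W.filter fun w => ‖autSum Ψ σ c w.1 w.2‖ ^ 2 = (n : ℝ) ^ 2 * κ with hW1
  set W2 := W.filter fun w => autSum Ψ σ c w.1 w.2 = -(n * κ) with hW2
  have htri : ∀ w ∈ W, ‖autSum Ψ σ c w.1 w.2‖ ^ 2 = (n : ℝ) ^ 2 ∨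
      ‖autSum Ψ σ c w.1 w.2‖ ^ 2 = (n : ℝ) ^ 2 * κ ∨ autSum Ψ σ c w.1 w.2 = -(n * κ) := by
    intro w hw
    by_cases h : ∃ r, r ≠ 0 ∧ autPolar σ c w.1 w.2 r = 0
    · obtain ⟨r, hr, hpol⟩ := h
      obtain ⟨b, hb, hb0, e⟩ := H.exists_degenerate hw hr hpol
      rw [e]
      rcases hdeg b hb hb0 with h | h
      · exact Or.inr (Or.inr h.2)
      · exact Or.inr (Or.inl h.2)
    · left
      push Not at h
      rw [H.norm_autSum_sq (mem_nonzeroFixedPairs.mp hw).1, hF]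
      have : (univ.filter fun x => autPolar σ c w.1 w.2 x = 0) = {0} := by
        ext x
        simp only [mem_filter, mem_univ, true_and, mem_singleton]
        refine ⟨fun hx => by_contra fun hx0 => h x hx0 hx, ?_⟩
        rintro rfl
        simp [autPolar]
      rw [this]; simp
  have hn2 : (0 : ℝ) < (n : ℝ) ^ 2 := by positivity
  have hne01 : (n : ℝ) ^ 2 ≠ (n : ℝ) ^ 2 * κ := by nlinarith
  have hne02 : (n : ℝ) ^ 2 ≠ (n : ℝ) ^ 2 * κ ^ 2 := by nlinarith [mul_pos hn2 (by nlinarith : (0:ℝ) < κ ^ 2 - 1)]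
  have hne12 : (n : ℝ) ^ 2 * κ ≠ (n : ℝ) ^ 2 * κ ^ 2 := by
    nlinarith [mul_pos hn2 (by nlinarith : (0:ℝ) < κ ^ 2 - κ)]
  have hd01 : Disjoint W0 W1 := by
    rw [disjoint_filter]; intro w _ h1 h2; exact hne01 (h1.symm.trans h2)
  have hd02 : Disjoint (W0 ∪ W1) W2 := by
    rw [disjoint_union_left, disjoint_filter, disjoint_filter]
    exact ⟨fun w _ h1 h2 => hne02 (h1.symm.trans (hnormdeg h2)),
      fun w _ h1 h2 => hne12 (h1.symm.trans (hnormdeg h2))⟩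
  have hunion : W = (W0 ∪ W1) ∪ W2 := by
    ext w
    simp only [hW0, hW1, hW2, mem_union, mem_filter]
    have := htri w
    tauto
  have hcard2 : W2.card * (κ ^ 2 - 1) = (n ^ 2 - 1) * (M - 1) := by
    have h := H.sum_card_radical (fun z => z = -(n * κ))
    rw [sum_congr rfl (g := fun _ => κ ^ 2 - 1), sum_const, smul_eq_mul, hF] at h
    · rw [h]
      congr 1
      rw [← H.card_filter_degenerate (M := M) hE (hK ▸ hMK)]
      congr 1
      refine filter_congr fun b hb => ?_
      rw [mem_erase, mem_fixedFinset] at hb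
      rcases hdeg b hb.2 hb.1 with h | h
      · simp only [h.2, true_iff]; exact h.1
      · exact ⟨fun h3 => absurd (h.2.symm.trans (hnormdeg h3)) hne12, fun h3 => absurd h3 h.1⟩
    · intro w hw
      rw [mem_filter] at hw
      rw [hrad w hw.1 (t := κ ^ 2) (by rw [hnormdeg hw.2]; push_cast; rfl)]
  have hcard1 : W1.card * (κ - 1) = (n ^ 2 - 1) * (n - M) := by
    have h := H.sum_card_radical (fun z => ‖z‖ ^ 2 = (n : ℝ) ^ 2 * κ)
    rw [sum_congr rfl (g := fun _ => κ - 1), sum_const, smul_eq_mul, hF] at h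
    · rw [h]
      congr 1
      have h4 := card_filter_add_card_filter_not (s := (fixedFinset c).erase 0)
        (fun b => ∀ k, c.trans σ k = k → Ψ (k ^ 2 * (2 * b)⁻¹) = 1)
      have h6 := H.card_filter_degenerate hE (hK ▸ hMK)
      have h5 : ((fixedFinset c).erase 0).card = n - 1 := by
        rw [card_erase_of_mem (mem_fixedFinset.mpr (map_zero c)), hE]
      rw [h5] at h4
      rw [filter_congr (q := fun b => ¬ ∀ k, c.trans σ k = k → Ψ (k ^ 2 * (2 * b)⁻¹) = 1)]
      · have h7 : ((fixedFinset c).erase 0 |>.filter fun b =>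
            ∀ k, c.trans σ k = k → Ψ (k ^ 2 * (2 * b)⁻¹) = 1).card = M - 1 := by
          rw [← h6]
        omega
      intro b hb
      rw [mem_erase, mem_fixedFinset] at hb
      rcases hdeg b hb.2 hb.1 with h | h
      · exact ⟨fun h3 => absurd (h3.symm.trans (hnormdeg h.2)) hne12, fun h3 => absurd h.1 h3⟩
      · exact ⟨fun _ => h.1, fun _ => h.2⟩
    · intro w hw
      rw [mem_filter] at hw
      rw [hrad w hw.1 hw.2]
  set Wp := univ.filter fun w : F × F => c w.1 = w.1 ∧ autSum Ψ σ c w.1 w.2 = n with hWp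
  have h00 : autSum Ψ σ c 0 0 = (n : ℂ) ^ 2 := by
    simp [autSum, hF]
  have hWpW : Wp = W0.filter fun w => autSum Ψ σ c w.1 w.2 = n := by
    ext w
    simp only [hWp, hW0, hW, mem_filter, mem_univ, true_and, mem_nonzeroFixedPairs]
    refine ⟨fun h => ⟨⟨⟨h.1, ?_⟩, by rw [h.2]; simp⟩, h.2⟩, fun h => ⟨h.1.1.1, h.2⟩⟩
    rintro rfl
    have h1 := h.2
    simp only [Prod.fst_zero, Prod.snd_zero, h00] at h1
    have h2 : n ^ 2 = n := by exact_mod_cast h1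
    nlinarith
  have hsum0 : ∑ w ∈ W0, autSum Ψ σ c w.1 w.2 = n * (2 * Wp.card - W0.card) := by
    have h1 : ∀ w ∈ W0, autSum Ψ σ c w.1 w.2
        = 2 * (if autSum Ψ σ c w.1 w.2 = n then (n : ℂ) else 0) - n := by
      intro w hw
      rw [hW0, mem_filter] at hw
      split_ifs with h
      · rw [h]; ring
      · rw [(hA _ _ (mem_nonzeroFixedPairs.mp hw.1).1 hw.2).resolve_left h]; ring
    rw [sum_congr rfl h1, sum_sub_distrib, ← mul_sum, ← sum_filter, ← hWpW, sum_const, sum_const]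
    simp only [nsmul_eq_mul]
    ring
  have hsum1 : ∑ w ∈ W1, autSum Ψ σ c w.1 w.2 = 0 := by
    have hmul (v : F × F) (hv : v ∈ W1) : (u * v.1, u * v.2) ∈ W1 := by
      simp only [hW1, hW, mem_filter, mem_nonzeroFixedPairs] at hv ⊢
      refine ⟨⟨by rw [map_mul, hcu, hv.1.1], fun h => hv.1.2 ?_⟩, ?_⟩
      · have e1 := congrArg Prod.fst h
        have e2 := congrArg Prod.snd h
        simp only [Prod.fst_zero, Prod.snd_zero, mul_eq_zero, hu0, false_or] at e1 e2
        exact Prod.ext e1 e2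
      · rw [hB _ _ hv.1.1 hv.2, norm_neg, hv.2]
    have hinj : Set.InjOn (fun v : F × F => (u * v.1, u * v.2)) W1 := by
      intro v _ v' _ h
      simp only [Prod.mk.injEq, mul_right_inj' hu0] at h
      exact Prod.ext h.1 h.2
    have himg : W1.image (fun v : F × F => (u * v.1, u * v.2)) = W1 :=
      eq_of_subset_of_card_le (image_subset_iff.mpr hmul) (card_image_of_injOn hinj).ge
    have h1 : ∑ w ∈ W1, autSum Ψ σ c w.1 w.2 = -∑ w ∈ W1, autSum Ψ σ c w.1 w.2 := by
      conv_lhs => rw [← himg]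
      rw [sum_image hinj, ← sum_neg_distrib]
      refine sum_congr rfl fun v hv => ?_
      rw [hW1, mem_filter] at hv
      exact hB _ _ (mem_nonzeroFixedPairs.mp hv.1).1 hv.2
    exact self_eq_neg.mp h1
  have hsum2 : ∑ w ∈ W2, autSum Ψ σ c w.1 w.2 = -(n * κ * W2.card) := by
    rw [sum_congr rfl fun w hw => (mem_filter.mp hw).2, sum_const, nsmul_eq_mul]
    ring
  have htotal := H.sum_autSum hE hF
  rw [← hW, hunion, sum_union hd02, sum_union hd01, hsum0, hsum1, hsum2] at htotal
  have hcardW : W0.card + W1.card + W2.card = n ^ 3 - 1 := by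
    rw [← card_union_of_disjoint hd01, ← card_union_of_disjoint hd02, ← hunion]
    have h1 : W = (fixedFinset c ×ˢ univ).erase 0 := by
      ext w
      simp [hW, mem_nonzeroFixedPairs, mem_fixedFinset, and_comm]
    rw [h1, card_erase_of_mem (by simp [mem_fixedFinset]), card_product, hE, card_univ, hF]
    congr 1
    ring
  have t1 : (n : ℚ) * (2 * Wp.card - W0.card) - n * κ * W2.card = n ^ 3 - n ^ 2 := by
    have : ((n * (2 * Wp.card - W0.card) - n * κ * W2.card : ℚ) : ℂ)
        = ((n ^ 3 - n ^ 2 : ℚ) : ℂ) := by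
      push_cast
      linear_combination htotal
    exact_mod_cast this
  have t2 : (W0.card : ℚ) + W1.card + W2.card = n ^ 3 - 1 := by
    have := congrArg (Nat.cast (R := ℚ)) hcardW
    rw [Nat.cast_sub (Nat.one_le_pow _ _ (by omega))] at this
    push_cast at this
    exact this
  have t3 : (W2.card : ℚ) * (κ ^ 2 - 1) = (n ^ 2 - 1) * (M - 1) := by
    have := congrArg (Nat.cast (R := ℚ)) hcard2
    push_cast [Nat.cast_sub hM, Nat.cast_sub (Nat.one_le_pow 2 n (by omega)),
      Nat.cast_sub (Nat.one_le_pow 2 κ (by omega))] at this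
    exact this
  have t4 : (W1.card : ℚ) * (κ - 1) = (n ^ 2 - 1) * (n - M) := by
    have := congrArg (Nat.cast (R := ℚ)) hcard1
    push_cast [Nat.cast_sub hMn, Nat.cast_sub (Nat.one_le_pow 2 n (by omega)),
      Nat.cast_sub hκ.le] at this
    exact this
  have t5 : (M : ℚ) * κ = n := by exact_mod_cast hMK
  have hκ0 : (κ : ℚ) - 1 ≠ 0 := by
    have : (1 : ℚ) < κ := by exact_mod_cast hκ
    linarith
  have hn0 : (n : ℚ) ≠ 0 := by
    have : (1 : ℚ) < n := by exact_mod_cast hn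
    linarith
  have t6 : (2 * Wp.card - W0.card : ℚ) - κ * W2.card = n ^ 2 - n := by
    apply mul_left_cancel₀ hn0
    linear_combination t1
  have t7 : (W1.card : ℚ) = (n ^ 2 - 1) * M := by
    apply mul_right_cancel₀ hκ0
    linear_combination t4 - (n ^ 2 - 1 : ℚ) * t5
  linear_combination (κ + 1 : ℚ) * (t6 + t2 - t7) + t3 - (n ^ 2 - 1 : ℚ) * t5

end CommutingAutomorphisms

end CommutingAutomorphisms

section FrobeniusForms

open Finset

variable {p : ℕ} [Fact p.Prime] {F : Type*} [Field F] [Fintype F] [CharP F p]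

omit [CharP F p] in
lemma card_filter_pow_eq_self [DecidableEq F] {d m : ℕ} (hd : 1 ≤ d) (hdm : d ∣ m)
    (hF : Fintype.card F = p ^ m) : (univ.filter fun x : F => x ^ p ^ d = x).card = p ^ d := by
  have hp := (Fact.out : p.Prime).two_le
  have hpd : 2 ≤ p ^ d := hp.trans (Nat.le_self_pow (by omega) p)
  have h1 := IsCyclic.card_powMonoidHom_ker (G := Fˣ) (p ^ d - 1)
  have h2 : Nat.gcd (Nat.card Fˣ) (p ^ d - 1) = p ^ d - 1 := by
    rw [Nat.card_units, Nat.card_eq_fintype_card, hF]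
    exact Nat.gcd_eq_right (Nat.pow_sub_one_dvd_pow_sub_one p hdm)
  rw [h2, Nat.card_eq_fintype_card, ← card_univ] at h1
  have h3 : ((univ.filter fun x : F => x ^ p ^ d = x).erase 0).card = p ^ d - 1 := by
    rw [← h1]
    symm
    have hsucc (x : F) : x ^ p ^ d = x * x ^ (p ^ d - 1) := by
      rw [← pow_succ', Nat.sub_add_cancel (by omega)]
    refine card_bij (fun u _ => ((u : Fˣ) : F)) ?_ ?_ ?_
    · rintro ⟨u, hu⟩ -
      rw [MonoidHom.mem_ker, powMonoidHom_apply] at hu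
      simp only [mem_erase, mem_filter, mem_univ, true_and]
      refine ⟨u.ne_zero, ?_⟩
      rw [hsucc, ← Units.val_pow_eq_pow_val, hu, Units.val_one, mul_one]
    · rintro u - v - h
      exact Subtype.ext (Units.ext h)
    · intro x hx
      simp only [mem_erase, mem_filter, mem_univ, true_and] at hx
      refine ⟨⟨Units.mk0 x hx.1, ?_⟩, mem_univ _, rfl⟩
      rw [MonoidHom.mem_ker, powMonoidHom_apply]
      apply Units.ext
      have h4 := hx.2
      rw [hsucc] at h4
      simpa [hx.1] using h4
  rw [card_erase_of_mem (by simp; omega)] at h3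
  have h4 : 0 < (univ.filter fun x : F => x ^ p ^ d = x).card :=
    card_pos.mpr ⟨0, by simp; omega⟩
  omega

/-- The complex additive character `x ↦ e(Tr x / p)` of a finite field of characteristic `p`. -/
noncomputable def traceAddChar (p : ℕ) [Fact p.Prime] (F : Type*) [Field F]
    [Algebra (ZMod p) F] : AddChar F ℂ :=
  (ZMod.stdAddChar (N := p)).compAddMonoidHom (Algebra.trace (ZMod p) F).toAddMonoidHom

omit [Fintype F] [CharP F p] in
lemma traceAddChar_apply [Algebra (ZMod p) F] (x : F) :
    traceAddChar p F x = ZMod.stdAddChar (Algebra.trace (ZMod p) F x) := rfl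

omit [CharP F p] in
lemma traceAddChar_isPrimitive [Algebra (ZMod p) F] : (traceAddChar p F).IsPrimitive := by
  apply AddChar.IsPrimitive.of_ne_one
  obtain ⟨a, ha⟩ : ∃ a, Algebra.trace (ZMod p) F a ≠ 0 := by
    by_contra! h
    exact one_ne_zero ((traceForm_nondegenerate (ZMod p) F).1 1 fun y => by
      rw [Algebra.traceForm_apply, h])
  refine AddChar.ne_one_iff.mpr ⟨a, fun h => ha ?_⟩
  rw [traceAddChar_apply, ← AddChar.map_zero_eq_one (ZMod.stdAddChar (N := p))] at h
  exact ZMod.injective_stdAddChar h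

lemma trace_iterateFrobeniusEquiv [Algebra (ZMod p) F] (k : ℕ) (x : F) :
    Algebra.trace (ZMod p) F (iterateFrobeniusEquiv F p k x) = Algebra.trace (ZMod p) F x := by
  let e : F ≃ₐ[ZMod p] F := AlgEquiv.ofRingEquiv (f := iterateFrobeniusEquiv F p k) fun x => by
    rw [iterateFrobeniusEquiv_def, ← map_pow, ZMod.pow_card_pow]
  exact Algebra.trace_eq_of_algEquiv e x

omit [Fintype F] in
lemma pow_eq_self_of_gcd {i j : ℕ} {x : F} (hi : x ^ p ^ i = x) (hj : x ^ p ^ j = x) :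
    x ^ p ^ Nat.gcd i j = x := by
  have h (k : ℕ) : (frobenius F p)^[k] x = x ^ p ^ k := iterate_frobenius p k x
  rw [← h] at hi hj ⊢
  exact Function.IsPeriodicPt.gcd hi hj

omit [Fintype F] in
lemma pow_eq_self_of_dvd_s4 {i j : ℕ} {x : F} (hi : x ^ p ^ i = x) (hij : i ∣ j) :
    x ^ p ^ j = x := by
  have h (k : ℕ) : (frobenius F p)^[k] x = x ^ p ^ k := iterate_frobenius p k x
  rw [← h] at hi ⊢
  exact Function.IsPeriodicPt.trans_dvd hi hij

omit [Fact p.Prime] [Fintype F] in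
lemma two_ne_zero_of_charP (hp : p ≠ 2) : (2 : F) ≠ 0 := by
  apply Ring.two_ne_zero
  rwa [ringChar.eq F p]

lemma commutingAutomorphisms_frobenius [Algebra (ZMod p) F] [DecidableEq F] (hp : p ≠ 2)
    {s l d : ℕ} (hF : Fintype.card F = p ^ (2 * s)) (hds : d ∣ s)
    (hg : Nat.gcd (s + l) (2 * s) = d) :
    CommutingAutomorphisms (traceAddChar p F) (iterateFrobeniusEquiv F p l)
      (iterateFrobeniusEquiv F p s) where
  prim := traceAddChar_isPrimitive
  char_left x := by rw [traceAddChar_apply, trace_iterateFrobeniusEquiv, traceAddChar_apply]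
  char_right x := by rw [traceAddChar_apply, trace_iterateFrobeniusEquiv, traceAddChar_apply]
  invol x := by
    simp only [iterateFrobeniusEquiv_def]
    rw [← pow_mul, ← pow_add, ← two_mul, ← hF, FiniteField.pow_card]
  comm x := by
    simp only [iterateFrobeniusEquiv_def]
    rw [← pow_mul, ← pow_mul, mul_comm]
  two_ne := two_ne_zero_of_charP hp
  fixed x h := by
    simp only [iterateFrobeniusEquiv_def] at h ⊢
    rw [← pow_mul, ← pow_add] at h
    have h2 : x ^ p ^ (2 * s) = x := by rw [← hF, FiniteField.pow_card]
    have h3 := pow_eq_self_of_gcd h h2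
    rw [hg] at h3
    exact pow_eq_self_of_dvd_s4 h3 hds

/-- The quadratic form `x ↦ Tr (a x^(p^s+1) + b x^(p^l+1))`. -/
noncomputable def traceQuadraticForm (p s l : ℕ) [Fact p.Prime] {F : Type*} [Field F] [Fintype F]
    [CharP F p] [Algebra (ZMod p) F] (a b : F) : QuadraticForm (ZMod p) F :=
  LinearMap.BilinMap.toQuadraticMap (LinearMap.mk₂ (ZMod p)
    (fun x y : F => Algebra.trace (ZMod p) F (a * (x * y ^ p ^ s) + b * (x * y ^ p ^ l)))
    (fun x x' y => by rw [← map_add]; congr 1; ring)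
    (fun r x y => by
      rw [← map_smul]; congr 1
      simp only [smul_mul_assoc, mul_smul_comm, smul_add])
    (fun x y y' => by
      rw [← map_add, add_pow_char_pow, add_pow_char_pow]; congr 1; ring)
    (fun r x y => by
      rw [← map_smul]; congr 1
      simp only [smul_pow, ZMod.pow_card_pow, mul_smul_comm, smul_add]))

lemma traceQuadraticForm_apply [Algebra (ZMod p) F] (s l : ℕ) (a b x : F) :
    traceQuadraticForm p s l a b x
      = Algebra.trace (ZMod p) F (a * (x * x ^ p ^ s) + b * (x * x ^ p ^ l)) := rfl

end FrobeniusForms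

section CodewordCount

open Finset

variable {p : ℕ} [Fact p.Prime] {F : Type} [Field F] [Fintype F] [CharP F p]
  [Algebra (ZMod p) F]

omit [CharP F p] in
lemma finrank_eq_of_card {m : ℕ} (hF : Fintype.card F = p ^ m) :
    Module.finrank (ZMod p) F = m := by
  have h := Module.card_eq_pow_finrank (K := ZMod p) (V := F)
  rw [hF, ZMod.card] at h
  exact (Nat.pow_right_injective (Fact.out : p.Prime).two_le h).symm

omit [CharP F p] in
lemma trp_eq_trace {m : ℕ} (hF : Fintype.card F = p ^ m) (z : F) :
    trp p m z = algebraMap (ZMod p) F (Algebra.trace (ZMod p) F z) := by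
  rw [FiniteField.algebraMap_trace_eq_sum_pow, finrank_eq_of_card hF, Nat.card_zmod, trp]

omit [Fintype F] [Algebra (ZMod p) F] in
lemma trp_half (hp : p ≠ 2) {s : ℕ} {z : F} (hz : z ^ p ^ s = z) :
    trp p s z = trp p (2 * s) (z / 2) := by
  have h2 : (2 : F) ≠ 0 := two_ne_zero_of_charP hp
  have h2k (k : ℕ) : (2 : F) ^ p ^ k = 2 := by
    rw [← iterateFrobenius_def, map_ofNat]
  rw [trp, trp, two_mul, sum_range_add, ← sum_add_distrib]
  refine sum_congr rfl fun i _ => ?_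
  have h3 : (z / 2) ^ p ^ (s + i) = (z / 2) ^ p ^ i := by
    rw [pow_add, pow_mul, div_pow z 2 (p ^ s), hz, h2k]
  have : NeZero (2 : F) := ⟨h2⟩
  rw [h3, div_pow, h2k, add_halves]

lemma cword_eq_algebraMap (hp : p ≠ 2) {s l : ℕ} (hF : Fintype.card F = p ^ (2 * s)) {a : F}
    (ha : a ^ p ^ s = a) (b c : F) (h : ZMod p) (x : F) :
    cword p s l a b c h x = algebraMap (ZMod p) F
      (traceQuadraticForm p s l (a / 2) b x + Algebra.traceForm (ZMod p) F c x + h) := by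
  have hcast : (ZMod.cast h : F) = algebraMap (ZMod p) F h :=
    RingHom.congr_fun (Subsingleton.elim (ZMod.castHom dvd_rfl F) (algebraMap (ZMod p) F)) h
  have hz : (a * x ^ (p ^ s + 1)) ^ p ^ s = a * x ^ (p ^ s + 1) := by
    have hx : x ^ (p ^ s * p ^ s) = x := by
      rw [← pow_add, ← two_mul, ← hF, FiniteField.pow_card]
    rw [mul_pow, ha, ← pow_mul, add_mul, pow_add, hx, one_mul, pow_succ, mul_comm x]
  have hquad : a * x ^ (p ^ s + 1) / 2 = a / 2 * (x * x ^ p ^ s) := by ring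
  have hblin : b * x ^ (p ^ l + 1) = b * (x * x ^ p ^ l) := by ring
  rw [cword, hcast, trp_half hp hz, trp_eq_trace hF, trp_eq_trace hF, traceQuadraticForm_apply,
    Algebra.traceForm_apply, hquad, hblin]
  simp only [map_add]
  ring

lemma autSum_traceAddChar (s l : ℕ) (a b : F) :
    autSum (traceAddChar p F) (iterateFrobeniusEquiv F p l) (iterateFrobeniusEquiv F p s) a b
      = ∑ x, ZMod.stdAddChar (traceQuadraticForm p s l a b x) := rfl

lemma autSum_traceAddChar_smul (s l : ℕ) (y : ZMod p) (a b : F) :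
    autSum (traceAddChar p F) (iterateFrobeniusEquiv F p l) (iterateFrobeniusEquiv F p s)
        (algebraMap (ZMod p) F y * a) (algebraMap (ZMod p) F y * b)
      = ∑ x, ZMod.stdAddChar (y * traceQuadraticForm p s l a b x) := by
  rw [autSum_traceAddChar]
  refine sum_congr rfl fun x _ => ?_
  rw [traceQuadraticForm_apply, traceQuadraticForm_apply, ← smul_eq_mul y, ← map_smul]
  congr 2
  rw [Algebra.smul_def]
  ring

variable [DecidableEq F]

lemma card_codewords_of_weight (hp : p ≠ 2) {s l : ℕ} (hs : 1 ≤ s)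
    (hF : Fintype.card F = p ^ (2 * s)) {a : F} (ha : a ^ p ^ s = a) (b : F)
    [Decidable (autSum (traceAddChar p F) (iterateFrobeniusEquiv F p l)
      (iterateFrobeniusEquiv F p s) (a / 2) b = ((p ^ s : ℕ) : ℂ))] :
    (univ.filter fun t : F × ZMod p =>
        (suppw p s l a b t.1 t.2).card = p ^ (2 * s - 1) * (p - 1) + p ^ (s - 1)).card
      = if autSum (traceAddChar p F) (iterateFrobeniusEquiv F p l)
          (iterateFrobeniusEquiv F p s) (a / 2) b = ((p ^ s : ℕ) : ℂ)
        then p ^ (2 * s) * (p - 1) else 0 := by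
  obtain ⟨r, -, S, -, hy, -, θ, hθ⟩ := quadraticForm_sum_and_weight hp
    (traceQuadraticForm p s l (a / 2) b) hs (finrank_eq_of_card hF)
  have hS : autSum (traceAddChar p F) (iterateFrobeniusEquiv F p l)
      (iterateFrobeniusEquiv F p s) (a / 2) b = S := by
    rw [autSum_traceAddChar]
    simpa using hy 1 one_ne_zero
  have hiff (t : F × ZMod p) :
      (suppw p s l a b t.1 t.2).card = p ^ (2 * s - 1) * (p - 1) + p ^ (s - 1)
        ↔ S = p ^ s ∧ t.2 ≠ θ (Algebra.traceForm (ZMod p) F t.1) := by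
    rw [← hθ, suppw]
    simp only [cword_eq_algebraMap hp hF ha, ne_eq,
      map_eq_zero_iff _ (algebraMap (ZMod p) F).injective]
  rw [filter_congr fun t _ => hiff t]
  split_ifs with h <;> rw [hS, Nat.cast_pow] at h
  · simp only [h, true_and]
    rw [card_filter, Fintype.sum_prod_type]
    have h1 (c : F) : ∑ h : ZMod p,
        (if h ≠ θ (Algebra.traceForm (ZMod p) F c) then 1 else 0) = p - 1 := by
      rw [← card_filter, filter_ne', card_erase_of_mem (mem_univ _), card_univ, ZMod.card]
    simp only [h1]
    rw [sum_const, card_univ, hF, smul_eq_mul]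
  · simp [h]

theorem card_traceAutSum_eq (hp : p ≠ 2) {s l d : ℕ} (hF : Fintype.card F = p ^ (2 * s))
    (hs : 1 ≤ s) (hds : d ∣ s) (hd : Odd d) (hg : Nat.gcd (s + l) (2 * s) = d)
    [DecidablePred fun w : F × F => w.1 ^ p ^ s = w.1 ∧ autSum (traceAddChar p F)
      (iterateFrobeniusEquiv F p l) (iterateFrobeniusEquiv F p s) w.1 w.2 = ((p ^ s : ℕ) : ℂ)] :
    (2 * (p ^ d + 1) * (univ.filter fun w : F × F => w.1 ^ p ^ s = w.1 ∧
        autSum (traceAddChar p F) (iterateFrobeniusEquiv F p l) (iterateFrobeniusEquiv F p s)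
          w.1 w.2 = ((p ^ s : ℕ) : ℂ)).card : ℚ)
      = p ^ d * (p ^ s + 1) * (p ^ (2 * s) - 1) := by
  classical
  have hp1 := (Fact.out : p.Prime).one_lt
  have hp0 : (p : ℝ) ≠ 0 := by exact_mod_cast (by omega : p ≠ 0)
  have hpR : (1 : ℝ) < p := by exact_mod_cast hp1
  have hd1 : 1 ≤ d := hd.pos
  have hdle : d ≤ s := Nat.le_of_dvd (by omega) hds
  have H := commutingAutomorphisms_frobenius (F := F) hp hF hds hg
  have hE : (fixedFinset (iterateFrobeniusEquiv F p s)).card = p ^ s :=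
    card_filter_pow_eq_self hs (Dvd.intro_left 2 rfl) hF
  have hK : (fixedFinset ((iterateFrobeniusEquiv F p s).trans
      (iterateFrobeniusEquiv F p l))).card = p ^ d := by
    rw [← card_filter_pow_eq_self hd1 (hds.mul_left 2) hF, fixedFinset]
    congr 1
    refine filter_congr fun x _ => ?_
    have e : (iterateFrobeniusEquiv F p s).trans (iterateFrobeniusEquiv F p l) x
        = x ^ p ^ (s + l) := by
      rw [RingEquiv.trans_apply, iterateFrobeniusEquiv_def, iterateFrobeniusEquiv_def, ← pow_mul,
        ← pow_add]
    rw [e]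
    constructor
    · intro h
      rw [← hg]
      exact pow_eq_self_of_gcd h (by rw [← hF, FiniteField.pow_card])
    · intro h
      exact pow_eq_self_of_dvd_s4 h (hg ▸ Nat.gcd_dvd_left _ _)
  obtain ⟨y, hy⟩ := quadraticChar_exists_neg_one (F := ZMod p)
    (by rwa [ZMod.ringChar_zmod_n])
  have hy0 : y ≠ 0 := by
    rintro rfl
    simp at hy
  have hqy : qchar p y = -1 := by rw [qchar_apply, hy]; simp
  have hsig (a b : F) := quadraticForm_sum_and_weight hp (traceQuadraticForm p s l a b) hs
    (finrank_eq_of_card hF)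
  have key := H.card_autSum_eq (n := p ^ s) (M := p ^ (s - d)) (κ := p ^ d) hE
    (by rw [hF, ← pow_mul, mul_comm]) hK (by rw [← pow_add]; congr 1; omega)
    (Nat.one_lt_pow (by omega) hp1) (u := algebraMap (ZMod p) F y)
    (by simpa using hy0)
    (by rw [iterateFrobeniusEquiv_def, ← map_pow, ZMod.pow_card_pow])
    (fun a b _ hn => by
      obtain ⟨r, hr, S, hS, hsum, hmax, -⟩ := hsig a b
      have h1 : autSum (traceAddChar p F) (iterateFrobeniusEquiv F p l)
          (iterateFrobeniusEquiv F p s) a b = S := by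
        rw [autSum_traceAddChar]
        simpa using hsum 1 one_ne_zero
      rw [h1] at hn ⊢
      rw [hS, Nat.cast_pow, ← pow_mul] at hn
      have := pow_right_injective₀ (by linarith) hpR.ne' hn
      push_cast
      exact hmax (by omega))
    (fun a b _ hn => by
      obtain ⟨r, hr, S, hS, hsum, -, -⟩ := hsig a b
      have h1 : autSum (traceAddChar p F) (iterateFrobeniusEquiv F p l)
          (iterateFrobeniusEquiv F p s) a b = S := by
        rw [autSum_traceAddChar]
        simpa using hsum 1 one_ne_zero
      rw [h1] at hn
      rw [hS, Nat.cast_pow, Nat.cast_pow, ← pow_mul, ← pow_add] at hn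
      have := pow_right_injective₀ (by linarith) hpR.ne' hn
      have hodd : Odd r := by
        obtain ⟨k, hk⟩ := hd
        exact ⟨s - k - 1, by omega⟩
      rw [autSum_traceAddChar_smul, h1, hsum y hy0, hqy, hodd.neg_one_pow, neg_one_mul])
  push_cast at key
  rw [← pow_mul, mul_comm s 2] at key
  rw [← key]
  congr 3
  refine filter_congr fun w _ => ?_
  rw [Nat.cast_pow]
  exact Iff.rfl

end CodewordCount

theorem stmt4 (p s l : ℕ) [Fact p.Prime] (F : Type) [Field F] [Fintype F] [DecidableEq F]
    [CharP F p] (hodd : Odd p) (hs : 2 ≤ s) (hl1 : 1 ≤ l) (hls : l ≠ s)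
    (hl2 : l ≤ 2 * s - 1) (hF : Fintype.card F = p ^ (2 * s)) (d : ℕ)
    (hd : Nat.gcd s l = d) (hd' : Nat.gcd (s + l) (2 * l) = d) (hdodd : Odd d) :
    (((Finset.univ : Finset (F × F × F × ZMod p)).filter fun t =>
        t.1 ^ p ^ s = t.1 ∧ (suppw p s l t.1 t.2.1 t.2.2.1 t.2.2.2).card
          = p ^ (2 * s - 1) * (p - 1) + p ^ (s - 1)).card : ℚ)
      = (p : ℚ) ^ (2 * s + d) * ((p : ℚ) - 1) * ((p : ℚ) ^ s + 1) * ((p : ℚ) ^ (2 * s) - 1)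
          / (2 * ((p : ℚ) ^ d + 1)) := by
  classical
  let : Algebra (ZMod p) F := ZMod.algebra F p
  have hp : p ≠ 2 := by rintro rfl; exact absurd hodd (by decide)
  have h2 : (2 : F) ≠ 0 := two_ne_zero_of_charP hp
  have h2k : (2 : F) ^ p ^ s = 2 := by rw [← iterateFrobenius_def, map_ofNat]
  have hg : Nat.gcd (s + l) (2 * s) = d := by
    rw [← hd']
    refine Nat.dvd_antisymm (Nat.dvd_gcd (Nat.gcd_dvd_left _ _) ?_)
      (Nat.dvd_gcd (Nat.gcd_dvd_left _ _) ?_)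
    · have h1 : Nat.gcd (s + l) (2 * s) ∣ 2 * s + 2 * l :=
        (Nat.gcd_dvd_left _ _).trans ⟨2, by ring⟩
      exact (Nat.dvd_add_right (Nat.gcd_dvd_right _ _)).mp h1
    · have h1 : Nat.gcd (s + l) (2 * l) ∣ 2 * l + 2 * s :=
        (Nat.gcd_dvd_left _ _).trans ⟨2, by ring⟩
      exact (Nat.dvd_add_right (Nat.gcd_dvd_right _ _)).mp h1
  have hcount := card_traceAutSum_eq (F := F) hp hF (by omega) (hd ▸ Nat.gcd_dvd_left s l) hdodd hg
  set N := (Finset.univ.filter fun w : F × F => w.1 ^ p ^ s = w.1 ∧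
    autSum (traceAddChar p F) (iterateFrobeniusEquiv F p l) (iterateFrobeniusEquiv F p s)
      w.1 w.2 = ((p ^ s : ℕ) : ℂ)).card with hN
  have htotal : ((Finset.univ : Finset (F × F × F × ZMod p)).filter fun t =>
        t.1 ^ p ^ s = t.1 ∧ (suppw p s l t.1 t.2.1 t.2.2.1 t.2.2.2).card
          = p ^ (2 * s - 1) * (p - 1) + p ^ (s - 1)).card = N * (p ^ (2 * s) * (p - 1)) := by
    have hfib (a b : F) : ∑ t : F × ZMod p, (if a ^ p ^ s = a ∧ (suppw p s l a b t.1 t.2).card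
          = p ^ (2 * s - 1) * (p - 1) + p ^ (s - 1) then 1 else 0)
        = (if a ^ p ^ s = a ∧ autSum (traceAddChar p F) (iterateFrobeniusEquiv F p l)
            (iterateFrobeniusEquiv F p s) (a / 2) b = ((p ^ s : ℕ) : ℂ) then 1 else 0)
          * (p ^ (2 * s) * (p - 1)) := by
      by_cases ha : a ^ p ^ s = a
      · simp only [ha, true_and]
        rw [← Finset.card_filter, card_codewords_of_weight hp (by omega) hF ha]
        simp
      · simp [ha]
    rw [Finset.card_filter, Fintype.sum_prod_type]
    simp_rw [Fintype.sum_prod_type (α₁ := F) (α₂ := F × ZMod p), hfib]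
    simp_rw [← Finset.sum_mul]
    congr 1
    rw [← Fintype.sum_prod_type', ← Finset.card_filter, hN]
    refine Finset.card_bij' (fun w _ => (w.1 / 2, w.2)) (fun w _ => (w.1 * 2, w.2)) ?_ ?_ ?_ ?_
    · intro w hw
      simp only [Finset.mem_filter, Finset.mem_univ, true_and] at hw ⊢
      exact ⟨by rw [div_pow, hw.1, h2k], hw.2⟩
    · intro w hw
      simp only [Finset.mem_filter, Finset.mem_univ, true_and] at hw ⊢
      exact ⟨by rw [mul_pow, hw.1, h2k], by rw [mul_div_cancel_right₀ _ h2]; exact hw.2⟩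
    · intro w _
      exact Prod.ext (div_mul_cancel₀ _ h2) rfl
    · intro w _
      exact Prod.ext (mul_div_cancel_right₀ _ h2) rfl
  rw [htotal, eq_div_iff (by positivity)]
  rw [Nat.cast_mul, Nat.cast_mul, Nat.cast_sub (Fact.out : p.Prime).one_le]
  push_cast
  rw [pow_add]
  linear_combination ((p : ℚ) ^ (2 * s) * (p - 1)) * hcount
end
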